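/- arXiv:2012.14380 — 2 statements merged into one kernel-verified Lean document; each statement's English description precedes it below -/
import Mathlib

section
/- For every d-polytope P with d ≥ 3, the excess degree 2·f_1(P) − d·f_0(P) is never strictly between 0 and d − 2; moreover, the values 0 and d − 2 are both attained by d-polytopes, so 0 and d − 2 are the two smallest possible excess degrees of d-polytopes. -/
open Set

/-- A polytope: the convex hull of a finite set of points. -/
def IsPolytope {n : ℕ} (P : Set (Fin n → ℝ)) : Prop :=
  ∃ S : Finset (Fin n → ℝ), P = convexHull ℝ (S : Set (Fin n → ℝ))

/-- The affine dimension of a set: the rank of its vector span. -/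
noncomputable def adim {n : ℕ} (P : Set (Fin n → ℝ)) : ℕ :=
  Module.finrank ℝ (vectorSpan ℝ P)

/-- A `d`-polytope: a polytope whose affine hull has dimension `d`. -/
def IsDPolytope (d : ℕ) {n : ℕ} (P : Set (Fin n → ℝ)) : Prop :=
  IsPolytope P ∧ adim P = d

/-- An edge of `P`: a face (an extreme convex subset) of affine dimension 1. -/
def IsEdge {n : ℕ} (P E : Set (Fin n → ℝ)) : Prop :=
  IsExtreme ℝ P E ∧ Convex ℝ E ∧ adim E = 1

/-- `f₀ P`: the number of vertices (extreme points) of `P`. -/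
noncomputable def f₀ {n : ℕ} (P : Set (Fin n → ℝ)) : ℕ :=
  (Set.extremePoints ℝ P).ncard

/-- `f₁ P`: the number of edges of `P`. -/
noncomputable def f₁ {n : ℕ} (P : Set (Fin n → ℝ)) : ℕ :=
  {E : Set (Fin n → ℝ) | IsEdge P E}.ncard

/-- `E^d`: the set of `(f₀, f₁)` pairs realized by `d`-polytopes. -/
def fPairs (d : ℕ) : Set (ℕ × ℕ) :=
  {p | ∃ (n : ℕ) (P : Set (Fin n → ℝ)), IsDPolytope d P ∧ f₀ P = p.1 ∧ f₁ P = p.2}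

open scoped Classical in
/-- The vertices of a polytope, as a finset. -/
noncomputable def verts {n : ℕ} (P : Set (Fin n → ℝ)) : Finset (Fin n → ℝ) :=
  if h : (P.extremePoints ℝ).Finite then h.toFinset else ∅

open scoped Classical in
/-- The neighbours of `v` in the graph of `P`. -/
noncomputable def nbrs {n : ℕ} (P : Set (Fin n → ℝ)) (v : Fin n → ℝ) : Finset (Fin n → ℝ) :=
  {u ∈ verts P | u ≠ v ∧ IsExtreme ℝ P (segment ℝ v u)}

section Basic

variable {n : ℕ} {P F : Set (Fin n → ℝ)} {u v : Fin n → ℝ}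

lemma IsPolytope.convex (hP : IsPolytope P) : Convex ℝ P := by
  obtain ⟨S, rfl⟩ := hP
  exact convex_convexHull ℝ _

lemma IsPolytope.finite_extremePoints (hP : IsPolytope P) : (P.extremePoints ℝ).Finite := by
  obtain ⟨S, rfl⟩ := hP
  exact S.finite_toSet.subset extremePoints_convexHull_subset

lemma coe_verts (hP : IsPolytope P) : (verts P : Set (Fin n → ℝ)) = P.extremePoints ℝ := by
  simp [verts, hP.finite_extremePoints]

lemma mem_verts (hP : IsPolytope P) : v ∈ verts P ↔ v ∈ P.extremePoints ℝ := by
  rw [← coe_verts hP, Finset.mem_coe]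

lemma convexHull_verts (hP : IsPolytope P) : convexHull ℝ (verts P : Set (Fin n → ℝ)) = P := by
  have hc : IsCompact P := by
    obtain ⟨S, rfl⟩ := hP
    exact S.finite_toSet.isCompact_convexHull ℝ
  have h := closure_convexHull_extremePoints hc hP.convex
  rwa [IsClosed.closure_eq (hP.finite_extremePoints.isClosed_convexHull ℝ), ← coe_verts hP] at h

lemma verts_subset (hP : IsPolytope P) : (verts P : Set (Fin n → ℝ)) ⊆ P := by
  rw [coe_verts hP]; exact extremePoints_subset

lemma IsPolytope.of_isExtreme (hP : IsPolytope P) (hF : IsExtreme ℝ P F) (hc : Convex ℝ F) :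
    IsPolytope F := by
  classical
  obtain ⟨S, rfl⟩ := hP
  refine ⟨{s ∈ S | s ∈ F}, Set.Subset.antisymm ?_ ?_⟩
  · intro x hx
    have hsub : ((S : Set (Fin n → ℝ)) \ F) ⊆ convexHull ℝ (S : Set (Fin n → ℝ)) \ F :=
      fun s hs => ⟨subset_convexHull ℝ _ hs.1, hs.2⟩
    have hsd := convexHull_min hsub (hF.convex_sdiff (convex_convexHull ℝ _))
    have hU : (S : Set (Fin n → ℝ)) =
        (({s ∈ S | s ∈ F} : Finset (Fin n → ℝ)) : Set (Fin n → ℝ)) ∪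
          ((S : Set (Fin n → ℝ)) \ F) := by
      ext s; by_cases h : s ∈ F <;> simp [h]
    have hxP := hF.subset hx
    rcases Set.eq_empty_or_nonempty (({s ∈ S | s ∈ F} : Finset (Fin n → ℝ)) : Set (Fin n → ℝ))
      with h1 | h1
    · rw [h1, empty_union] at hU
      rw [hU] at hxP
      exact absurd hx (hsd (hU ▸ hxP)).2
    rcases Set.eq_empty_or_nonempty ((S : Set (Fin n → ℝ)) \ F) with h2 | h2
    · rw [h2, union_empty] at hU
      rwa [hU] at hxP
    have hxP' := hxP
    rw [hU, convexHull_union h1 h2, mem_convexJoin] at hxP'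
    obtain ⟨a, ha, b, hb, hxab⟩ := hxP'
    by_cases hxa : x = a
    · exact hxa ▸ ha
    have haF : a ∈ F := convexHull_min (fun s hs => by simp at hs; exact hs.2) hc ha
    have hbF := (hsd hb).2
    have hxb : x ≠ b := fun h => hbF (h ▸ hx)
    exact absurd (hF.right_mem_of_mem_openSegment (hF.subset haF) (hsd hb).1 hx
      (mem_openSegment_of_ne_left_right (Ne.symm hxa) (Ne.symm hxb) hxab)) hbF
  · exact convexHull_min (fun s hs => by simp at hs; exact hs.2) hc

lemma right_mem_extremePoints_segment (v u : Fin n → ℝ) : u ∈ (segment ℝ v u).extremePoints ℝ := by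
  refine mem_extremePoints_iff_left.2 ⟨right_mem_segment _ _ _, ?_⟩
  rintro x ⟨a, b, ha, hb, hab, rfl⟩ y ⟨c, d, hc, hd, hcd, rfl⟩ ⟨e, f, he, hf, hef, hu⟩
  obtain rfl : b = 1 - a := by linarith
  obtain rfl : d = 1 - c := by linarith
  obtain rfl : f = 1 - e := by linarith
  have h0 : (e * a + (1 - e) * c) • (v - u) = 0 := by
    linear_combination (norm := module) hu
  rcases smul_eq_zero.1 h0 with h1 | h1
  · have : e * a = 0 := by nlinarith [mul_nonneg he.le ha, mul_nonneg hf.le hc]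
    have : a = 0 := by simpa [he.ne'] using this
    simp [this]
  · rw [sub_eq_zero.1 h1, ← add_smul]; simp

lemma extremePoints_segment (v u : Fin n → ℝ) : (segment ℝ v u).extremePoints ℝ = {v, u} := by
  refine Set.Subset.antisymm ?_ ?_
  · rw [← convexHull_pair]
    exact extremePoints_convexHull_subset
  · rintro x (rfl | rfl)
    · rw [segment_symm]
      exact right_mem_extremePoints_segment _ _
    · exact right_mem_extremePoints_segment _ _

lemma mem_nbrs (hP : IsPolytope P) :
    u ∈ nbrs P v ↔ u ≠ v ∧ IsExtreme ℝ P (segment ℝ v u) := by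
  classical
  simp only [nbrs, Finset.mem_filter, mem_verts hP, and_iff_right_iff_imp]
  rintro ⟨-, h⟩
  exact h.extremePoints_subset_extremePoints (right_mem_extremePoints_segment v u)

lemma mem_verts_of_mem_nbrs (hu : u ∈ nbrs P v) : u ∈ verts P := by
  classical
  exact (Finset.mem_filter.1 hu).1

lemma mem_nbrs_comm (hP : IsPolytope P) : u ∈ nbrs P v ↔ v ∈ nbrs P u := by
  rw [mem_nbrs hP, mem_nbrs hP, ne_comm, segment_symm]

lemma verts_of_isExtreme (hP : IsPolytope P) (hF : IsExtreme ℝ P F) (hc : Convex ℝ F) :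
    u ∈ verts F ↔ u ∈ verts P ∧ u ∈ F := by
  rw [mem_verts hP, mem_verts (hP.of_isExtreme hF hc), hF.extremePoints_eq, and_comm]; rfl

lemma nbrs_of_isExtreme (hP : IsPolytope P) (hF : IsExtreme ℝ P F) (hc : Convex ℝ F) (hv : v ∈ F) :
    u ∈ nbrs F v ↔ u ∈ nbrs P v ∧ u ∈ F := by
  rw [mem_nbrs hP, mem_nbrs (hP.of_isExtreme hF hc)]
  constructor
  · rintro ⟨h1, h2⟩
    exact ⟨⟨h1, hF.trans h2⟩, h2.subset (right_mem_segment _ _ _)⟩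
  · rintro ⟨⟨h1, h2⟩, h3⟩
    exact ⟨h1, h2.mono hF.subset (hc.segment_subset hv h3)⟩

lemma notMem_convexHull_verts_erase [DecidableEq (Fin n → ℝ)] (hP : IsPolytope P)
    (hv : v ∈ verts P) :
    v ∉ convexHull ℝ ((verts P).erase v : Set (Fin n → ℝ)) := by
  intro h
  have hsub : convexHull ℝ ((verts P).erase v : Set (Fin n → ℝ)) ⊆ P :=
    convexHull_min (fun x hx => verts_subset hP (Finset.mem_of_mem_erase hx)) hP.convex
  have := extremePoints_convexHull_subset
    (inter_extremePoints_subset_extremePoints_of_subset hsub ⟨h, (mem_verts hP).1 hv⟩)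
  simp at this

lemma eq_zero_of_sum_smul_sub_eq_zero [DecidableEq (Fin n → ℝ)] (hP : IsPolytope P)
    (hv : v ∈ verts P) {T : Finset (Fin n → ℝ)} (hT : T ⊆ (verts P).erase v) {c : (Fin n → ℝ) → ℝ}
    (hc : ∀ u ∈ T, 0 ≤ c u) (h0 : ∑ u ∈ T, c u • (u - v) = 0) : ∀ u ∈ T, c u = 0 := by
  by_contra! hne
  obtain ⟨w, hw, hw0⟩ := hne
  have hpos : 0 < ∑ u ∈ T, c u :=
    Finset.sum_pos' hc ⟨w, hw, lt_of_le_of_ne (hc w hw) (Ne.symm hw0)⟩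
  refine notMem_convexHull_verts_erase hP hv ?_
  have := Finset.centerMass_mem_convexHull (R := ℝ) T (w := c) hc hpos (z := id)
    (s := ((verts P).erase v : Set (Fin n → ℝ))) (fun i hi => hT hi)
  convert this
  simp only [smul_sub, Finset.sum_sub_distrib, ← Finset.sum_smul, sub_eq_zero] at h0
  rw [Finset.centerMass]
  simp only [id, h0]
  rw [smul_smul, inv_mul_cancel₀ hpos.ne', one_smul]

/-- A polytope lies in the cone spanned at a vertex by the edges through it. -/
lemma exists_sum_nbrs (hP : IsPolytope P) (hv : v ∈ verts P) {p : Fin n → ℝ} (hp : p ∈ P) :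
    ∃ c : (Fin n → ℝ) → ℝ, (∀ u, 0 ≤ c u) ∧ p - v = ∑ u ∈ nbrs P v, c u • (u - v) := by
  classical
  let Q : Finset (Fin n → ℝ) → Prop := fun T => ∀ p ∈ P,
    ∃ c : (Fin n → ℝ) → ℝ, (∀ u, 0 ≤ c u) ∧ p - v = ∑ u ∈ T, c u • (u - v)
  have hQ : Q ((verts P).erase v) := by
    intro p hp
    rw [← convexHull_verts hP, Finset.mem_convexHull'] at hp
    obtain ⟨w, hw, hw1, rfl⟩ := hp
    refine ⟨fun u => max (w u) 0, fun u => le_max_right _ _, ?_⟩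
    calc _ = ∑ u ∈ verts P, w u • (u - v) := by
          simp [smul_sub, Finset.sum_sub_distrib, ← Finset.sum_smul, hw1]
      _ = ∑ u ∈ (verts P).erase v, w u • (u - v) :=
          (Finset.sum_erase _ (by simp)).symm
      _ = _ := Finset.sum_congr rfl fun u hu => by
          simp only [max_eq_left (hw u (Finset.mem_of_mem_erase hu))]
  obtain ⟨T, hT, hmin⟩ := exists_minimal_le_of_wellFoundedLT Q _ hQ
  suffices hTN : T ⊆ nbrs P v by
    obtain ⟨c, hc, hpc⟩ := hmin.prop p hp
    refine ⟨fun u => if u ∈ T then c u else 0, fun u => by dsimp only; split_ifs <;> simp [hc], ?_⟩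
    rw [hpc, ← Finset.sum_subset hTN]
    · exact Finset.sum_congr rfl fun u hu => by simp only [if_pos hu]
    · intro u _ hu; simp [hu]
  intro t ht
  have htv : t ≠ v := Finset.ne_of_mem_erase (hT ht)
  have htP : t ∈ verts P := Finset.mem_of_mem_erase (hT ht)
  have hvP := verts_subset hP hv
  rw [mem_nbrs hP]
  refine ⟨htv, hP.convex.segment_subset hvP (verts_subset hP htP), ?_⟩
  rintro p hp q hq x hx ⟨a, b, ha, hb, hab, hpq⟩
  obtain ⟨α, hα, hpα⟩ := hmin.prop p hp
  obtain ⟨β, hβ, hqβ⟩ := hmin.prop q hq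
  rw [segment_eq_image'] at hx
  obtain ⟨l, ⟨hl0, hl1⟩, rfl⟩ := hx
  let γ : (Fin n → ℝ) → ℝ := fun u => a * α u + b * β u
  have hγ : ∀ u, 0 ≤ γ u := fun u => add_nonneg (mul_nonneg ha.le (hα u)) (mul_nonneg hb.le (hβ u))
  have hsum : l • (t - v) = ∑ u ∈ T, γ u • (u - v) := by
    have h1 : l • (t - v) = a • (p - v) + b • (q - v) := by
      have : b = 1 - a := by linarith
      subst this
      simp only at hpq
      linear_combination (norm := module) -hpq
    rw [h1, hpα, hqβ, Finset.smul_sum, Finset.smul_sum, ← Finset.sum_add_distrib]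
    exact Finset.sum_congr rfl fun u _ => by simp only [γ, add_smul, mul_smul]
  have hsplit : ∀ c : (Fin n → ℝ) → ℝ, ∑ u ∈ T, c u • (u - v) =
      c t • (t - v) + ∑ u ∈ T.erase t, c u • (u - v) := fun c =>
    (Finset.add_sum_erase T (fun u => c u • (u - v)) ht).symm
  by_cases hlt : γ t < l
  · exfalso
    have hQ' : Q (T.erase t) := by
      intro p hp
      obtain ⟨c, hc, hpc⟩ := hmin.prop p hp
      refine ⟨fun u => c u + c t * (l - γ t)⁻¹ * γ u, fun u => add_nonneg (hc u) (mul_nonneg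
        (mul_nonneg (hc t) (inv_nonneg.2 (by linarith))) (hγ u)), ?_⟩
      have h2 : (l - γ t) • (t - v) = ∑ u ∈ T.erase t, γ u • (u - v) := by
        rw [hsplit] at hsum
        rw [sub_smul, hsum]; abel
      have h3 : t - v = (l - γ t)⁻¹ • ∑ u ∈ T.erase t, γ u • (u - v) := by
        rw [← h2, smul_smul, inv_mul_cancel₀ (by linarith), one_smul]
      rw [hpc, hsplit]
      simp only [add_smul, Finset.sum_add_distrib, mul_smul, ← Finset.smul_sum]
      rw [← h3]; abel
    exact Finset.notMem_erase t T (hmin.le_of_le hQ' (Finset.erase_subset t T) ht)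
  · have hz := eq_zero_of_sum_smul_sub_eq_zero hP hv hT
      (c := fun u => if u = t then γ t - l else γ u)
      (fun u _ => by split_ifs; exacts [by linarith, hγ u]) (by
        rw [hsplit]
        simp only [if_true]
        rw [Finset.sum_congr rfl (g := fun u => γ u • (u - v))
          (fun u hu => by rw [if_neg (Finset.ne_of_mem_erase hu)])]
        rw [hsplit] at hsum
        rw [sub_smul, hsum]; abel)
    have hα0 : ∀ u ∈ T.erase t, α u • (u - v) = 0 := by
      intro u hu
      have := hz u (Finset.mem_of_mem_erase hu)
      simp only [if_neg (Finset.ne_of_mem_erase hu), γ] at this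
      have h4 : a * α u = 0 := by nlinarith [mul_nonneg ha.le (hα u), mul_nonneg hb.le (hβ u)]
      have : α u = 0 := by simpa [ha.ne'] using h4
      simp [this]
    have hpt : p - v = α t • (t - v) := by
      rw [hpα, hsplit, Finset.sum_eq_zero hα0, add_zero]
    have hpv : p = v + α t • (t - v) := by rw [← hpt]; abel
    have hle : α t ≤ 1 := by
      by_contra! hgt
      have hpos : 0 < α t := by linarith
      have := ((mem_extremePoints_iff_left.1 ((mem_verts hP).1 htP)).2 v hvP p hp
        ⟨1 - (α t)⁻¹, (α t)⁻¹, by rw [sub_pos]; exact inv_lt_one_of_one_lt₀ hgt, inv_pos.2 hpos,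
          by ring, by
            rw [hpv, smul_add, smul_smul, inv_mul_cancel₀ hpos.ne', sub_smul, one_smul,
              one_smul]
            abel⟩)
      exact htv this.symm
    rw [segment_eq_image']
    exact ⟨α t, ⟨hα t, hle⟩, hpv.symm⟩

lemma vectorSpan_eq_span_nbrs (hP : IsPolytope P) (hv : v ∈ verts P) :
    vectorSpan ℝ P = Submodule.span ℝ ((fun u => u - v) '' (nbrs P v : Set (Fin n → ℝ))) := by
  have hvP := verts_subset hP hv
  rw [vectorSpan_eq_span_vsub_set_right ℝ hvP]
  apply le_antisymm
  · rw [Submodule.span_le]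
    rintro _ ⟨p, hp, rfl⟩
    obtain ⟨c, -, hpc⟩ := exists_sum_nbrs hP hv hp
    simp only [vsub_eq_sub, SetLike.mem_coe]
    rw [hpc]
    exact Submodule.sum_mem _ fun u hu => Submodule.smul_mem _ _
      (Submodule.subset_span ⟨u, hu, rfl⟩)
  · refine Submodule.span_mono (Set.image_mono fun u hu => ?_)
    exact verts_subset hP (mem_verts_of_mem_nbrs hu)

lemma adim_le_card_nbrs (hP : IsPolytope P) (hv : v ∈ verts P) : adim P ≤ (nbrs P v).card := by
  classical
  rw [adim, vectorSpan_eq_span_nbrs hP hv, ← Finset.coe_image]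
  exact (finrank_span_finset_le_card _).trans Finset.card_image_le

end Basic

/-- The cone of feasible directions of `P` at `v`. -/
def feasible {n : ℕ} (P : Set (Fin n → ℝ)) (v : Fin n → ℝ) : Set (Fin n → ℝ) :=
  {a | ∃ ε : ℝ, 0 < ε ∧ v + ε • a ∈ P}

/-- The subset of `P` on which the functional `l` takes the same value as at `v`. -/
def level {n : ℕ} (P : Set (Fin n → ℝ)) (v : Fin n → ℝ) (l : (Fin n → ℝ) →ₗ[ℝ] ℝ) :
    Set (Fin n → ℝ) :=
  {p ∈ P | l (p - v) = 0}

/-- The functional `l` supports `P` at `v`, cutting out a facet of `P`. -/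
def SupportsFacet {n : ℕ} (P : Set (Fin n → ℝ)) (v : Fin n → ℝ) (l : (Fin n → ℝ) →ₗ[ℝ] ℝ) : Prop :=
  (∀ p ∈ P, 0 ≤ l (p - v)) ∧ adim (level P v l) + 1 = adim P

section Cone

variable {n : ℕ} {P : Set (Fin n → ℝ)} {u v a b : Fin n → ℝ} {l : (Fin n → ℝ) →ₗ[ℝ] ℝ}

lemma sub_mem_feasible (hu : u ∈ P) : u - v ∈ feasible P v :=
  ⟨1, one_pos, by simpa using hu⟩

lemma Convex.exists_forall_le_of_mem_feasible (hP : Convex ℝ P) (hv : v ∈ P)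
    (ha : a ∈ feasible P v) :
    ∃ ε : ℝ, 0 < ε ∧ ∀ t : ℝ, 0 ≤ t → t ≤ ε → v + t • a ∈ P := by
  obtain ⟨ε, hε, h⟩ := ha
  refine ⟨ε, hε, fun t ht hte => ?_⟩
  have := hP.add_smul_sub_mem hv h (t := t / ε) ⟨by positivity, (div_le_one hε).2 hte⟩
  convert this using 2
  rw [add_sub_cancel_left, smul_smul, div_mul_cancel₀ _ hε.ne']

lemma smul_mem_feasible (hP : Convex ℝ P) (hv : v ∈ P) (ha : a ∈ feasible P v) {t : ℝ}
    (ht : 0 ≤ t) : t • a ∈ feasible P v := by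
  obtain ⟨ε, hε, h⟩ := hP.exists_forall_le_of_mem_feasible hv ha
  refine ⟨ε / (t + 1), by positivity, ?_⟩
  rw [smul_smul]
  refine h _ (by positivity) ?_
  rw [div_mul_eq_mul_div, div_le_iff₀ (by positivity)]
  nlinarith

lemma add_mem_feasible (hP : Convex ℝ P) (hv : v ∈ P) (ha : a ∈ feasible P v)
    (hb : b ∈ feasible P v) : a + b ∈ feasible P v := by
  obtain ⟨ε, hε, h⟩ := hP.exists_forall_le_of_mem_feasible hv ha
  obtain ⟨δ, hδ, h'⟩ := hP.exists_forall_le_of_mem_feasible hv hb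
  have hm : 0 < min ε δ := lt_min hε hδ
  refine ⟨min ε δ / 2, by positivity, ?_⟩
  have := hP (h _ hm.le (min_le_left _ _)) (h' _ hm.le (min_le_right _ _))
    (by norm_num : (0 : ℝ) ≤ 1 / 2) (by norm_num : (0 : ℝ) ≤ 1 / 2) (by norm_num)
  convert this using 1
  module

lemma sum_mem_feasible (hP : Convex ℝ P) (hv : v ∈ P) {T : Finset (Fin n → ℝ)}
    (hT : ∀ u ∈ T, u ∈ P) {c : (Fin n → ℝ) → ℝ} (hc : ∀ u ∈ T, 0 ≤ c u) :
    ∑ u ∈ T, c u • (u - v) ∈ feasible P v :=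
  Finset.sum_induction _ (· ∈ feasible P v) (fun _ _ => add_mem_feasible hP hv)
    ⟨1, one_pos, by simpa using hv⟩
    fun u hu => smul_mem_feasible hP hv (sub_mem_feasible (hT u hu)) (hc u hu)

/-- An edge spans an extreme ray of the cone of feasible directions. -/
lemma exists_smul_of_add_eq_smul (hP : Convex ℝ P) (hv : v ∈ P) (hu : IsExtreme ℝ P (segment ℝ v u))
    (ha : a ∈ feasible P v) (hb : b ∈ feasible P v) {t : ℝ} (ht : 0 ≤ t)
    (hab : a + b = t • (u - v)) : ∃ s : ℝ, a = s • (u - v) := by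
  obtain ⟨ε, hε, h⟩ := hP.exists_forall_le_of_mem_feasible hv ha
  obtain ⟨δ, hδ, h'⟩ := hP.exists_forall_le_of_mem_feasible hv hb
  obtain ⟨r, hr, hre, hrd, hrt⟩ : ∃ r : ℝ, 0 < r ∧ r ≤ ε ∧ r ≤ δ ∧ r / 2 * t ≤ 1 := by
    refine ⟨min (min ε δ) (1 / (t + 1)), by positivity, (min_le_left _ _).trans (min_le_left _ _),
      (min_le_left _ _).trans (min_le_right _ _), ?_⟩
    have h1 : min (min ε δ) (1 / (t + 1)) * t ≤ 1 / (t + 1) * t :=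
      mul_le_mul_of_nonneg_right (min_le_right _ _) ht
    have h2 : 1 / (t + 1) * t ≤ 1 := by
      rw [div_mul_eq_mul_div, div_le_iff₀ (by positivity)]; linarith
    linarith
  have hx : v + (r / 2 * t) • (u - v) ∈ segment ℝ v u := by
    rw [segment_eq_image']
    exact ⟨_, ⟨by positivity, hrt⟩, rfl⟩
  have := hu.left_mem_of_mem_openSegment (h r hr.le hre) (h' r hr.le hrd) hx
    ⟨1 / 2, 1 / 2, by norm_num, by norm_num, by norm_num, by
      rw [mul_smul, ← hab]; module⟩
  rw [segment_eq_image'] at this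
  obtain ⟨s, -, hs⟩ := this
  refine ⟨r⁻¹ * s, ?_⟩
  simp only [add_right_inj] at hs
  rw [mul_smul, hs, smul_smul, inv_mul_cancel₀ hr.ne', one_smul]

lemma isExtreme_level (hl : ∀ p ∈ P, 0 ≤ l (p - v)) : IsExtreme ℝ P (level P v l) := by
  refine ⟨fun p hp => hp.1, ?_⟩
  rintro x hx y hy z ⟨hz, hz0⟩ ⟨a, b, ha, hb, hab, rfl⟩
  refine ⟨hx, ?_⟩
  have h1 : l (a • x + b • y - v) = a * l (x - v) + b * l (y - v) := by
    obtain rfl : b = 1 - a := by linarith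
    simp only [map_sub, map_add, map_smul, smul_eq_mul]; ring
  have h2 := mul_nonneg ha.le (hl x hx)
  have h3 := mul_nonneg hb.le (hl y hy)
  have h4 : a * l (x - v) = 0 := by linarith
  simpa [ha.ne'] using h4

lemma convex_level (hP : Convex ℝ P) : Convex ℝ (level P v l) := by
  have : level P v l = P ∩ {p | l p = l v} := by
    ext p; simp [level, sub_eq_zero]
  rw [this]
  exact hP.inter (convex_hyperplane l.isLinear _)

lemma left_mem_level (hv : v ∈ P) : v ∈ level P v l := ⟨hv, by simp⟩

lemma IsPolytope.level (hP : IsPolytope P) (hl : ∀ p ∈ P, 0 ≤ l (p - v)) :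
    IsPolytope (level P v l) :=
  hP.of_isExtreme (isExtreme_level hl) (convex_level hP.convex)

lemma mem_nbrs_level (hP : IsPolytope P) (hv : v ∈ P) (hl : ∀ p ∈ P, 0 ≤ l (p - v)) :
    u ∈ nbrs (level P v l) v ↔ u ∈ nbrs P v ∧ l (u - v) = 0 := by
  rw [nbrs_of_isExtreme hP (isExtreme_level hl) (convex_level hP.convex) (left_mem_level hv)]
  refine and_congr_right fun hu => ⟨fun h => h.2, fun h => ⟨?_, h⟩⟩
  exact verts_subset hP (mem_verts_of_mem_nbrs hu)

lemma mem_verts_level (hP : IsPolytope P) (hl : ∀ p ∈ P, 0 ≤ l (p - v)) :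
    u ∈ verts (level P v l) ↔ u ∈ verts P ∧ l (u - v) = 0 := by
  rw [verts_of_isExtreme hP (isExtreme_level hl) (convex_level hP.convex)]
  exact and_congr_right fun hu => ⟨fun h => h.2, fun h => ⟨verts_subset hP hu, h⟩⟩

/-- Among the functionals nonnegative on a finite set `T` and negative at `x`, there is one whose
zeros in `T` span a hyperplane of the span of `T`. -/
lemma exists_functional_finrank_span_zeros {T : Finset (Fin n → ℝ)} {x : Fin n → ℝ}
    (hx : x ∈ Submodule.span ℝ (T : Set (Fin n → ℝ))) (hl : ∀ t ∈ T, 0 ≤ l t) (hlx : l x < 0) :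
    ∃ l' : (Fin n → ℝ) →ₗ[ℝ] ℝ, (∀ t ∈ T, 0 ≤ l' t) ∧ l' x < 0 ∧
      Module.finrank ℝ (Submodule.span ℝ {t | t ∈ T ∧ l' t = 0}) + 1 =
        Module.finrank ℝ (Submodule.span ℝ (T : Set (Fin n → ℝ))) := by
  classical
  set W := Submodule.span ℝ (T : Set (Fin n → ℝ)) with hW
  induction hk : Module.finrank ℝ W - Module.finrank ℝ (Submodule.span ℝ {t | t ∈ T ∧ l t = 0})
    using Nat.strong_induction_on generalizing l with
  | _ k ih =>
  set Z := Submodule.span ℝ {t | t ∈ T ∧ l t = 0} with hZ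
  have hZW : Z ≤ W := Submodule.span_mono fun t ht => ht.1
  have hZl : Z ≤ LinearMap.ker l := by
    rw [hZ, Submodule.span_le]; exact fun t ht => ht.2
  have hlt : Z < W := lt_of_le_of_ne hZW fun h => by
    have : x ∈ LinearMap.ker l := hZl (h ▸ hx)
    rw [LinearMap.mem_ker] at this; linarith
  have hfr := Submodule.finrank_lt_finrank_of_lt hlt
  rcases Nat.lt_or_ge (Module.finrank ℝ Z + 1) (Module.finrank ℝ W) with h1 | h1
  swap
  · exact ⟨l, hl, hlx, by rw [← hZ]; omega⟩
  have hne : ¬ W ≤ Z ⊔ Submodule.span ℝ {x} := by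
    intro hle
    have h2 := Submodule.finrank_mono hle
    have h3 := Submodule.finrank_add_le_finrank_add_finrank Z (Submodule.span ℝ {x})
    have h4 : Module.finrank ℝ (Submodule.span ℝ {x}) ≤ 1 := by
      simpa using finrank_span_le_card (R := ℝ) ({x} : Set (Fin n → ℝ))
    omega
  obtain ⟨m, t₁, ht₁, hm₁, hmZ, hmx⟩ : ∃ m : (Fin n → ℝ) →ₗ[ℝ] ℝ, ∃ t₁ ∈ T, m t₁ < 0 ∧
      Z ≤ LinearMap.ker m ∧ m x = 0 := by
    rw [hW, Submodule.span_le, Set.not_subset] at hne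
    obtain ⟨t₁, ht₁, hn⟩ := hne
    obtain ⟨f, hf, hle⟩ := Submodule.exists_le_ker_of_notMem hn
    have hfx : f x = 0 := hle (Submodule.mem_sup_right (Submodule.mem_span_singleton_self x))
    have hfZ : Z ≤ LinearMap.ker f := le_sup_left.trans hle
    rcases lt_or_gt_of_ne hf with h | h
    · exact ⟨f, t₁, ht₁, h, hfZ, hfx⟩
    · exact ⟨-f, t₁, ht₁, by simpa using h, fun z hz => by
        simpa using hfZ hz, by simp [hfx]⟩
  obtain ⟨t₀, ht₀, hmin⟩ := Finset.exists_min_image {t ∈ T | m t < 0} (fun t => l t / (-m t))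
    ⟨t₁, by simp [ht₁, hm₁]⟩
  simp only [Finset.mem_filter] at ht₀ hmin
  set τ := l t₀ / (-m t₀) with hτ
  have hτ0 : 0 ≤ τ := div_nonneg (hl _ ht₀.1) (by linarith)
  have hτ1 : (l + τ • m) t₀ = 0 := by
    have := ht₀.2.ne
    simp only [LinearMap.add_apply, LinearMap.smul_apply, smul_eq_mul, hτ]
    field_simp
    simp
  have hnn : ∀ t ∈ T, 0 ≤ (l + τ • m) t := by
    intro t ht
    simp only [LinearMap.add_apply, LinearMap.smul_apply, smul_eq_mul]
    rcases lt_or_ge (m t) 0 with h | h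
    · have := hmin t ⟨ht, h⟩
      rw [le_div_iff₀ (by linarith)] at this
      linarith
    · exact add_nonneg (hl t ht) (mul_nonneg hτ0 h)
  have hxx : (l + τ • m) x < 0 := by simpa [hmx] using hlx
  have hlt' : Z < Submodule.span ℝ {t | t ∈ T ∧ (l + τ • m) t = 0} := by
    refine lt_of_le_of_ne (Submodule.span_mono fun t ht => ⟨ht.1, ?_⟩) fun h => ?_
    · have : m t = 0 := hmZ (Submodule.subset_span ht)
      simp [ht.2, this]
    · have h5 : t₀ ∈ Z := h ▸ Submodule.subset_span ⟨ht₀.1, hτ1⟩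
      have : m t₀ = 0 := hmZ h5
      linarith [ht₀.2]
  have := Submodule.finrank_lt_finrank_of_lt hlt'
  exact ih _ (by omega) hnn hxx rfl

lemma exists_functional_of_notMem_feasible (hP : IsPolytope P) (hv : v ∈ verts P) {x : Fin n → ℝ}
    (hx : x ∉ feasible P v) :
    ∃ l : (Fin n → ℝ) →ₗ[ℝ] ℝ, (∀ p ∈ verts P, 0 ≤ l (p - v)) ∧ l x < 0 := by
  classical
  set K := convexHull ℝ ((verts P).erase v : Set (Fin n → ℝ)) with hK
  have hKP : K ⊆ P :=
    convexHull_min (fun x hx => verts_subset hP (Finset.mem_of_mem_erase hx)) hP.convex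
  let R : Set (Fin n → ℝ) := (fun t : ℝ => v + t • x) '' Set.Ici 0
  have hx0 : x ≠ 0 := fun h => hx (by
    rw [h]; exact ⟨1, one_pos, by simpa using verts_subset hP hv⟩)
  have hRc : Convex ℝ R := by
    rintro _ ⟨s, hs, rfl⟩ _ ⟨t, ht, rfl⟩ a b ha hb hab
    refine ⟨a * s + b * t, add_nonneg (mul_nonneg ha hs) (mul_nonneg hb ht), ?_⟩
    obtain rfl : b = 1 - a := by linarith
    simp only
    module
  have hRcl : IsClosed R := by
    have h1 : Topology.IsClosedEmbedding (fun t : ℝ => v + t • x) :=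
      (Homeomorph.addLeft v).isClosedEmbedding.comp
        (isClosedEmbedding_smul_left hx0)
    exact h1.isClosedMap _ isClosed_Ici
  have hdisj : Disjoint K R := by
    rw [Set.disjoint_left]
    rintro _ hk ⟨t, ht, rfl⟩
    rcases eq_or_lt_of_le (show (0 : ℝ) ≤ t from ht) with h | h
    · rw [← h] at hk
      exact notMem_convexHull_verts_erase hP hv (by simpa only [zero_smul, add_zero] using hk)
    · exact hx ⟨t, h, hKP hk⟩
  obtain ⟨f, α, β, hfα, hαβ, hfβ⟩ := geometric_hahn_banach_compact_closed
    (convex_convexHull ℝ _) (((verts P).erase v).finite_toSet.isCompact_convexHull ℝ) hRc hRcl hdisj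
  have hfv : β < f v := hfβ v ⟨0, Set.self_mem_Ici, by simp⟩
  have hfx : 0 ≤ f x := by
    by_contra! h
    have := hfβ (v + ((f v - β) / (-f x)) • x)
      ⟨(f v - β) / (-f x), Set.mem_Ici.2 (div_nonneg (by linarith) (by linarith)), rfl⟩
    rw [map_add, map_smul, smul_eq_mul, div_mul_eq_mul_div, div_neg, mul_div_cancel_right₀ _ h.ne]
      at this
    linarith
  have hneg : ∀ p ∈ (verts P).erase v, f (p - v) < 0 := fun p hp => by
    have := hfα p (subset_convexHull ℝ _ hp)
    rw [map_sub]; linarith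
  obtain ⟨ψ, hψ, -⟩ := Submodule.exists_le_ker_of_notMem (K := ℝ) (V := Fin n → ℝ) (p := ⊥) (v := x)
    (by simpa using hx0)
  obtain ⟨ψ, hψ⟩ : ∃ ψ : (Fin n → ℝ) →ₗ[ℝ] ℝ, 0 < ψ x := by
    rcases lt_or_gt_of_ne hψ with h | h
    · exact ⟨-ψ, by simpa using h⟩
    · exact ⟨ψ, h⟩
  obtain ⟨ε, hε, hεp⟩ : ∃ ε : ℝ, 0 < ε ∧
      ∀ p ∈ (verts P).erase v, f (p - v) + ε * ψ (p - v) < 0 := by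
    have h1 : ∀ᶠ ε : ℝ in nhdsWithin 0 (Set.Ioi 0), ∀ p ∈ (verts P).erase v,
        f (p - v) + ε * ψ (p - v) < 0 := by
      rw [Filter.eventually_all_finset]
      intro p hp
      have hc : Continuous fun ε : ℝ => f (p - v) + ε * ψ (p - v) := by fun_prop
      refine (hc.continuousAt.eventually_lt_const ?_).filter_mono nhdsWithin_le_nhds
      simpa using hneg p hp
    obtain ⟨ε, h, hε⟩ := (h1.and self_mem_nhdsWithin).exists
    exact ⟨ε, hε, h⟩
  refine ⟨-((f : (Fin n → ℝ) →ₗ[ℝ] ℝ) + ε • ψ), fun p hp => ?_, ?_⟩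
  · by_cases hpv : p = v
    · simp [hpv]
    · have := hεp p (Finset.mem_erase.2 ⟨hpv, hp⟩)
      simp only [LinearMap.neg_apply, LinearMap.add_apply, LinearMap.smul_apply, smul_eq_mul,
        ContinuousLinearMap.coe_coe]
      linarith
  · have := mul_pos hε hψ
    simp only [LinearMap.neg_apply, LinearMap.add_apply, LinearMap.smul_apply, smul_eq_mul,
      ContinuousLinearMap.coe_coe]
    linarith

/-- The cone of feasible directions at a vertex is cut out by the facets through that vertex. -/
lemma exists_supportsFacet_of_notMem_feasible (hP : IsPolytope P) (hv : v ∈ verts P)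
    {x : Fin n → ℝ} (hxW : x ∈ vectorSpan ℝ P) (hx : x ∉ feasible P v) :
    ∃ l, SupportsFacet P v l ∧ l x < 0 := by
  classical
  obtain ⟨l, hl, hlx⟩ := exists_functional_of_notMem_feasible hP hv hx
  have hspan := vectorSpan_eq_span_nbrs hP hv
  rw [← Finset.coe_image] at hspan
  obtain ⟨m, hm, hmx, hfr⟩ := exists_functional_finrank_span_zeros (l := l) (x := x)
    (T := (nbrs P v).image fun u => u - v) (hspan ▸ hxW) (by
      intro t ht
      obtain ⟨u, hu, rfl⟩ := Finset.mem_image.1 ht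
      exact hl u (mem_verts_of_mem_nbrs hu)) hlx
  have hmP : ∀ p ∈ P, 0 ≤ m (p - v) := by
    intro p hp
    obtain ⟨c, hc, hpc⟩ := exists_sum_nbrs hP hv hp
    rw [hpc, map_sum]
    refine Finset.sum_nonneg fun u hu => ?_
    rw [map_smul]
    exact mul_nonneg (hc u) (hm _ (Finset.mem_image_of_mem _ hu))
  refine ⟨m, ⟨hmP, ?_⟩, hmx⟩
  have hvL : v ∈ verts (level P v m) := (mem_verts_level hP hmP).2 ⟨hv, by simp⟩
  have hset : (fun u => u - v) '' (nbrs (level P v m) v : Set (Fin n → ℝ)) =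
      {t | t ∈ (nbrs P v).image (fun u => u - v) ∧ m t = 0} := by
    ext t
    simp only [Set.mem_image, Finset.mem_coe, mem_nbrs_level hP (verts_subset hP hv) hmP,
      Set.mem_ofPred_eq, Finset.mem_image]
    constructor
    · rintro ⟨u, ⟨h1, h2⟩, rfl⟩; exact ⟨⟨u, h1, rfl⟩, h2⟩
    · rintro ⟨⟨u, h1, rfl⟩, h2⟩; exact ⟨u, ⟨h1, h2⟩, rfl⟩
  rw [adim, adim, hspan, ← hfr, vectorSpan_eq_span_nbrs (hP.level hmP) hvL, hset]

end Cone

/-- The excess degree of a polytope, as a sum over its vertices. -/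
noncomputable def excess {n : ℕ} (P : Set (Fin n → ℝ)) : ℤ :=
  ∑ u ∈ verts P, (((nbrs P u).card : ℤ) - adim P)

section Excess

open scoped Classical

variable {n : ℕ} {P F G : Set (Fin n → ℝ)} {u v : Fin n → ℝ} {l : (Fin n → ℝ) →ₗ[ℝ] ℝ}

lemma card_nbrs_sub_adim_nonneg (hP : IsPolytope P) (hv : v ∈ verts P) :
    0 ≤ ((nbrs P v).card : ℤ) - adim P := by
  have := adim_le_card_nbrs hP hv
  omega

lemma adim_le_add_card_filter (hP : IsPolytope P) (hF : IsExtreme ℝ P F) (hc : Convex ℝ F)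
    (hv : v ∈ verts F) : adim P ≤ adim F + {u ∈ nbrs P v | u ∉ F}.card := by
  have hv' := (verts_of_isExtreme hP hF hc).1 hv
  have hFP := hP.of_isExtreme hF hc
  have hle : vectorSpan ℝ P ≤ vectorSpan ℝ F ⊔
      Submodule.span ℝ
        (({u ∈ nbrs P v | u ∉ F}.image fun u => u - v : Finset _) : Set (Fin n → ℝ)) := by
    rw [vectorSpan_eq_span_nbrs hP hv'.1, vectorSpan_eq_span_nbrs hFP hv, ← Submodule.span_union]
    refine Submodule.span_mono ?_
    rintro _ ⟨u, hu, rfl⟩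
    by_cases h : u ∈ F
    · exact Or.inl ⟨u, (nbrs_of_isExtreme hP hF hc hv'.2).2 ⟨hu, h⟩, rfl⟩
    · exact Or.inr (Finset.mem_image_of_mem _ (Finset.mem_filter.2 ⟨hu, h⟩))
  refine (Submodule.finrank_mono hle).trans
    ((Submodule.finrank_add_le_finrank_add_finrank _ _).trans ?_)
  exact Nat.add_le_add_left ((finrank_span_finset_le_card _).trans Finset.card_image_le) _

lemma adim_lt_card_verts (hP : IsPolytope P) (hv : v ∈ verts P) : adim P + 1 ≤ (verts P).card := by
  have h1 := adim_le_card_nbrs hP hv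
  have h2 : nbrs P v ⊆ (verts P).erase v := fun u hu =>
    Finset.mem_erase.2 ⟨((mem_nbrs hP).1 hu).1, mem_verts_of_mem_nbrs hu⟩
  have h3 := Finset.card_le_card h2
  rw [Finset.card_erase_of_mem hv] at h3
  have := Finset.card_pos.2 ⟨v, hv⟩
  omega

lemma nbrs_eq_filter (hP : IsPolytope P) (hF : IsExtreme ℝ P F) (hc : Convex ℝ F) (hv : v ∈ F) :
    nbrs F v = {u ∈ nbrs P v | u ∈ F} := by
  ext u; rw [nbrs_of_isExtreme hP hF hc hv, Finset.mem_filter]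

/-- A vertex lying on two facets that meet in a face of dimension `j` has degree at least
`2 * d - 2 - j`. -/
lemma two_mul_adim_le_card_nbrs (hP : IsPolytope P) (hF : IsExtreme ℝ P F) (hFc : Convex ℝ F)
    (hFd : adim F + 1 = adim P) (hG : IsExtreme ℝ P G) (hGc : Convex ℝ G)
    (hGd : adim G + 1 = adim P) (hv : v ∈ verts (F ∩ G)) :
    2 * adim P ≤ (nbrs P v).card + adim (F ∩ G) + 2 := by
  have hH := hF.inter hG
  have hHc := hFc.inter hGc
  obtain ⟨H, hHeq⟩ : ∃ H, H = F ∩ G := ⟨_, rfl⟩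
  rw [← hHeq] at hH hHc hv ⊢
  have hHF : H ⊆ F := hHeq ▸ inter_subset_left
  have hHG : H ⊆ G := hHeq ▸ inter_subset_right
  have hFP := hP.of_isExtreme hF hFc
  have hGP := hP.of_isExtreme hG hGc
  have hvH := ((verts_of_isExtreme hP hH hHc).1 hv).2
  have h1 := adim_le_card_nbrs (hP.of_isExtreme hH hHc) hv
  have h2 := adim_le_add_card_filter hFP (hH.mono hF.subset hHF) hHc hv
  have h3 := adim_le_add_card_filter hGP (hH.mono hG.subset hHG) hHc hv
  rw [nbrs_eq_filter hP hF hFc (hHF hvH)] at h2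
  rw [nbrs_eq_filter hP hG hGc (hHG hvH)] at h3
  rw [nbrs_eq_filter hP hH hHc hvH] at h1
  have hd1 : Disjoint {u ∈ nbrs P v | u ∈ H} {u ∈ {u ∈ nbrs P v | u ∈ F} | u ∉ H} := by
    rw [Finset.disjoint_left]
    intro u hu hu'
    exact (Finset.mem_filter.1 hu').2 (Finset.mem_filter.1 hu).2
  have hd2 : Disjoint ({u ∈ nbrs P v | u ∈ H} ∪ {u ∈ {u ∈ nbrs P v | u ∈ F} | u ∉ H})
      {u ∈ {u ∈ nbrs P v | u ∈ G} | u ∉ H} := by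
    rw [Finset.disjoint_left]
    intro u hu hu'
    simp only [Finset.mem_union, Finset.mem_filter, hHeq, Set.mem_inter_iff] at hu hu'
    tauto
  have h4 : ({u ∈ nbrs P v | u ∈ H} ∪ {u ∈ {u ∈ nbrs P v | u ∈ F} | u ∉ H}) ∪
      {u ∈ {u ∈ nbrs P v | u ∈ G} | u ∉ H} ⊆ nbrs P v := by
    intro u hu
    simp only [Finset.mem_union, Finset.mem_filter] at hu
    tauto
  have h5 := Finset.card_le_card h4
  rw [Finset.card_union_of_disjoint hd2, Finset.card_union_of_disjoint hd1] at h5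
  omega

lemma le_excess_of_facets (hP : IsPolytope P) (hF : IsExtreme ℝ P F) (hFc : Convex ℝ F)
    (hFd : adim F + 1 = adim P) (hG : IsExtreme ℝ P G) (hGc : Convex ℝ G)
    (hGd : adim G + 1 = adim P) (hv : v ∈ verts (F ∩ G)) (hj : adim (F ∩ G) + 3 ≤ adim P) :
    (adim P : ℤ) - 2 ≤ excess P := by
  have hH := hF.inter hG
  have hHc := hFc.inter hGc
  have h1 := adim_lt_card_verts (hP.of_isExtreme hH hHc) hv
  have hsub : verts (F ∩ G) ⊆ verts P := fun u hu => ((verts_of_isExtreme hP hH hHc).1 hu).1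
  calc (adim P : ℤ) - 2 ≤ (adim (F ∩ G) + 1) * (adim P - 2 - adim (F ∩ G)) := by
        have : (0 : ℤ) ≤ adim (F ∩ G) * ((adim P : ℤ) - 3 - adim (F ∩ G)) :=
          mul_nonneg (by positivity) (by omega)
        nlinarith
    _ ≤ (verts (F ∩ G)).card * (adim P - 2 - adim (F ∩ G)) :=
        mul_le_mul_of_nonneg_right (by exact_mod_cast h1) (by omega)
    _ = ∑ u ∈ verts (F ∩ G), ((adim P : ℤ) - 2 - adim (F ∩ G)) := by
        rw [Finset.sum_const, nsmul_eq_mul]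
    _ ≤ ∑ u ∈ verts (F ∩ G), (((nbrs P u).card : ℤ) - adim P) := by
        refine Finset.sum_le_sum fun u hu => ?_
        have := two_mul_adim_le_card_nbrs hP hF hFc hFd hG hGc hGd hu
        omega
    _ ≤ excess P :=
        Finset.sum_le_sum_of_subset_of_nonneg hsub fun u hu _ => card_nbrs_sub_adim_nonneg hP hu

lemma SupportsFacet.vectorSpan_level_eq (hl : SupportsFacet P v l) (hv : v ∈ P) (hu : u ∈ P)
    (hlu : l (u - v) ≠ 0) : vectorSpan ℝ (level P v l) = vectorSpan ℝ P ⊓ LinearMap.ker l := by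
  have hle : vectorSpan ℝ (level P v l) ≤ vectorSpan ℝ P ⊓ LinearMap.ker l := by
    refine le_inf (vectorSpan_mono ℝ fun p hp => hp.1) ?_
    rw [vectorSpan_eq_span_vsub_set_right ℝ (left_mem_level hv), Submodule.span_le]
    rintro _ ⟨p, hp, rfl⟩
    exact hp.2
  refine Submodule.eq_of_le_of_finrank_le hle ?_
  have hlt : vectorSpan ℝ P ⊓ LinearMap.ker l < vectorSpan ℝ P := by
    refine lt_of_le_of_ne inf_le_left fun h => hlu ?_
    have h1 : u - v ∈ vectorSpan ℝ P := vsub_mem_vectorSpan ℝ hu hv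
    rw [← h] at h1
    exact h1.2
  have h1 := Submodule.finrank_lt_finrank_of_lt hlt
  have h2 := hl.2
  rw [adim, adim] at h2
  omega

lemma eq_of_mem_verts_of_sub_eq_smul (hP : IsPolytope P) (hv : v ∈ P) {g h : Fin n → ℝ}
    (hg : g ∈ verts P) (hh : h ∈ verts P) (hgv : g ≠ v) (hhv : h ≠ v) {t : ℝ} (ht : 0 < t)
    (hgh : g - v = t • (h - v)) : g = h := by
  wlog h1 : t ≤ 1 generalizing g h t
  · refine (this hh hg hhv hgv (inv_pos.2 ht) ?_ (inv_le_one_of_one_le₀ (by linarith))).symm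
    rw [hgh, smul_smul, inv_mul_cancel₀ ht.ne', one_smul]
  have hg' : g = v + t • (h - v) := by rw [← hgh]; abel
  rcases h1.eq_or_lt with rfl | h1
  · rw [hg']; simp
  refine absurd ?_ hgv.symm
  refine ((mem_extremePoints_iff_left.1 ((mem_verts hP).1 hg)).2 v hv h (verts_subset hP hh)
    ⟨1 - t, t, by linarith, ht, by ring, ?_⟩)
  rw [hg']; module

/-- If a vertex is simple in a facet but has at least two neighbours off it, then some other facet
through that vertex meets the given one in a face of codimension at least two. -/
lemma exists_supportsFacet_adim_inter_le (hP : IsPolytope P) (hv : v ∈ verts P)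
    (hl : SupportsFacet P v l) (hs : (nbrs (level P v l) v).card + 1 = adim P)
    {g h : Fin n → ℝ} (hg : g ∈ nbrs P v) (hh : h ∈ nbrs P v) (hgh : g ≠ h)
    (hlg : l (g - v) ≠ 0) (hlh : l (h - v) ≠ 0) :
    ∃ m, SupportsFacet P v m ∧ adim (level P v l ∩ level P v m) + 3 ≤ adim P := by
  by_contra! hcon
  have hvP := verts_subset hP hv
  have hgP := verts_subset hP (mem_verts_of_mem_nbrs hg)
  have hhP := verts_subset hP (mem_verts_of_mem_nbrs hh)
  set N := nbrs (level P v l) v with hN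
  have hmemN : ∀ u, u ∈ N ↔ u ∈ nbrs P v ∧ l (u - v) = 0 := fun u => mem_nbrs_level hP hvP hl.1
  have hNP : ∀ u ∈ N, u ∈ P := fun u hu =>
    verts_subset hP (mem_verts_of_mem_nbrs ((hmemN u).1 hu).1)
  have hlg' : 0 < l (g - v) := lt_of_le_of_ne (hl.1 g hgP) hlg.symm
  have hlh' : 0 < l (h - v) := lt_of_le_of_ne (hl.1 h hhP) hlh.symm
  have honly : ∀ m, SupportsFacet P v m → ∀ e₁ ∈ N, ∀ e₂ ∈ N, m (e₁ - v) ≠ 0 → m (e₂ - v) ≠ 0 →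
      e₁ = e₂ := by
    intro m hm e₁ he₁ e₂ he₂ h1 h2
    by_contra hne
    have hH := (isExtreme_level hl.1).inter (isExtreme_level hm.1)
    have hHc : Convex ℝ (level P v l ∩ level P v m) :=
      (convex_level hP.convex).inter (convex_level hP.convex)
    have hvH : v ∈ level P v l ∩ level P v m := ⟨left_mem_level hvP, left_mem_level hvP⟩
    have h3 := adim_le_card_nbrs (hP.of_isExtreme hH hHc)
      ((verts_of_isExtreme hP hH hHc).2 ⟨hv, hvH⟩)
    have h4 : nbrs (level P v l ∩ level P v m) v ⊆ (N.erase e₁).erase e₂ := by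
      intro u hu
      rw [nbrs_of_isExtreme hP hH hHc hvH] at hu
      refine Finset.mem_erase.2 ⟨?_, Finset.mem_erase.2 ⟨?_, (hmemN u).2 ⟨hu.1, hu.2.1.2⟩⟩⟩
      · rintro rfl; exact h2 hu.2.2.2
      · rintro rfl; exact h1 hu.2.2.2
    have h5 := Finset.card_le_card h4
    rw [Finset.card_erase_of_mem (Finset.mem_erase.2 ⟨Ne.symm hne, he₂⟩),
      Finset.card_erase_of_mem he₁] at h5
    have h6 : 1 < N.card := Finset.one_lt_card.2 ⟨e₁, he₁, e₂, he₂, hne⟩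
    have := hcon m hm
    omega
  set g' := (l (g - v))⁻¹ • (g - v) with hg'
  set h' := (l (h - v))⁻¹ • (h - v) with hh'
  have hlg1 : l g' = 1 := by rw [hg', map_smul, smul_eq_mul, inv_mul_cancel₀ hlg]
  have hlh1 : l h' = 1 := by rw [hh', map_smul, smul_eq_mul, inv_mul_cancel₀ hlh]
  have hgW : g' ∈ vectorSpan ℝ P := Submodule.smul_mem _ _ (vsub_mem_vectorSpan ℝ hgP hvP)
  have hhW : h' ∈ vectorSpan ℝ P := Submodule.smul_mem _ _ (vsub_mem_vectorSpan ℝ hhP hvP)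
  obtain ⟨t, ht⟩ : ∃ t : (Fin n → ℝ) → ℝ, ∑ e ∈ N, t e • (e - v) = g' - h' := by
    have h1 : g' - h' ∈ vectorSpan ℝ (level P v l) := by
      rw [hl.vectorSpan_level_eq hvP hgP hlg]
      exact ⟨Submodule.sub_mem _ hgW hhW, by simp [hlg1, hlh1]⟩
    rw [vectorSpan_eq_span_nbrs (hP.level hl.1) ((mem_verts_level hP hl.1).2 ⟨hv, by simp⟩),
      Submodule.mem_span_image_finset_iff_exists_fun] at h1
    obtain ⟨c, hc⟩ := h1
    refine ⟨fun e => if he : e ∈ N then c ⟨e, he⟩ else 0, ?_⟩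
    rw [← hc, ← Finset.sum_coe_sort]
    exact Finset.sum_congr rfl fun e _ => by simp [hN]
  have hmNW : ∀ e ∈ N, e - v ∈ vectorSpan ℝ P := fun e he =>
    vsub_mem_vectorSpan ℝ (hNP e he) hvP
  let A : Fin n → ℝ := ∑ e ∈ N, max (t e) 0 • (e - v)
  let B : Fin n → ℝ := ∑ e ∈ N, max (-t e) 0 • (e - v)
  have hAB : A - B = g' - h' := by
    rw [← ht, ← Finset.sum_sub_distrib]
    refine Finset.sum_congr rfl fun e _ => ?_
    rw [← sub_smul]
    congr 1
    rcases le_total (t e) 0 with h | h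
    · rw [max_eq_right h, max_eq_left (by linarith)]; ring
    · rw [max_eq_left h, max_eq_right (by linarith)]; ring
  have hl0 : ∀ c : (Fin n → ℝ) → ℝ, l (∑ e ∈ N, c e • (e - v)) = 0 := fun c => by
    rw [map_sum]
    exact Finset.sum_eq_zero fun e he => by rw [map_smul, ((hmemN e).1 he).2, smul_zero]
  have hfeasA : A ∈ feasible P v := sum_mem_feasible hP.convex hvP hNP fun _ _ => le_max_right _ _
  have hfeasB : B ∈ feasible P v := sum_mem_feasible hP.convex hvP hNP fun _ _ => le_max_right _ _
  have hfeas : g' - A ∈ feasible P v := by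
    by_contra hnot
    have hW : g' - A ∈ vectorSpan ℝ P := Submodule.sub_mem _ hgW
      (Submodule.sum_mem _ fun e he => Submodule.smul_mem _ _ (hmNW e he))
    obtain ⟨m, hm, hneg⟩ := exists_supportsFacet_of_notMem_feasible hP hv hW hnot
    have hmg : 0 ≤ m g' := by
      rw [hg', map_smul]; exact mul_nonneg (by positivity) (hm.1 g hgP)
    have hmh : 0 ≤ m h' := by
      rw [hh', map_smul]; exact mul_nonneg (by positivity) (hm.1 h hhP)
    have hmsum : ∀ c : (Fin n → ℝ) → ℝ, m (∑ e ∈ N, c e • (e - v)) = ∑ e ∈ N, c e * m (e - v) :=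
      fun c => by simp [map_sum]
    have hzero : m A = 0 ∨ m B = 0 := by
      by_cases hex : ∃ e ∈ N, m (e - v) ≠ 0
      · obtain ⟨e, he, hme⟩ := hex
        have hsingle : ∀ c : (Fin n → ℝ) → ℝ, ∑ e ∈ N, c e * m (e - v) = c e * m (e - v) := fun c =>
          Finset.sum_eq_single_of_mem e he fun e' he' hne => by
            rw [mul_eq_zero]; right
            by_contra h1
            exact hne (honly m hm e' he' e he h1 hme)
        rcases le_total (t e) 0 with h | h
        · left; rw [hmsum, hsingle, max_eq_right h, zero_mul]
        · right; rw [hmsum, hsingle, max_eq_right (by linarith), zero_mul]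
      · push Not at hex
        left
        rw [hmsum]
        exact Finset.sum_eq_zero fun e he => by rw [hex e he, mul_zero]
    have hg2 : g' - A = h' - B := by linear_combination (norm := module) -hAB
    rcases hzero with h | h
    · rw [map_sub, h] at hneg; linarith
    · rw [hg2, map_sub, h] at hneg; linarith
  have key : ∀ w ∈ nbrs P v, l (w - v) ≠ 0 → ∀ c : (Fin n → ℝ) → ℝ,
      ∑ e ∈ N, c e • (e - v) ∈ feasible P v →
      (l (w - v))⁻¹ • (w - v) - ∑ e ∈ N, c e • (e - v) ∈ feasible P v →
      (l (w - v))⁻¹ • (w - v) - ∑ e ∈ N, c e • (e - v) = (l (w - v))⁻¹ • (w - v) := by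
    intro w hw hlw c h1 h2
    have hlw' : 0 ≤ (l (w - v))⁻¹ :=
      inv_nonneg.2 (hl.1 w (verts_subset hP (mem_verts_of_mem_nbrs hw)))
    obtain ⟨s, hs⟩ := exists_smul_of_add_eq_smul hP.convex hvP ((mem_nbrs hP).1 hw).2 h2 h1 hlw'
      (sub_add_cancel _ _)
    have h3 := congrArg l hs
    rw [map_sub, hl0, map_smul, map_smul, smul_eq_mul, smul_eq_mul, inv_mul_cancel₀ hlw, sub_zero]
      at h3
    rw [hs, eq_inv_of_mul_eq_one_left h3.symm]
  have hA := key g hg hlg (fun e => max (t e) 0) hfeasA hfeas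
  have hg2 : g' - A = h' - B := by linear_combination (norm := module) -hAB
  have hB := key h hh hlh (fun e => max (-t e) 0) hfeasB (by rw [hg2] at hfeas; exact hfeas)
  have heq : g' = h' := by
    rw [← hg', ← hh'] at *
    exact hA.symm.trans (hg2.trans hB)
  refine hgh (eq_of_mem_verts_of_sub_eq_smul hP hvP (mem_verts_of_mem_nbrs hg)
    (mem_verts_of_mem_nbrs hh) ((mem_nbrs hP).1 hg).1 ((mem_nbrs hP).1 hh).1
    (t := l (g - v) * (l (h - v))⁻¹) (by positivity) ?_)
  rw [mul_smul, ← hh', ← heq, hg', smul_smul, mul_inv_cancel₀ hlg, one_smul]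

/-- A vertex that misses exactly one neighbour on each facet through it is simple. -/
lemma card_nbrs_le_of_forall_card_eq_one (hP : IsPolytope P) (hv : v ∈ verts P)
    (h : ∀ l, SupportsFacet P v l → {u ∈ nbrs P v | l (u - v) ≠ 0}.card ≤ 1) :
    (nbrs P v).card ≤ adim P := by
  have hvP := verts_subset hP hv
  have hex : ∀ u ∈ nbrs P v, ∃ l, SupportsFacet P v l ∧ 0 < l (u - v) := by
    intro u hu
    have huP := verts_subset hP (mem_verts_of_mem_nbrs hu)
    have hnot : -(u - v) ∉ feasible P v := by
      rintro ⟨ε, hε, hmem⟩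
      have := (mem_extremePoints_iff_left.1 ((mem_verts hP).1 hv)).2 u huP _ hmem
        ⟨ε / (1 + ε), 1 / (1 + ε), by positivity, by positivity, by field_simp; ring, by
          have h1 : ε / (1 + ε) = 1 - 1 / (1 + ε) := by field_simp; ring
          have h2 : 1 / (1 + ε) * ε = 1 - 1 / (1 + ε) := by field_simp; ring
          rw [smul_add, smul_smul, h1, h2]; module⟩
      exact ((mem_nbrs hP).1 hu).1 this
    obtain ⟨l, hl, hlu⟩ := exists_supportsFacet_of_notMem_feasible hP hv
      (Submodule.neg_mem _ (vsub_mem_vectorSpan ℝ huP hvP)) hnot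
    exact ⟨l, hl, by simpa using hlu⟩
  choose! f hf hfu using hex
  have hoff : ∀ u ∈ nbrs P v, ∀ w ∈ nbrs P v, w ≠ u → f u (w - v) = 0 := by
    intro u hu w hw hwu
    by_contra hne
    exact hwu (Finset.card_le_one.1 (h _ (hf u hu)) w (Finset.mem_filter.2 ⟨hw, hne⟩) u
      (Finset.mem_filter.2 ⟨hu, (hfu u hu).ne'⟩))
  have hli : LinearIndependent ℝ (fun u : nbrs P v => (⟨u - v, vsub_mem_vectorSpan ℝ
      (verts_subset hP (mem_verts_of_mem_nbrs u.2)) hvP⟩ : vectorSpan ℝ P)) := by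
    rw [Fintype.linearIndependent_iff]
    intro c hc u
    have h1 := congrArg (fun z : vectorSpan ℝ P => f u (z : Fin n → ℝ)) hc
    simp only [Submodule.coe_sum, Submodule.coe_smul, map_sum, map_smul, smul_eq_mul,
      Submodule.coe_zero, map_zero] at h1
    rw [Finset.sum_eq_single_of_mem u (Finset.mem_univ _) fun w _ hwu => by
      rw [hoff u u.2 w w.2 (fun h => hwu (Subtype.ext h)), mul_zero]] at h1
    exact (mul_eq_zero.1 h1).resolve_right (hfu u u.2).ne'
  simpa [adim] using hli.fintype_card_le_finrank

/-- A polytope of dimension `d` with a nonsimple vertex has excess degree at least `d - 2`. -/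
theorem adim_sub_two_le_excess (hP : IsPolytope P) (hv : v ∈ verts P)
    (hns : adim P < (nbrs P v).card) : (adim P : ℤ) - 2 ≤ excess P := by
  induction hd : adim P generalizing P with
  | zero =>
    have : 0 ≤ excess P := Finset.sum_nonneg fun u hu => card_nbrs_sub_adim_nonneg hP hu
    push_cast; linarith
  | succ d ih =>
  rw [← hd]
  have hvP := verts_subset hP hv
  by_contra! hlt
  have hlevel : ∀ l, SupportsFacet P v l → {u ∈ nbrs P v | l (u - v) ≠ 0}.card ≤ 1 := by
    intro l hl
    have hE := isExtreme_level hl.1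
    have hC : Convex ℝ (level P v l) := convex_level hP.convex
    have hFP := hP.level hl.1
    have hvF : v ∈ verts (level P v l) := (mem_verts_level hP hl.1).2 ⟨hv, by simp⟩
    have hcard : (nbrs (level P v l) v).card + {u ∈ nbrs P v | l (u - v) ≠ 0}.card =
        (nbrs P v).card := by
      have : nbrs (level P v l) v = {u ∈ nbrs P v | l (u - v) = 0} := by
        ext u; rw [mem_nbrs_level hP hvP hl.1, Finset.mem_filter]
      rw [this]
      exact Finset.card_filter_add_card_filter_not _
    by_contra! hgt
    have hle := adim_le_card_nbrs hFP hvF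
    have hFd := hl.2
    rcases hle.eq_or_lt with hs | hns'
    · obtain ⟨g, hg, w, hw, hgw⟩ := Finset.one_lt_card.1 hgt
      rw [Finset.mem_filter] at hg hw
      obtain ⟨m, hm, hj⟩ := exists_supportsFacet_adim_inter_le hP hv hl (by omega) hg.1 hw.1 hgw
        hg.2 hw.2
      have hEm := isExtreme_level hm.1
      have hCm : Convex ℝ (level P v m) := convex_level hP.convex
      have := le_excess_of_facets hP hE hC hl.2 hEm hCm hm.2
        ((verts_of_isExtreme hP (hE.inter hEm) (hC.inter hCm)).2
          ⟨hv, left_mem_level hvP, left_mem_level hvP⟩) hj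
      linarith
    · have h1 := ih hFP hvF hns' (by omega)
      have hterm : ∀ u ∈ verts (level P v l), ((nbrs (level P v l) u).card : ℤ) -
          adim (level P v l) + {w ∈ nbrs P u | w ∉ level P v l}.card - 1 =
          ((nbrs P u).card : ℤ) - adim P := by
        intro u hu
        have hu' := ((verts_of_isExtreme hP hE hC).1 hu).2
        have h2 : (nbrs (level P v l) u).card + {w ∈ nbrs P u | w ∉ level P v l}.card =
            (nbrs P u).card := by
          rw [nbrs_eq_filter hP hE hC hu']
          exact Finset.card_filter_add_card_filter_not _
        omega
      have hsum : excess (level P v l) < excess P := by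
        calc _ < ∑ u ∈ verts (level P v l), (((nbrs P u).card : ℤ) - adim P) := by
              refine Finset.sum_lt_sum (fun u hu => ?_) ⟨v, hvF, ?_⟩
              · have h3 := adim_le_add_card_filter hP hE hC hu
                have := hterm u hu
                omega
              · omega
          _ ≤ excess P := Finset.sum_le_sum_of_subset_of_nonneg
              (fun u hu => ((verts_of_isExtreme hP hE hC).1 hu).1)
              fun u hu _ => card_nbrs_sub_adim_nonneg hP hu
      omega
  have := card_nbrs_le_of_forall_card_eq_one hP hv hlevel
  omega

lemma excess_eq_zero_or_le (hP : IsPolytope P) : excess P = 0 ∨ (adim P : ℤ) - 2 ≤ excess P := by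
  by_cases h : ∃ v ∈ verts P, adim P < (nbrs P v).card
  · obtain ⟨v, hv, hns⟩ := h
    exact Or.inr (adim_sub_two_le_excess hP hv hns)
  · push Not at h
    left
    refine Finset.sum_eq_zero fun u hu => ?_
    have := adim_le_card_nbrs hP hu
    have := h u hu
    omega

end Excess

section Edges

variable {n : ℕ} {P E : Set (Fin n → ℝ)} {u v : Fin n → ℝ}

lemma isEdge_segment (hP : IsPolytope P) (hu : u ∈ nbrs P v) : IsEdge P (segment ℝ v u) := by
  obtain ⟨hne, hE⟩ := (mem_nbrs hP).1 hu
  refine ⟨hE, convex_segment _ _, ?_⟩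
  rw [adim, vectorSpan_segment, vsub_eq_sub]
  exact finrank_span_singleton (sub_ne_zero.2 hne)

lemma IsEdge.exists_eq_segment (hP : IsPolytope P) (hE : IsEdge P E) :
    ∃ v ∈ verts P, ∃ u ∈ nbrs P v, segment ℝ v u = E := by
  obtain ⟨hE, hc, hd⟩ := hE
  have hEP := hP.of_isExtreme hE hc
  obtain ⟨v, hv⟩ : (verts E).Nonempty := by
    rw [Finset.nonempty_iff_ne_empty]
    intro h
    have h1 := convexHull_verts hEP
    rw [h, Finset.coe_empty, convexHull_empty] at h1
    rw [← h1, adim, vectorSpan_empty, finrank_bot] at hd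
    exact zero_ne_one hd
  obtain ⟨u, hu⟩ : (nbrs E v).Nonempty := by
    rw [← Finset.card_pos]
    have := adim_le_card_nbrs hEP hv
    omega
  have hv' := (verts_of_isExtreme hP hE hc).1 hv
  refine ⟨v, hv'.1, u, ((nbrs_of_isExtreme hP hE hc hv'.2).1 hu).1, ?_⟩
  have huv := ((mem_nbrs hEP).1 hu).1
  have huE := verts_subset hEP (mem_verts_of_mem_nbrs hu)
  refine (hc.segment_subset hv'.2 huE).antisymm fun x hx => ?_
  have hcol : Collinear ℝ ({v, x, u} : Set (Fin n → ℝ)) := by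
    refine Collinear.subset ?_ (collinear_iff_finrank_le_one.2 hd.le)
    rintro _ (rfl | rfl | rfl)
    exacts [hv'.2, hx, huE]
  rcases hcol.wbtw_or_wbtw_or_wbtw with h | h | h
  · exact mem_segment_iff_wbtw.2 h
  · rcases (mem_extremePoints_iff_forall_segment.1
      ((mem_verts hEP).1 (mem_verts_of_mem_nbrs hu))).2 x hx v hv'.2
      (mem_segment_iff_wbtw.2 h) with rfl | h1
    · exact right_mem_segment _ _ _
    · exact absurd h1.symm huv
  · rcases (mem_extremePoints_iff_forall_segment.1 ((mem_verts hEP).1 hv)).2 u huE x hx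
      (mem_segment_iff_wbtw.2 h) with h1 | rfl
    · exact absurd h1 huv
    · exact left_mem_segment _ _ _

lemma f₀_eq_card_verts (hP : IsPolytope P) : f₀ P = (verts P).card := by
  rw [f₀, ← coe_verts hP, Set.ncard_coe_finset]

/-- The handshake identity for the graph of a polytope. -/
lemma sum_card_nbrs (hP : IsPolytope P) : ∑ v ∈ verts P, (nbrs P v).card = 2 * f₁ P := by
  classical
  let D : Finset (Σ _ : Fin n → ℝ, Fin n → ℝ) := (verts P).sigma (nbrs P)
  have hf₁ : f₁ P = (D.image fun p => segment ℝ p.1 p.2).card := by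
    rw [f₁, ← Set.ncard_coe_finset]
    congr 1
    ext E
    simp only [Set.mem_ofPred_eq, Finset.coe_image, Set.mem_image, SetLike.mem_coe]
    constructor
    · intro hE
      obtain ⟨v, hv, u, hu, h⟩ := hE.exists_eq_segment hP
      exact ⟨⟨v, u⟩, Finset.mem_sigma.2 ⟨hv, hu⟩, h⟩
    · rintro ⟨⟨v, u⟩, hvu, rfl⟩
      exact isEdge_segment hP (Finset.mem_sigma.1 hvu).2
  rw [← Finset.card_sigma, hf₁, mul_comm]
  have hfib : ∀ e ∈ D.image (fun p => segment ℝ p.1 p.2),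
      {p ∈ D | segment ℝ p.1 p.2 = e}.card = 2 := by
    intro e he
    obtain ⟨⟨v, u⟩, hvu, rfl⟩ := Finset.mem_image.1 he
    obtain ⟨hv, hu⟩ := Finset.mem_sigma.1 hvu
    rw [Finset.card_eq_two]
    refine ⟨⟨v, u⟩, ⟨u, v⟩, fun h => ((mem_nbrs hP).1 hu).1 (Sigma.mk.inj h).1.symm, ?_⟩
    ext ⟨a, b⟩
    simp only [Finset.mem_filter, Finset.mem_insert, Finset.mem_singleton, Sigma.mk.injEq,
      heq_eq_eq]
    constructor
    · rintro ⟨-, h⟩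
      have h1 := congrArg (Set.extremePoints ℝ) h
      rwa [extremePoints_segment, extremePoints_segment, Set.pair_eq_pair_iff] at h1
    · rintro (⟨rfl, rfl⟩ | ⟨rfl, rfl⟩)
      · exact ⟨hvu, rfl⟩
      · exact ⟨Finset.mem_sigma.2 ⟨mem_verts_of_mem_nbrs hu, (mem_nbrs_comm hP).1 hu⟩,
          segment_symm _ _ _⟩
  rw [Finset.card_eq_sum_card_image (fun p => segment ℝ p.1 p.2) D, Finset.sum_congr rfl hfib,
    Finset.sum_const, smul_eq_mul]

lemma two_mul_f₁_sub_eq_excess (hP : IsPolytope P) :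
    2 * (f₁ P : ℤ) - (adim P : ℤ) * (f₀ P : ℤ) = excess P := by
  rw [excess, Finset.sum_sub_distrib, Finset.sum_const, nsmul_eq_mul, f₀_eq_card_verts hP]
  have := sum_card_nbrs hP
  zify at this
  rw [this, mul_comm (adim P : ℤ)]

end Edges

section CrossPolytope

open scoped Classical

variable {n : ℕ} {S : Finset (Fin n → ℝ)} {a b : Fin n → ℝ}

lemma isPolytope_convexHull (S : Finset (Fin n → ℝ)) :
    IsPolytope (convexHull ℝ (S : Set (Fin n → ℝ))) := ⟨S, rfl⟩

lemma adim_convexHull (S : Set (Fin n → ℝ)) :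
    adim (convexHull ℝ S) = Module.finrank ℝ (vectorSpan ℝ S) := by
  rw [adim, ← direction_affineSpan, affineSpan_convexHull, direction_affineSpan]

lemma verts_convexHull_subset (S : Finset (Fin n → ℝ)) :
    verts (convexHull ℝ (S : Set (Fin n → ℝ))) ⊆ S := fun _ hu =>
  extremePoints_convexHull_subset ((mem_verts (isPolytope_convexHull S)).1 hu)

/-- A segment between two points of `S` exposed by a linear functional is a face of the hull. -/
lemma isExtreme_segment_convexHull (l : (Fin n → ℝ) →ₗ[ℝ] ℝ) (ha : a ∈ S) (hb : b ∈ S)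
    (hl : ∀ s ∈ S, 0 ≤ l (s - a)) (hab : l (b - a) = 0)
    (hS : ∀ s ∈ S, l (s - a) = 0 → s = a ∨ s = b) :
    IsExtreme ℝ (convexHull ℝ (S : Set (Fin n → ℝ))) (segment ℝ a b) := by
  have hP := isPolytope_convexHull S
  have hl' : ∀ p ∈ convexHull ℝ (S : Set (Fin n → ℝ)), 0 ≤ l (p - a) := by
    have hsub : convexHull ℝ (S : Set (Fin n → ℝ)) ⊆ {p | l a ≤ l p} :=
      convexHull_min (fun s hs => by simpa using hl s hs) (convex_halfSpace_ge l.isLinear _)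
    intro p hp
    simpa using hsub hp
  suffices h : segment ℝ a b = level (convexHull ℝ (S : Set (Fin n → ℝ))) a l by
    rw [h]
    exact isExtreme_level hl'
  refine ((convex_level hP.convex).segment_subset ?_ ?_).antisymm ?_
  · exact left_mem_level (subset_convexHull ℝ _ ha)
  · exact ⟨subset_convexHull ℝ _ hb, hab⟩
  · rw [← convexHull_verts (hP.level hl')]
    refine convexHull_min (fun s hs => ?_) (convex_segment _ _)
    obtain ⟨h1, h2⟩ := (mem_verts_level hP hl').1 hs
    rcases hS s (verts_convexHull_subset S h1) h2 with rfl | rfl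
    · exact left_mem_segment _ _ _
    · exact right_mem_segment _ _ _

/-- A finite set of unit vectors, any two of which are orthogonal or antipodal. -/
def IsOrthoplexSet (S : Finset (Fin n → ℝ)) : Prop :=
  (∀ u ∈ S, u ⬝ᵥ u = 1) ∧ ∀ u ∈ S, ∀ w ∈ S, u ≠ w → u ≠ -w → u ⬝ᵥ w = 0

lemma IsOrthoplexSet.isExtreme_segment (hS : IsOrthoplexSet S) (ha : a ∈ S) (hb : b ∈ S)
    (hab : a ≠ -b) : IsExtreme ℝ (convexHull ℝ (S : Set (Fin n → ℝ))) (segment ℝ a b) := by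
  have hnonpos : ∀ u ∈ S, ∀ w ∈ S, u ≠ w → u ⬝ᵥ w ≤ 0 := by
    intro u hu w hw huw
    by_cases h : u = -w
    · rw [h, neg_dotProduct, hS.1 w hw]; norm_num
    · exact (hS.2 u hu w hw huw h).le
  have hab0 : 0 ≤ a ⬝ᵥ b := by
    by_cases h : a = b
    · rw [h, hS.1 b hb]; norm_num
    · exact (hS.2 a ha b hb h hab).ge
  have hval : ∀ s, (-dotProductEquiv ℝ (Fin n) (a + b)) (s - a) =
      1 + a ⬝ᵥ b - (a ⬝ᵥ s + b ⬝ᵥ s) := by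
    intro s
    have := hS.1 a ha
    have := dotProduct_comm a b
    simp only [LinearMap.neg_apply, dotProductEquiv_apply_apply, dotProduct_sub, add_dotProduct]
    linarith
  have hlt : ∀ s ∈ S, s ≠ a → s ≠ b → 0 < 1 + a ⬝ᵥ b - (a ⬝ᵥ s + b ⬝ᵥ s) := by
    intro s hs hsa hsb
    have := hnonpos a ha s hs hsa.symm
    have := hnonpos b hb s hs hsb.symm
    linarith
  have ha0 : (-dotProductEquiv ℝ (Fin n) (a + b)) (a - a) = 0 := by rw [sub_self, map_zero]
  have hb0 : (-dotProductEquiv ℝ (Fin n) (a + b)) (b - a) = 0 := by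
    rw [hval, hS.1 b hb]; ring
  refine isExtreme_segment_convexHull (-dotProductEquiv ℝ (Fin n) (a + b)) ha hb ?_ hb0 ?_
  · intro s hs
    by_cases hsa : s = a
    · rw [hsa, ha0]
    by_cases hsb : s = b
    · rw [hsb, hb0]
    rw [hval]
    exact (hlt s hs hsa hsb).le
  · intro s hs h0
    by_contra! h
    rw [hval] at h0
    exact (hlt s hs h.1 h.2).ne' h0

lemma IsOrthoplexSet.ne_neg_self (hS : IsOrthoplexSet S) (ha : a ∈ S) : a ≠ -a := by
  intro h
  have h1 := hS.1 a ha
  have h2 : a ⬝ᵥ a = -(a ⬝ᵥ a) := by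
    conv_lhs => rw [h]
    rw [neg_dotProduct, dotProduct_neg, neg_neg, ← neg_dotProduct, ← h]
  linarith

lemma IsOrthoplexSet.verts_eq (hS : IsOrthoplexSet S) :
    verts (convexHull ℝ (S : Set (Fin n → ℝ))) = S := by
  refine (verts_convexHull_subset S).antisymm fun a ha => ?_
  rw [mem_verts (isPolytope_convexHull S)]
  refine (hS.isExtreme_segment ha ha (hS.ne_neg_self ha)).extremePoints_subset_extremePoints ?_
  exact right_mem_extremePoints_segment a a

lemma IsOrthoplexSet.nbrs_eq (hS : IsOrthoplexSet S)
    (hT : ∀ u ∈ S, -u ∈ S → ∃ w ∈ S, -w ∈ S ∧ w ≠ u ∧ w ≠ -u) (ha : a ∈ S) :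
    nbrs (convexHull ℝ (S : Set (Fin n → ℝ))) a = (S.erase a).erase (-a) := by
  have hP := isPolytope_convexHull S
  ext b
  rw [Finset.mem_erase, Finset.mem_erase]
  constructor
  · intro hb
    obtain ⟨hne, hE⟩ := (mem_nbrs hP).1 hb
    have hbS := verts_convexHull_subset S (mem_verts_of_mem_nbrs hb)
    refine ⟨?_, hne, hbS⟩
    rintro rfl
    obtain ⟨w, hw, hw', hwa, hwa'⟩ := hT a ha hbS
    have hmid : (0 : Fin n → ℝ) ∈ segment ℝ a (-a) :=
      ⟨1 / 2, 1 / 2, by norm_num, by norm_num, by norm_num, by simp⟩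
    have hwE : w ∈ segment ℝ a (-a) :=
      hE.left_mem_of_mem_openSegment (subset_convexHull ℝ _ hw) (subset_convexHull ℝ _ hw') hmid
        ⟨1 / 2, 1 / 2, by norm_num, by norm_num, by norm_num, by simp⟩
    have h1 : w ∈ (segment ℝ a (-a)).extremePoints ℝ := by
      rw [hE.extremePoints_eq, ← coe_verts hP, hS.verts_eq]
      exact ⟨hwE, hw⟩
    rw [extremePoints_segment] at h1
    exact h1.elim hwa hwa'
  · rintro ⟨h1, h2, h3⟩
    exact (mem_nbrs hP).2 ⟨h2, hS.isExtreme_segment ha h3 fun h => h1 (by rw [h, neg_neg])⟩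

/-- The standard basis vectors together with the negatives of those indexed by `T`. -/
noncomputable def crossSet (T : Finset (Fin n)) : Finset (Fin n → ℝ) :=
  Finset.univ.image (fun i => Pi.single i 1) ∪ T.image (fun i => -Pi.single i 1)

variable {T : Finset (Fin n)}

lemma isOrthoplexSet_crossSet (T : Finset (Fin n)) : IsOrthoplexSet (crossSet T) := by
  have hmem : ∀ u ∈ crossSet T, ∃ i, u = Pi.single i 1 ∨ u = -Pi.single i 1 := by
    intro u hu
    simp only [crossSet, Finset.mem_union, Finset.mem_image] at hu
    rcases hu with ⟨i, -, rfl⟩ | ⟨i, -, rfl⟩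
    exacts [⟨i, Or.inl rfl⟩, ⟨i, Or.inr rfl⟩]
  refine ⟨fun u hu => ?_, fun u hu w hw h1 h2 => ?_⟩
  · obtain ⟨i, rfl | rfl⟩ := hmem u hu <;> simp
  · obtain ⟨i, hi⟩ := hmem u hu
    obtain ⟨j, hj⟩ := hmem w hw
    have hij : i ≠ j := by
      rintro rfl
      rcases hi with rfl | rfl <;> rcases hj with rfl | rfl <;> simp at h1 h2
    rcases hi with rfl | rfl <;> rcases hj with rfl | rfl <;> simp [hij]

lemma single_one_ne_neg (i j : Fin n) : (Pi.single i 1 : Fin n → ℝ) ≠ -Pi.single j 1 := by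
  intro h
  have := congrFun h i
  by_cases hij : i = j
  · subst hij; norm_num at this
  · simp [hij] at this

lemma single_one_injective : Function.Injective fun i : Fin n => (Pi.single i 1 : Fin n → ℝ) := by
  simpa [Function.Injective] using (Pi.basisFun ℝ (Fin n)).injective

lemma card_image_single_union (A B : Finset (Fin n)) :
    (A.image (fun i => (Pi.single i 1 : Fin n → ℝ)) ∪ B.image (fun i => -Pi.single i 1)).card =
      A.card + B.card := by
  have hinj : Function.Injective fun i : Fin n => -(Pi.single i 1 : Fin n → ℝ) :=
    neg_injective.comp single_one_injective
  rw [Finset.card_union_of_disjoint, Finset.card_image_of_injective _ single_one_injective,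
    Finset.card_image_of_injective _ hinj]
  rw [Finset.disjoint_left]
  intro u hu hu'
  obtain ⟨i, -, rfl⟩ := Finset.mem_image.1 hu
  obtain ⟨j, -, h⟩ := Finset.mem_image.1 hu'
  exact single_one_ne_neg i j h.symm

lemma single_mem_crossSet (i : Fin n) : (Pi.single i 1 : Fin n → ℝ) ∈ crossSet T :=
  Finset.mem_union_left _ (Finset.mem_image_of_mem _ (Finset.mem_univ i))

lemma neg_single_mem_crossSet {i : Fin n} : -(Pi.single i 1 : Fin n → ℝ) ∈ crossSet T ↔ i ∈ T := by
  simp only [crossSet, Finset.mem_union, Finset.mem_image, neg_inj]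
  constructor
  · rintro (⟨j, -, h⟩ | ⟨j, hj, h⟩)
    · exact absurd h (single_one_ne_neg j i)
    · exact single_one_injective h ▸ hj
  · exact fun h => Or.inr ⟨i, h, rfl⟩

lemma card_crossSet (T : Finset (Fin n)) : (crossSet T).card = n + T.card := by
  rw [crossSet, card_image_single_union, Finset.card_univ, Fintype.card_fin]

lemma card_filter_neg_mem_crossSet (T : Finset (Fin n)) :
    {u ∈ crossSet T | -u ∈ crossSet T}.card = 2 * T.card := by
  have : {u ∈ crossSet T | -u ∈ crossSet T} =
      T.image (fun i => Pi.single i 1) ∪ T.image (fun i => -Pi.single i 1) := by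
    ext u
    simp only [Finset.mem_filter, Finset.mem_union, Finset.mem_image]
    constructor
    · rintro ⟨hu, hu'⟩
      rcases Finset.mem_union.1 hu with h | h
      · obtain ⟨i, -, rfl⟩ := Finset.mem_image.1 h
        exact Or.inl ⟨i, neg_single_mem_crossSet.1 hu', rfl⟩
      · exact Or.inr (Finset.mem_image.1 h)
    · rintro (⟨i, hi, rfl⟩ | ⟨i, hi, rfl⟩)
      · exact ⟨single_mem_crossSet i, neg_single_mem_crossSet.2 hi⟩
      · exact ⟨neg_single_mem_crossSet.2 hi, by rw [neg_neg]; exact single_mem_crossSet i⟩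
  rw [this, card_image_single_union, two_mul]

lemma excess_convexHull_crossSet (hT : T.card ≠ 1) :
    excess (convexHull ℝ (crossSet T : Set (Fin n → ℝ))) =
      (n + T.card) * (n + T.card - 1 - adim (convexHull ℝ (crossSet T : Set (Fin n → ℝ)))) -
        2 * T.card := by
  have hS := isOrthoplexSet_crossSet T
  have hanti : ∀ u ∈ crossSet T, -u ∈ crossSet T →
      ∃ w ∈ crossSet T, -w ∈ crossSet T ∧ w ≠ u ∧ w ≠ -u := by
    have hne : ∀ i ∈ T, ∃ j ∈ T, j ≠ i := fun i hi =>
      Finset.exists_mem_ne (lt_of_le_of_ne (Finset.card_pos.2 ⟨i, hi⟩) hT.symm) i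
    intro u hu hu'
    obtain ⟨i, hi, hui⟩ : ∃ i ∈ T, u = Pi.single i 1 ∨ u = -Pi.single i 1 := by
      rcases Finset.mem_union.1 hu with h | h
      · obtain ⟨i, -, rfl⟩ := Finset.mem_image.1 h
        exact ⟨i, neg_single_mem_crossSet.1 hu', Or.inl rfl⟩
      · obtain ⟨i, hi, rfl⟩ := Finset.mem_image.1 h
        exact ⟨i, hi, Or.inr rfl⟩
    obtain ⟨j, hj, hji⟩ := hne i hi
    refine ⟨Pi.single j 1, single_mem_crossSet j, neg_single_mem_crossSet.2 hj, ?_⟩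
    have h1 := single_one_ne_neg j i
    have h2 : (Pi.single j 1 : Fin n → ℝ) ≠ Pi.single i 1 := fun h => hji (single_one_injective h)
    rcases hui with rfl | rfl
    · exact ⟨h2, h1⟩
    · exact ⟨h1, by rwa [neg_neg]⟩
  have hterm : ∀ u ∈ crossSet T,
      ((nbrs (convexHull ℝ (crossSet T : Set (Fin n → ℝ))) u).card : ℤ) =
        n + T.card - 1 - if -u ∈ crossSet T then 1 else 0 := by
    intro u hu
    have h1 := Finset.card_erase_add_one hu
    rw [card_crossSet] at h1
    rw [hS.nbrs_eq hanti hu]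
    split_ifs with h
    · have h2 := Finset.card_erase_add_one
        (Finset.mem_erase.2 ⟨(hS.ne_neg_self hu).symm, h⟩ : -u ∈ (crossSet T).erase u)
      omega
    · rw [Finset.erase_eq_of_notMem fun h2 => h (Finset.mem_of_mem_erase h2)]
      omega
  rw [excess, hS.verts_eq, Finset.sum_sub_distrib, Finset.sum_congr rfl hterm,
    Finset.sum_sub_distrib, Finset.sum_boole, card_filter_neg_mem_crossSet, Finset.sum_const,
    Finset.sum_const, card_crossSet]
  push_cast [nsmul_eq_mul]
  ring

lemma adim_convexHull_crossSet_empty (n : ℕ) :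
    adim (convexHull ℝ (crossSet (∅ : Finset (Fin (n + 1))) : Set (Fin (n + 1) → ℝ))) = n := by
  have h : AffineIndependent ℝ (Pi.basisFun ℝ (Fin (n + 1))) :=
    (Pi.basisFun ℝ (Fin (n + 1))).linearIndependent.affineIndependent
  have hrange : (crossSet (∅ : Finset (Fin (n + 1))) : Set (Fin (n + 1) → ℝ)) =
      Set.range (Pi.basisFun ℝ (Fin (n + 1))) := by
    ext u
    simp [crossSet]
  rw [adim_convexHull, hrange, h.finrank_vectorSpan (Fintype.card_fin _)]

lemma adim_convexHull_crossSet (hT : T.Nonempty) :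
    adim (convexHull ℝ (crossSet T : Set (Fin n → ℝ))) = n := by
  obtain ⟨i, hi⟩ := hT
  suffices h : vectorSpan ℝ (crossSet T : Set (Fin n → ℝ)) = ⊤ by
    rw [adim_convexHull, h, finrank_top, Module.finrank_fin_fun]
  rw [eq_top_iff, ← (Pi.basisFun ℝ (Fin n)).span_eq, Submodule.span_le]
  have hsub : ∀ u ∈ crossSet T, ∀ w ∈ crossSet T,
      u - w ∈ vectorSpan ℝ (crossSet T : Set (Fin n → ℝ)) :=
    fun u hu w hw => vsub_mem_vectorSpan ℝ hu hw
  have hi1 := hsub _ (single_mem_crossSet i) _ (neg_single_mem_crossSet.2 hi)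
  rintro _ ⟨j, rfl⟩
  have hj := hsub _ (single_mem_crossSet j) _ (single_mem_crossSet i)
  have hsum : Pi.basisFun ℝ (Fin n) j = (Pi.single j 1 - Pi.single i 1) +
      (1 / 2 : ℝ) • (Pi.single i 1 - -Pi.single i 1) := by
    rw [Pi.basisFun_apply]
    module
  rw [SetLike.mem_coe, hsum]
  exact Submodule.add_mem _ hj (Submodule.smul_mem _ _ hi1)

end CrossPolytope

/-- For `d ≥ 3` the excess degree of a `d`-polytope is never strictly between `0` and
`d - 2`, and both values `0` and `d - 2` are attained. -/
theorem stmt18 (d : ℕ) (hd : 3 ≤ d) :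
    (∀ (n : ℕ) (P : Set (Fin n → ℝ)), IsDPolytope d P →
      ¬(0 < 2 * (f₁ P : ℤ) - (d : ℤ) * (f₀ P : ℤ) ∧
        2 * (f₁ P : ℤ) - (d : ℤ) * (f₀ P : ℤ) < (d : ℤ) - 2)) ∧
    (∃ (n : ℕ) (P : Set (Fin n → ℝ)), IsDPolytope d P ∧
      2 * (f₁ P : ℤ) - (d : ℤ) * (f₀ P : ℤ) = 0) ∧
    (∃ (n : ℕ) (P : Set (Fin n → ℝ)), IsDPolytope d P ∧
      2 * (f₁ P : ℤ) - (d : ℤ) * (f₀ P : ℤ) = (d : ℤ) - 2) := by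
  refine ⟨?_, ?_, ?_⟩
  · rintro n P ⟨hP, rfl⟩
    rw [two_mul_f₁_sub_eq_excess hP]
    rcases excess_eq_zero_or_le hP with h | h <;> omega
  · have hP := isPolytope_convexHull (crossSet (∅ : Finset (Fin (d + 1))))
    have hdim := adim_convexHull_crossSet_empty d
    refine ⟨d + 1, _, ⟨hP, hdim⟩, ?_⟩
    have h := two_mul_f₁_sub_eq_excess hP
    rw [excess_convexHull_crossSet (by simp), hdim] at h
    rw [h]
    push_cast [Finset.card_empty]
    ring
  · let T : Finset (Fin d) := {⟨0, by omega⟩, ⟨1, by omega⟩}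
    have hT : T.card = 2 := Finset.card_pair (by simp)
    have hP := isPolytope_convexHull (crossSet T)
    have hdim := adim_convexHull_crossSet (T := T) (Finset.card_pos.1 (by omega))
    refine ⟨d, _, ⟨hP, hdim⟩, ?_⟩
    have h := two_mul_f₁_sub_eq_excess hP
    rw [excess_convexHull_crossSet (by omega), hdim, hT] at h
    rw [h]
    push_cast
    ring
end

section
/- Let φ(v, d) = (1/2)·d·v + (1/2)·(v − d − 1)·(2d − v). For every d-polytope P: (1) if f_0(P) ≤ 2d, then f_1(P) ≥ φ(f_0(P), d); and (2) if d ≥ 4, then (f_0(P), f_1(P)) ≠ (d + 4, φ(d + 4, d) + 1). -/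
open Set

/-- `φ(v, d) = (1/2)·d·v + (1/2)·(v - d - 1)·(2d - v)`. -/
def phi (v d : ℚ) : ℚ := d * v / 2 + (v - d - 1) * (2 * d - v) / 2

theorem exists_extreme_segments_span {E : Type*} [NormedAddCommGroup E] [NormedSpace ℝ E]
    [DecidableEq E] {G : Finset E} {v : E} (hv : v ∈ G)
    (hG : ∀ w ∈ G, w ∈ (convexHull ℝ (G : Set E)).extremePoints ℝ) :
    ∃ W ⊆ G.erase v, (∀ w ∈ W, IsExtreme ℝ (convexHull ℝ (G : Set E)) (segment ℝ v w)) ∧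
      ∀ u ∈ G, u - v ∈ Submodule.span ℝ ((fun w => w - v) '' (W : Set E)) := by
  classical
  set P := convexHull ℝ (G : Set E) with hP
  have hGP : (G : Set E) ⊆ P := subset_convexHull ℝ _
  -- a functional exposing `v`
  obtain ⟨f, r, hfv, hf⟩ : ∃ (f : StrongDual ℝ E) (r : ℝ), f v < r ∧
      ∀ b ∈ convexHull ℝ ((G.erase v : Finset E) : Set E), r < f b := by
    apply geometric_hahn_banach_point_closed (convex_convexHull ℝ _)
      (Set.Finite.isClosed_convexHull _ (G.erase v).finite_toSet)
    have h1 := ((convex_convexHull ℝ _).mem_extremePoints_iff_mem_sdiff_convexHull_sdiff.1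
      (hG v hv)).2
    refine fun h2 => h1 (convexHull_mono ?_ h2)
    intro x hx
    simp only [Finset.coe_erase, mem_sdiff, Finset.mem_coe, mem_singleton_iff] at hx
    exact ⟨hGP hx.1, hx.2⟩
  have hfpos : ∀ w ∈ G.erase v, 0 < f (w - v) := by
    intro w hw
    have := hf w (subset_convexHull ℝ _ hw)
    rw [map_sub]; linarith
  -- conic generation
  let gen : Finset E → E → Prop := fun W u =>
    ∃ c : E → ℝ, (∀ w, 0 ≤ c w) ∧ u - v = ∑ w ∈ W, c w • (w - v)
  have hgen0 : ∀ u ∈ G, gen (G.erase v) u := by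
    intro u hu
    by_cases huv : u = v
    · exact ⟨0, by simp, by simp [huv]⟩
    · refine ⟨Pi.single u 1, fun w => ?_, ?_⟩
      · by_cases h : w = u
        · subst h; simp
        · simp [h]
      · rw [Finset.sum_eq_single u]
        · simp
        · intro b _ hb; simp [hb]
        · intro h; exact absurd (Finset.mem_erase.2 ⟨huv, hu⟩) h
  obtain ⟨W, hW, hmin⟩ : ∃ W ∈ (G.erase v).powerset.filter (fun W => ∀ u ∈ G, gen W u),
      ∀ W' ∈ (G.erase v).powerset.filter (fun W => ∀ u ∈ G, gen W u), W.card ≤ W'.card :=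
    Finset.exists_min_image _ _ ⟨G.erase v, by simpa using hgen0⟩
  simp only [Finset.mem_filter, Finset.mem_powerset] at hW hmin
  obtain ⟨hWG, hWgen⟩ := hW
  have hgenP : ∀ x ∈ P, gen W x := by
    have hconv : Convex ℝ {x | gen W x} := by
      rintro x ⟨c, hc, hx⟩ y ⟨c', hc', hy⟩ a b ha hb hab
      refine ⟨fun w => a * c w + b * c' w, fun w => by
        have := hc w; have := hc' w; positivity, ?_⟩
      have : a • x + b • y - v = a • (x - v) + b • (y - v) := by
        have : v = a • v + b • v := by rw [← add_smul, hab, one_smul]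
        nth_rw 1 [this]; module
      rw [this, hx, hy, Finset.smul_sum, Finset.smul_sum, ← Finset.sum_add_distrib]
      exact Finset.sum_congr rfl fun w _ => by module
    exact fun x hx => convexHull_min (fun u hu => hWgen u hu) hconv hx
  -- no generator is redundant
  have hirr : ∀ w ∈ W, ¬ gen (W.erase w) w := by
    rintro w hw ⟨c, hc, hcw⟩
    have : ∀ u ∈ G, gen (W.erase w) u := by
      intro u hu
      obtain ⟨c', hc', hu'⟩ := hWgen u hu
      refine ⟨fun i => c' i + c' w * c i, fun i => by
        have := hc' i; have := hc' w; have := hc i; positivity, ?_⟩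
      rw [hu', ← Finset.add_sum_erase _ _ hw]
      nth_rw 1 [hcw]
      rw [Finset.smul_sum, ← Finset.sum_add_distrib]
      exact Finset.sum_congr rfl fun w _ => by module
    have := hmin _ ⟨(Finset.erase_subset _ _).trans hWG, this⟩
    have := Finset.card_erase_lt_of_mem hw
    omega
  refine ⟨W, hWG, fun w hw => ⟨?_, ?_⟩, fun u hu => ?_⟩
  · exact (convex_convexHull ℝ _).segment_subset (hGP hv) (hGP (Finset.mem_of_mem_erase (hWG hw)))
  · intro x hx y hy z hz hzxy
    obtain ⟨α, hα, hxα⟩ := hgenP x hx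
    obtain ⟨β, hβ, hyβ⟩ := hgenP y hy
    rw [segment_eq_image'] at hz
    obtain ⟨t, ht, rfl⟩ := hz
    obtain ⟨a, b, ha, hb, hab, hz⟩ := hzxy
    set γ : E → ℝ := fun i => a * α i + b * β i with hγ
    have hγ0 : ∀ i, 0 ≤ γ i := fun i => by
      have := hα i; have := hβ i; simp only [hγ]; positivity
    have hsum : ∑ i ∈ W, γ i • (i - v) = t • (w - v) := by
      have h1 : t • (w - v) = a • (x - v) + b • (y - v) := by
        have h2 : v = a • v + b • v := by rw [← add_smul, hab, one_smul]
        have h3 : t • (w - v) = (a • x + b • y) - v := by rw [hz]; module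
        rw [h3]; nth_rw 1 [h2]; module
      rw [h1, hxα, hyβ, Finset.smul_sum, Finset.smul_sum, ← Finset.sum_add_distrib]
      exact Finset.sum_congr rfl fun w _ => by simp only [hγ]; module
    rw [← Finset.add_sum_erase _ _ hw] at hsum
    have hle : t ≤ γ w := by
      by_contra! hlt
      refine hirr w hw ⟨fun i => γ i / (t - γ w), fun i =>
        div_nonneg (hγ0 i) (by linarith), ?_⟩
      have h1 : ∑ i ∈ W.erase w, γ i • (i - v) = (t - γ w) • (w - v) := by
        rw [sub_smul, ← hsum]; module
      have h2 : (t - γ w) ≠ 0 := by linarith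
      calc w - v = (t - γ w)⁻¹ • ((t - γ w) • (w - v)) := by rw [smul_smul, inv_mul_cancel₀ h2, one_smul]
        _ = _ := by
          rw [← h1, Finset.smul_sum]
          exact Finset.sum_congr rfl fun i _ => by simp only [smul_smul, div_eq_inv_mul]
    have hzero : ∀ i ∈ W.erase w, γ i = 0 := by
      have h1 := congrArg f hsum
      simp only [map_add, map_smul, map_sum, smul_eq_mul] at h1
      have hnn : ∀ i ∈ W.erase w, 0 ≤ γ i * f (i - v) := fun i hi =>
        mul_nonneg (hγ0 i) (hfpos i (hWG (Finset.mem_of_mem_erase hi))).le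
      have h2 : ∑ i ∈ W.erase w, γ i * f (i - v) = 0 := by
        refine le_antisymm ?_ (Finset.sum_nonneg hnn)
        have := mul_le_mul_of_nonneg_right hle (hfpos w (hWG hw)).le
        linarith
      intro i hi
      have := (Finset.sum_eq_zero_iff_of_nonneg hnn).1 h2 i hi
      exact (mul_eq_zero.1 this).resolve_right
        (hfpos i (hWG (Finset.mem_of_mem_erase hi))).ne'
    have hx2 : x - v = α w • (w - v) := by
      rw [hxα, ← Finset.add_sum_erase _ _ hw, Finset.sum_eq_zero, add_zero]
      intro i hi
      have h1 := hzero i hi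
      simp only [hγ] at h1
      have h2 := mul_nonneg hb.le (hβ i)
      have h3 : α i = 0 := by
        have h4 := mul_nonneg ha.le (hα i)
        have : a * α i = 0 := by linarith
        exact (mul_eq_zero.1 this).resolve_left ha.ne'
      rw [h3, zero_smul]
    have hwG := Finset.mem_erase.1 (hWG hw)
    have hα1 : α w ≤ 1 := by
      by_contra! h
      have := (hG w hwG.2).2 (hGP hv) hx ⟨1 - (α w)⁻¹, (α w)⁻¹, by
        have := inv_lt_one_of_one_lt₀ h; linarith, by positivity, by ring, by
        have h4 : x = v + α w • (w - v) := by rw [← hx2]; module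
        rw [h4, smul_add, smul_smul, inv_mul_cancel₀ (by positivity)]; module⟩
      exact hwG.1 this.symm
    rw [segment_eq_image']
    exact ⟨α w, ⟨hα w, hα1⟩, by simp only [← hx2]; module⟩
  · obtain ⟨c, -, h⟩ := hWgen u hu
    rw [h]
    exact Submodule.sum_mem _ fun w hw =>
      Submodule.smul_mem _ _ (Submodule.subset_span ⟨w, hw, rfl⟩)

theorem IsExtreme.eq_convexHull_filter {E : Type*} [AddCommGroup E] [Module ℝ E]
    {V : Finset E} {F : Set E} [DecidablePred (· ∈ F)]
    (h : IsExtreme ℝ (convexHull ℝ (V : Set E)) F) (hF : Convex ℝ F) :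
    F = convexHull ℝ (V.filter (· ∈ F) : Set E) := by
  classical
  set P := convexHull ℝ (V : Set E)
  have hVP : (V : Set E) ⊆ P := subset_convexHull ℝ _
  have hin : convexHull ℝ (V.filter (· ∈ F) : Set E) ⊆ F := convexHull_min (by
    intro x hx; simpa using (Finset.mem_filter.1 hx).2) hF
  have hout : convexHull ℝ (V.filter (· ∉ F) : Set E) ⊆ P \ F := convexHull_min (by
    intro x hx; exact ⟨hVP (Finset.mem_filter.1 hx).1, (Finset.mem_filter.1 hx).2⟩)
      (h.convex_sdiff (convex_convexHull ℝ _))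
  refine Subset.antisymm (fun x hx => ?_) hin
  have hxP := h.subset hx
  have hV : (V : Set E) = (V.filter (· ∈ F) : Set E) ∪ (V.filter (· ∉ F) : Set E) := by
    rw [← Finset.coe_union, Finset.filter_union_filter_not_eq]
  rcases Finset.eq_empty_or_nonempty (V.filter (· ∈ F)) with h1 | h1
  · rw [h1, Finset.coe_empty, empty_union] at hV
    exact absurd hx (hout (hV ▸ hxP)).2
  rcases Finset.eq_empty_or_nonempty (V.filter (· ∉ F)) with h2 | h2
  · rw [h2, Finset.coe_empty, union_empty] at hV
    rw [← hV]; exact hxP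
  change x ∈ convexHull ℝ (V : Set E) at hxP
  rw [hV, convexHull_union h1 h2, mem_convexJoin] at hxP
  obtain ⟨y, hy, z, hz, hxyz⟩ := hxP
  rw [← insert_endpoints_openSegment] at hxyz
  rcases hxyz with rfl | rfl | hxyz
  · exact hy
  · exact absurd hx (hout hz).2
  · exact absurd (h.right_mem_of_mem_openSegment (h.subset (hin hy)) (hout hz).1 hx hxyz)
      (hout hz).2

theorem IsExtreme.mem_of_mem_affineSpan {E : Type*} [AddCommGroup E] [Module ℝ E]
    {P : Set E} {F : Finset E} {w : E} (h : IsExtreme ℝ P (convexHull ℝ (F : Set E)))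
    (hw : w ∈ P) (hwF : w ∈ affineSpan ℝ (F : Set E)) : w ∈ convexHull ℝ (F : Set E) := by
  classical
  have hne : F.Nonempty := by
    by_contra hne
    rw [Finset.not_nonempty_iff_eq_empty] at hne
    subst hne; simp at hwF; exact hwF
  obtain ⟨c, hc1, hc⟩ : ∃ c : E → ℝ, ∑ g ∈ F, c g = 1 ∧ w = ∑ g ∈ F, c g • g := by
    have h1 : (F : Set E) = Set.range (fun i : F => (i : E)) := by simp
    rw [h1] at hwF
    obtain ⟨c, hc1, hc⟩ := eq_affineCombination_of_mem_affineSpan_of_fintype hwF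
    rw [Finset.affineCombination_eq_linear_combination _ _ _ hc1] at hc
    refine ⟨fun g => if hg : g ∈ F then c ⟨g, hg⟩ else 0, ?_, ?_⟩
    · rw [← hc1, ← Finset.sum_coe_sort]; simp
    · rw [hc, ← Finset.sum_coe_sort F]; simp
  set N : ℝ := (F.card : ℝ) with hN
  have hNpos : 0 < N := by simpa [hN] using hne.card_pos
  set S : ℝ := 1 + ∑ g ∈ F, |c g| with hS
  have hSpos : 0 < S := by have := Finset.sum_nonneg (fun g (_ : g ∈ F) => abs_nonneg (c g)); linarith
  have hcS : ∀ g ∈ F, c g ≤ S := fun g hg => by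
    have := Finset.single_le_sum (fun g (_ : g ∈ F) => abs_nonneg (c g)) hg
    have := le_abs_self (c g); linarith
  set t : ℝ := 1 / (N * S) with ht
  have htpos : 0 < t := by positivity
  have htS : t * S = 1 / N := by rw [ht]; field_simp
  have hconv := convex_convexHull ℝ (F : Set E)
  have hmem : ∀ a : E → ℝ, (∀ g ∈ F, 0 ≤ a g) → ∑ g ∈ F, a g = 1 →
      ∑ g ∈ F, a g • g ∈ convexHull ℝ (F : Set E) := fun a ha ha1 =>
    hconv.sum_mem ha ha1 fun g hg => subset_convexHull ℝ _ hg
  have hbar := hmem (fun _ => 1 / N) (fun _ _ => by positivity) (by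
    rw [Finset.sum_const, nsmul_eq_mul, ← hN]; field_simp)
  have hp := hmem (fun g => (1 + t) / N - t * c g) (fun g hg => by
    have := mul_le_mul_of_nonneg_left (hcS g hg) htpos.le
    rw [htS] at this
    have : 0 ≤ t / N := by positivity
    rw [add_div]; linarith) (by
    rw [Finset.sum_sub_distrib, ← Finset.mul_sum, hc1, Finset.sum_const, nsmul_eq_mul, ← hN]
    field_simp; ring)
  refine h.left_mem_of_mem_openSegment hw (h.subset hp) hbar
    ⟨t / (1 + t), 1 / (1 + t), by positivity, by positivity, by field_simp; ring, ?_⟩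
  rw [hc, Finset.smul_sum, Finset.smul_sum, ← Finset.sum_add_distrib]
  refine Finset.sum_congr rfl fun g _ => ?_
  rw [smul_smul, smul_smul, ← add_smul]
  congr 1
  field_simp; ring

/-- The vertex set `F` of a `d`-dimensional face of the polytope with vertex set `V`. -/
def IsFaceSet {E : Type*} [AddCommGroup E] [Module ℝ E] (V : Finset E) (d : ℕ) (F : Finset E) :
    Prop :=
  F ⊆ V ∧ IsExtreme ℝ (convexHull ℝ (V : Set E)) (convexHull ℝ (F : Set E)) ∧
    Module.finrank ℝ (vectorSpan ℝ (F : Set E)) = d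

/-- Adjacency in the graph of the polytope with vertex set `V`. -/
def EdgeAdj {E : Type*} [AddCommGroup E] [Module ℝ E] (V : Finset E) (v w : E) : Prop :=
  v ≠ w ∧ IsExtreme ℝ (convexHull ℝ (V : Set E)) (segment ℝ v w)

section
variable {E : Type*} [NormedAddCommGroup E] [NormedSpace ℝ E] {V : Finset E}

theorem IsFaceSet.mem_extremePoints {d : ℕ} {F : Finset E}
    (hV : ∀ w ∈ V, w ∈ (convexHull ℝ (V : Set E)).extremePoints ℝ)
    (hF : IsFaceSet V d F) {w : E} (hw : w ∈ F) :
    w ∈ (convexHull ℝ (F : Set E)).extremePoints ℝ := by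
  rw [hF.2.1.extremePoints_eq]
  exact ⟨subset_convexHull ℝ _ hw, hV w (hF.1 hw)⟩

theorem IsFaceSet.mem_of_mem_affineSpan {d : ℕ} {F : Finset E}
    (hV : ∀ w ∈ V, w ∈ (convexHull ℝ (V : Set E)).extremePoints ℝ)
    (hF : IsFaceSet V d F) {w : E} (hw : w ∈ V) (hwF : w ∈ affineSpan ℝ (F : Set E)) :
    w ∈ F := by
  have h1 := hF.2.1.mem_of_mem_affineSpan (subset_convexHull ℝ _ hw) hwF
  have h2 : w ∈ (convexHull ℝ (F : Set E)).extremePoints ℝ := by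
    rw [hF.2.1.extremePoints_eq]; exact ⟨h1, hV w hw⟩
  exact extremePoints_convexHull_subset h2

theorem IsFaceSet.span_adj {d : ℕ} {G : Finset E}
    (hV : ∀ w ∈ V, w ∈ (convexHull ℝ (V : Set E)).extremePoints ℝ)
    (hG : IsFaceSet V d G) {v : E} (hv : v ∈ G) :
    ∃ W ⊆ G, (∀ w ∈ W, EdgeAdj V v w) ∧
      ∀ u ∈ G, u - v ∈ Submodule.span ℝ ((fun w => w - v) '' (W : Set E)) := by
  classical
  obtain ⟨W, hW, h1, h2⟩ :=
    exists_extreme_segments_span hv (fun w hw => hG.mem_extremePoints hV hw)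
  exact ⟨W, hW.trans (Finset.erase_subset _ _), fun w hw =>
    ⟨(Finset.ne_of_mem_erase (hW hw)).symm, hG.2.1.trans (h1 w hw)⟩, h2⟩

theorem IsFaceSet.le_degree {d : ℕ} {G : Finset E} [DecidableRel (EdgeAdj V)]
    (hV : ∀ w ∈ V, w ∈ (convexHull ℝ (V : Set E)).extremePoints ℝ)
    (hG : IsFaceSet V d G) {v : E} (hv : v ∈ G) :
    d ≤ (G.filter (EdgeAdj V v)).card := by
  classical
  obtain ⟨W, hW, h1, h2⟩ := hG.span_adj hV hv
  have h3 : vectorSpan ℝ (G : Set E) ≤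
      Submodule.span ℝ ((W.image (fun w => w - v) : Finset E) : Set E) := by
    rw [vectorSpan_eq_span_vsub_set_right ℝ (p := v) hv, Submodule.span_le]
    rintro _ ⟨u, hu, rfl⟩
    rw [Finset.coe_image]
    exact h2 u hu
  rw [← hG.2.2]
  calc _ ≤ _ := Submodule.finrank_mono h3
    _ ≤ (W.image (fun w => w - v)).card := finrank_span_finset_le_card _
    _ ≤ W.card := Finset.card_image_le
    _ ≤ _ := Finset.card_le_card fun w hw => Finset.mem_filter.2 ⟨hW hw, h1 w hw⟩

theorem IsFaceSet.exists_adj_notMem {d e : ℕ} {F G : Finset E}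
    (hV : ∀ w ∈ V, w ∈ (convexHull ℝ (V : Set E)).extremePoints ℝ)
    (hG : IsFaceSet V d G) (hF : IsFaceSet V e F) {v : E} (hvG : v ∈ G) (hvF : v ∈ F)
    (hGF : ¬ G ⊆ F) : ∃ w ∈ G, w ∉ F ∧ EdgeAdj V v w := by
  classical
  obtain ⟨W, hW, h1, h2⟩ := hG.span_adj hV hvG
  by_contra! h
  refine hGF fun u hu => hF.mem_of_mem_affineSpan hV (hG.1 hu) ?_
  have hv : v ∈ affineSpan ℝ (F : Set E) := subset_affineSpan ℝ _ hvF
  rw [← AffineSubspace.vsub_right_mem_direction_iff_mem hv, direction_affineSpan]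
  refine Submodule.span_le.2 ?_ (h2 u hu)
  rintro _ ⟨w, hw, rfl⟩
  refine vsub_mem_vectorSpan ℝ ?_ hvF
  by_contra hwF
  exact h w (hW hw) hwF (h1 w hw)

theorem IsFaceSet.eq_of_subset [FiniteDimensional ℝ E] {d : ℕ} {F G : Finset E}
    (hV : ∀ w ∈ V, w ∈ (convexHull ℝ (V : Set E)).extremePoints ℝ)
    (hF : IsFaceSet V d F) (hG : IsFaceSet V d G) (hne : F.Nonempty) (h : F ⊆ G) : F = G := by
  refine h.antisymm fun u hu => hF.mem_of_mem_affineSpan hV (hG.1 hu) ?_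
  have h1 : vectorSpan ℝ (F : Set E) = vectorSpan ℝ (G : Set E) :=
    Submodule.eq_of_le_of_finrank_eq (vectorSpan_mono ℝ (by exact_mod_cast h))
      (hF.2.2.trans hG.2.2.symm)
  have h2 : affineSpan ℝ (F : Set E) = affineSpan ℝ (G : Set E) := by
    obtain ⟨v, hv⟩ := hne
    refine AffineSubspace.ext_of_direction_eq (by rw [direction_affineSpan, direction_affineSpan, h1])
      ⟨v, subset_affineSpan ℝ _ hv, subset_affineSpan ℝ _ (h hv)⟩
  rw [h2]
  exact subset_affineSpan ℝ _ hu

/-- An edge of a polytope is exposed by a linear functional. -/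
theorem EdgeAdj.exists_exposing [FiniteDimensional ℝ E] {d : ℕ} {G : Finset E}
    (hV : ∀ w ∈ V, w ∈ (convexHull ℝ (V : Set E)).extremePoints ℝ)
    (hG : IsFaceSet V d G) {v w : E} (hvw : EdgeAdj V v w) :
    ∃ f : E →ₗ[ℝ] ℝ, f (w - v) = 0 ∧ ∀ u ∈ G, u ≠ v → u ≠ w → 0 < f (u - v) := by
  classical
  have hVP : (V : Set E) ⊆ convexHull ℝ (V : Set E) := subset_convexHull ℝ _
  set O : Finset E := (G.erase v).erase w with hO
  have hpair : convexHull ℝ (({v, w} : Finset E) : Set E) = segment ℝ v w := by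
    rw [Finset.coe_pair, convexHull_pair]
  have hext : IsExtreme ℝ (convexHull ℝ (V : Set E))
      (convexHull ℝ (({v, w} : Finset E) : Set E)) := by rw [hpair]; exact hvw.2
  have hOut : convexHull ℝ (O : Set E) ⊆
      convexHull ℝ (V : Set E) \ convexHull ℝ (({v, w} : Finset E) : Set E) := by
    refine convexHull_min (fun u hu => ⟨?_, fun h => ?_⟩)
      (hext.convex_sdiff (convex_convexHull ℝ _))
    · exact hVP (hG.1 (Finset.mem_of_mem_erase (Finset.mem_of_mem_erase hu)))
    · have huV := hG.1 (Finset.mem_of_mem_erase (Finset.mem_of_mem_erase hu))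
      have h2 : u ∈ (convexHull ℝ (({v, w} : Finset E) : Set E)).extremePoints ℝ := by
        rw [hext.extremePoints_eq]; exact ⟨h, hV u huV⟩
      have h3 := extremePoints_convexHull_subset h2
      rw [Finset.mem_coe, hO] at hu
      simp at hu h3
      grind
  obtain ⟨f, a, b, hfa, hab, hfb⟩ := geometric_hahn_banach_compact_closed
    (s := convexHull ℝ (O : Set E)) (t := (affineSpan ℝ (({v, w} : Finset E) : Set E) : Set E))
    (convex_convexHull ℝ _) (Set.Finite.isCompact_convexHull _ O.finite_toSet)
    (AffineSubspace.convex _) (AffineSubspace.closed_of_finiteDimensional _)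
    (Set.disjoint_left.2 fun p hp hp' =>
      (hOut hp).2 (hext.mem_of_mem_affineSpan (hOut hp).1 hp'))
  have hline : ∀ s : ℝ, b < f v + s * f (w - v) := by
    intro s
    have h1 : v + s • (w - v) ∈ affineSpan ℝ (({v, w} : Finset E) : Set E) := by
      have hv' : v ∈ affineSpan ℝ (({v, w} : Finset E) : Set E) :=
        subset_affineSpan ℝ _ (by simp)
      rw [← AffineSubspace.vsub_right_mem_direction_iff_mem hv', direction_affineSpan]
      simp only [vsub_eq_sub, add_sub_cancel_left]
      exact Submodule.smul_mem _ _ (vsub_mem_vectorSpan ℝ (by simp) (by simp))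
    simpa using hfb _ h1
  have hzero : f (w - v) = 0 := by
    by_contra h
    have h1 := hline ((b - f v) / f (w - v))
    rw [div_mul_cancel₀ _ h] at h1
    linarith
  refine ⟨-f.toLinearMap, by rw [LinearMap.neg_apply, neg_eq_zero]; exact hzero, fun u hu huv huw => ?_⟩
  have h1 := hfa u (subset_convexHull ℝ _ (by simp [hO, huw, huv, hu]))
  have h2 := hline 0
  have h3 : (-f.toLinearMap) (u - v) = f v - f u := by simp
  rw [h3]; linarith

/-- For an edge `vw` and another vertex `u`, some facet contains the edge but not `u`. -/
theorem IsFaceSet.exists_facet [FiniteDimensional ℝ E] {d : ℕ} {G : Finset E}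
    (hV : ∀ w ∈ V, w ∈ (convexHull ℝ (V : Set E)).extremePoints ℝ)
    (hG : IsFaceSet V (d + 1) G) {v w u : E} (hv : v ∈ G) (hw : w ∈ G) (hu : u ∈ G)
    (hvw : EdgeAdj V v w) (huv : u ≠ v) (huw : u ≠ w) :
    ∃ F ⊆ G, IsFaceSet V d F ∧ v ∈ F ∧ w ∈ F ∧ u ∉ F := by
  classical
  let good : (E →ₗ[ℝ] ℝ) → Prop := fun f =>
    (∀ g ∈ G, 0 ≤ f (g - v)) ∧ f (w - v) = 0 ∧ 0 < f (u - v)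
  let Zs := G.powerset.filter fun Z => ∃ f, good f ∧ Z = G.filter fun g => f (g - v) = 0
  obtain ⟨f₀, hf₀, hf₀'⟩ := hvw.exists_exposing hV hG
  have hne : Zs.Nonempty := by
    refine ⟨G.filter fun g => f₀ (g - v) = 0, Finset.mem_filter.2
      ⟨Finset.mem_powerset.2 (Finset.filter_subset _ _), f₀, ⟨fun g hg => ?_, hf₀,
        hf₀' u hu huv huw⟩, rfl⟩⟩
    by_cases h1 : g = v
    · simp [h1]
    by_cases h2 : g = w
    · simp [h2, hf₀]
    exact (hf₀' g hg h1 h2).le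
  obtain ⟨Z, hZ, hmax⟩ := Finset.exists_max_image Zs Finset.card hne
  obtain ⟨hZG, f, ⟨hf1, hf2, hf3⟩, hZf⟩ := Finset.mem_filter.1 hZ
  rw [Finset.mem_powerset] at hZG
  have hmemZ : ∀ g, g ∈ Z ↔ g ∈ G ∧ f (g - v) = 0 := fun g => by rw [hZf, Finset.mem_filter]
  have hvZ : v ∈ Z := (hmemZ v).2 ⟨hv, by simp⟩
  have hwZ : w ∈ Z := (hmemZ w).2 ⟨hw, hf2⟩
  have huZ : u ∉ Z := fun h => hf3.ne' ((hmemZ u).1 h).2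
  set S := vectorSpan ℝ (G : Set E) with hS
  set T := vectorSpan ℝ (Z : Set E) with hT
  have hSv : S = Submodule.span ℝ ((· -ᵥ v) '' (G : Set E)) :=
    vectorSpan_eq_span_vsub_set_right ℝ hv
  have hTv : T = Submodule.span ℝ ((· -ᵥ v) '' (Z : Set E)) :=
    vectorSpan_eq_span_vsub_set_right ℝ hvZ
  have huS : u - v ∈ S := vsub_mem_vectorSpan ℝ hu hv
  have hTle : T ≤ S ⊓ LinearMap.ker f := by
    refine le_inf (vectorSpan_mono ℝ (by exact_mod_cast hZG)) ?_
    rw [hTv, Submodule.span_le]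
    rintro _ ⟨g, hg, rfl⟩
    exact ((hmemZ g).1 hg).2
  have hTeq : T = S ⊓ LinearMap.ker f := by
    refine hTle.antisymm fun s hs => ?_
    by_contra hsT
    obtain ⟨m₀, hm₀, hTm₀⟩ := Submodule.exists_le_ker_of_notMem hsT
    -- a functional vanishing on `Z` and `u`, not on `G`, and negative somewhere
    obtain ⟨m, hmZ, hmu, g₁, hg₁, hmg₁⟩ : ∃ m : E →ₗ[ℝ] ℝ, (∀ g ∈ Z, m (g - v) = 0) ∧
        m (u - v) = 0 ∧ ∃ g ∈ G, m (g - v) < 0 := by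
      set m := m₀ - (m₀ (u - v) / f (u - v)) • f with hm
      have hm1 : ∀ g ∈ Z, m (g - v) = 0 := by
        intro g hg
        have h1 : m₀ (g - v) = 0 := hTm₀ (vsub_mem_vectorSpan ℝ hg hvZ)
        simp only [hm, LinearMap.sub_apply, LinearMap.smul_apply, h1, ((hmemZ g).1 hg).2]
        simp
      have hm2 : m (u - v) = 0 := by
        simp only [hm, LinearMap.sub_apply, LinearMap.smul_apply, smul_eq_mul]
        rw [div_mul_cancel₀ _ hf3.ne', sub_self]
      have hms : m s ≠ 0 := by
        have : f s = 0 := hs.2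
        simp only [hm, LinearMap.sub_apply, LinearMap.smul_apply, this]
        simpa using hm₀
      have hex : ∃ g ∈ G, m (g - v) ≠ 0 := by
        by_contra! h
        refine hms ?_
        have : S ≤ LinearMap.ker m := by
          rw [hSv, Submodule.span_le]
          rintro _ ⟨g, hg, rfl⟩
          exact h g hg
        exact this hs.1
      obtain ⟨g, hg, hmg⟩ := hex
      rcases lt_or_gt_of_ne hmg with h | h
      · exact ⟨m, hm1, hm2, g, hg, h⟩
      · exact ⟨-m, fun g hg => by rw [LinearMap.neg_apply, hm1 g hg, neg_zero],
          by rw [LinearMap.neg_apply, hm2, neg_zero], g, hg,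
          by rw [LinearMap.neg_apply]; linarith⟩
    obtain ⟨g₂, hg₂, hmin⟩ := Finset.exists_min_image (G.filter fun g => m (g - v) < 0)
      (fun g => f (g - v) / (-m (g - v))) ⟨g₁, Finset.mem_filter.2 ⟨hg₁, hmg₁⟩⟩
    rw [Finset.mem_filter] at hg₂
    set t := f (g₂ - v) / (-m (g₂ - v)) with ht
    have ht0 : 0 ≤ t := div_nonneg (hf1 _ hg₂.1) (by linarith [hg₂.2])
    set f' := f + t • m with hf'
    have hf'app : ∀ x, f' x = f x + t * m x := fun x => by simp [hf']
    have hgood : good f' := by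
      refine ⟨fun g hg => ?_, ?_, ?_⟩
      · rw [hf'app]
        rcases lt_or_ge (m (g - v)) 0 with h | h
        · have h1 := hmin g (Finset.mem_filter.2 ⟨hg, h⟩)
          rw [le_div_iff₀ (by linarith)] at h1
          linarith
        · have := hf1 g hg
          positivity
      · rw [hf'app, hf2, hmZ w hwZ]; simp
      · rw [hf'app, hmu]; simpa using hf3
    have h1 := hmax (G.filter fun g => f' (g - v) = 0) (Finset.mem_filter.2
      ⟨Finset.mem_powerset.2 (Finset.filter_subset _ _), f', hgood, rfl⟩)
    have h2 : insert g₂ Z ⊆ G.filter fun g => f' (g - v) = 0 := by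
      intro g hg
      rw [Finset.mem_insert] at hg
      rw [Finset.mem_filter, hf'app]
      rcases hg with rfl | hg
      · refine ⟨hg₂.1, ?_⟩
        have : m (g - v) ≠ 0 := hg₂.2.ne
        rw [ht]; field_simp; ring
      · exact ⟨hZG hg, by rw [((hmemZ g).1 hg).2, hmZ g hg]; simp⟩
    have h3 : g₂ ∉ Z := fun h => hg₂.2.ne (hmZ _ h)
    have h4 := Finset.card_le_card h2
    rw [Finset.card_insert_of_notMem h3] at h4
    omega
  have hfin : Module.finrank ℝ T = d := by
    have h1 := Submodule.finrank_sup_add_finrank_inf_eq S (LinearMap.ker f)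
    have h2 := LinearMap.finrank_range_add_finrank_ker f
    have h3 : LinearMap.range f = ⊤ := by
      rw [LinearMap.range_eq_top]
      intro r
      exact ⟨(r / f (u - v)) • (u - v), by
        rw [map_smul, smul_eq_mul, div_mul_cancel₀ _ hf3.ne']⟩
    have h4 : S ⊔ LinearMap.ker f = ⊤ := by
      rw [eq_top_iff]
      intro x _
      have : x = (f x / f (u - v)) • (u - v) + (x - (f x / f (u - v)) • (u - v)) := by abel
      rw [this]
      refine Submodule.add_mem_sup (Submodule.smul_mem _ _ huS) ?_
      rw [LinearMap.mem_ker, map_sub, map_smul, smul_eq_mul, div_mul_cancel₀ _ hf3.ne', sub_self]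
    rw [h3, finrank_top, Module.finrank_self] at h2
    rw [h4, finrank_top, ← hTeq, hG.2.2] at h1
    omega
  refine ⟨Z, hZG, ⟨hZG.trans hG.1, hG.2.1.trans ?_, hfin⟩, hvZ, hwZ, huZ⟩
  have hnn : ∀ x ∈ convexHull ℝ (G : Set E), 0 ≤ f (x - v) := by
    have hc : Convex ℝ {x | f v ≤ f x} := convex_halfSpace_ge f.isLinear _
    intro x hx
    have := convexHull_min (fun g hg => by
      have := hf1 g hg; rw [map_sub] at this; simp only [mem_ofPred_eq]; linarith) hc hx
    rw [map_sub]; simp only [mem_ofPred_eq] at this; linarith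
  set B : Set E := {x | x ∈ convexHull ℝ (G : Set E) ∧ f (x - v) = 0} with hB
  have hcomb : ∀ (a b : ℝ) (x y : E), a + b = 1 →
      f (a • x + b • y - v) = a * f (x - v) + b * f (y - v) := by
    intro a b x y hab
    simp only [map_sub, map_add, map_smul, smul_eq_mul]
    linear_combination hab * f v
  have hBext : IsExtreme ℝ (convexHull ℝ (G : Set E)) B := by
    refine ⟨fun x hx => hx.1, ?_⟩
    rintro x hx y hy z ⟨-, hz⟩ ⟨a, b, ha, hb, hab, rfl⟩
    refine ⟨hx, ?_⟩
    rw [hcomb a b x y hab] at hz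
    have h1 := mul_nonneg ha.le (hnn x hx)
    have h2 := mul_nonneg hb.le (hnn y hy)
    have h3 : a * f (x - v) = 0 := by linarith
    exact (mul_eq_zero.1 h3).resolve_left ha.ne'
  have hBconv : Convex ℝ B := by
    rintro x ⟨hx, hx'⟩ y ⟨hy, hy'⟩ a b ha hb hab
    exact ⟨convex_convexHull ℝ _ hx hy ha hb hab, by rw [hcomb a b x y hab, hx', hy']; simp⟩
  have hBZ : B = convexHull ℝ (Z : Set E) := by
    rw [hBext.eq_convexHull_filter hBconv]
    congr 1
    ext g
    simp only [Finset.coe_filter, mem_ofPred_eq, Finset.mem_coe, hmemZ, hB]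
    exact ⟨fun h => ⟨h.1, h.2.2⟩, fun h => ⟨h.1, subset_convexHull ℝ _ h.1, h.2⟩⟩
  rw [← hBZ]; exact hBext

end
section Counting
variable {α : Type*} (Γ : SimpleGraph α)

open Classical in
/-- The vertices of `S` other than `v` which are not adjacent to `v`. -/
noncomputable def nonNbrs (v : α) (S : Finset α) : Finset α :=
  S.filter fun w => v ≠ w ∧ ¬ Γ.Adj v w

/-- The number of pairs in `S ×ˢ T` of distinct nonadjacent vertices. -/
noncomputable def nonAdjCount (S T : Finset α) : ℕ :=
  ∑ v ∈ S, (nonNbrs Γ v T).card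

variable {Γ}

theorem mem_nonNbrs {v w : α} {S : Finset α} :
    w ∈ nonNbrs Γ v S ↔ w ∈ S ∧ v ≠ w ∧ ¬ Γ.Adj v w := by
  simp [nonNbrs]

theorem nonNbrs_subset {v : α} {S : Finset α} : nonNbrs Γ v S ⊆ S :=
  fun _ hw => (mem_nonNbrs.1 hw).1

theorem nonNbrs_mono {v : α} {S T : Finset α} (h : S ⊆ T) : nonNbrs Γ v S ⊆ nonNbrs Γ v T :=
  fun _ hw => mem_nonNbrs.2 ((mem_nonNbrs.1 hw).imp_left (@h _))

theorem nonAdjCount_comm (S T : Finset α) : nonAdjCount Γ S T = nonAdjCount Γ T S := by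
  classical
  simp only [nonAdjCount, nonNbrs, Finset.card_filter]
  rw [Finset.sum_comm]
  simp only [ne_comm, Γ.adj_comm]

theorem card_nonNbrs_mono {v : α} {S T : Finset α} (h : S ⊆ T) :
    (nonNbrs Γ v S).card ≤ (nonNbrs Γ v T).card :=
  Finset.card_le_card (nonNbrs_mono h)

theorem nonAdjCount_le_mul {S T : Finset α} {n : ℕ} (h : ∀ v ∈ S, (nonNbrs Γ v T).card ≤ n) :
    nonAdjCount Γ S T ≤ S.card * n := by
  simpa [nonAdjCount] using Finset.sum_le_card_nsmul S _ n h

theorem mul_le_nonAdjCount {S T : Finset α} {n : ℕ} (h : ∀ v ∈ S, n ≤ (nonNbrs Γ v T).card) :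
    S.card * n ≤ nonAdjCount Γ S T := by
  simpa [nonAdjCount] using Finset.card_nsmul_le_sum S _ n h

theorem nonAdjCount_mono_right {S T T' : Finset α} (h : T ⊆ T') :
    nonAdjCount Γ S T ≤ nonAdjCount Γ S T' :=
  Finset.sum_le_sum fun _ _ => card_nonNbrs_mono h

theorem nonAdjCount_eq_zero_iff {S T : Finset α} :
    nonAdjCount Γ S T = 0 ↔ ∀ v ∈ S, ∀ w ∈ T, v ≠ w → Γ.Adj v w := by
  simp only [nonAdjCount, Finset.sum_eq_zero_iff, Finset.card_eq_zero,
    Finset.eq_empty_iff_forall_notMem, mem_nonNbrs]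
  grind

variable [DecidableEq α]

theorem card_nonNbrs_add_sdiff {F V : Finset α} (h : F ⊆ V) (v : α) :
    (nonNbrs Γ v F).card + (nonNbrs Γ v (V \ F)).card = (nonNbrs Γ v V).card := by
  rw [← Finset.card_union_of_disjoint]
  · congr 1; ext w; simp only [Finset.mem_union, mem_nonNbrs, Finset.mem_sdiff]; grind
  · rw [Finset.disjoint_left]; simp only [mem_nonNbrs, Finset.mem_sdiff]; grind

theorem nonAdjCount_add_sdiff_left {F V : Finset α} (h : F ⊆ V) (T : Finset α) :
    nonAdjCount Γ F T + nonAdjCount Γ (V \ F) T = nonAdjCount Γ V T := by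
  rw [nonAdjCount, nonAdjCount, nonAdjCount, add_comm, Finset.sum_sdiff h]

theorem nonAdjCount_add_sdiff_right {F V : Finset α} (h : F ⊆ V) (S : Finset α) :
    nonAdjCount Γ S F + nonAdjCount Γ S (V \ F) = nonAdjCount Γ S V := by
  simp only [nonAdjCount, ← Finset.sum_add_distrib, card_nonNbrs_add_sdiff h]

theorem nonAdjCount_self_add {F V : Finset α} (h : F ⊆ V) :
    nonAdjCount Γ V V + nonAdjCount Γ (V \ F) (V \ F) =
      nonAdjCount Γ F F + 2 * nonAdjCount Γ (V \ F) V := by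
  have h1 := nonAdjCount_add_sdiff_left (Γ := Γ) h V
  have h2 := nonAdjCount_add_sdiff_right (Γ := Γ) h F
  have h3 := nonAdjCount_add_sdiff_right (Γ := Γ) h (V \ F)
  have h4 := nonAdjCount_comm (Γ := Γ) F (V \ F)
  omega

theorem card_filter_adj_add [DecidableRel Γ.Adj] {F : Finset α}
    {v : α} (hv : v ∈ F) :
    (F.filter (Γ.Adj v)).card + (nonNbrs Γ v F).card + 1 = F.card := by
  classical
  have h1 : F.erase v = F.filter (Γ.Adj v) ∪ nonNbrs Γ v F := by
    ext w
    simp only [Finset.mem_erase, Finset.mem_union, Finset.mem_filter, mem_nonNbrs]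
    have := Γ.ne_of_adj (a := v) (b := w)
    grind
  have h2 : Disjoint (F.filter (Γ.Adj v)) (nonNbrs Γ v F) := by
    rw [Finset.disjoint_left]
    simp only [Finset.mem_filter, mem_nonNbrs]
    tauto
  rw [← Finset.card_union_of_disjoint h2, ← h1, Finset.card_erase_add_one hv]

end Counting

/-- The combinatorial properties of the faces of a polytope used below: `face d F` says that `F` is
the vertex set of a `d`-dimensional face, and `Γ` is the graph of the polytope. -/
structure FaceSystem {α : Type*} (Γ : SimpleGraph α) (face : ℕ → Finset α → Prop) : Prop where
  nonempty : ∀ {d F}, face d F → F.Nonempty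
  dim_unique : ∀ {d e F}, face d F → face e F → d = e
  card_nonNbrs : ∀ {d F v}, face d F → v ∈ F → (nonNbrs Γ v F).card + d + 1 ≤ F.card
  leave : ∀ {d e G F v}, face d G → face e F → v ∈ G → v ∈ F → ¬ G ⊆ F →
    ∃ w ∈ G, w ∉ F ∧ Γ.Adj v w
  eq_of_subset : ∀ {d F G}, face d F → face d G → F ⊆ G → F = G
  exists_facet : ∀ {d G v w u}, face (d + 1) G → v ∈ G → w ∈ G → u ∈ G → Γ.Adj v w → u ≠ v →
    u ≠ w → ∃ F ⊆ G, face d F ∧ v ∈ F ∧ w ∈ F ∧ u ∉ F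

namespace FaceSystem
variable {α : Type*} [DecidableEq α] {Γ : SimpleGraph α} {face : ℕ → Finset α → Prop}

theorem exists_facet_separating (hS : FaceSystem Γ face) {d : ℕ} {G : Finset α} (hd : 1 ≤ d)
    (hG : face (d + 1) G) {v u : α} (hv : v ∈ G) (hu : u ∈ G) (hvu : v ≠ u) :
    ∃ F ⊆ G, face d F ∧ v ∈ F ∧ u ∉ F := by
  have h1 := hS.card_nonNbrs hG hv
  obtain ⟨w, hw, hw'⟩ : ∃ w ∈ G, w ∉ nonNbrs Γ v G ∪ {v, u} := by
    by_contra! h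
    have h2 := (Finset.card_le_card (show G ⊆ _ from h)).trans (Finset.card_union_le _ _)
    have h3 := Finset.card_le_two (a := v) (b := u)
    omega
  simp only [Finset.mem_union, mem_nonNbrs, Finset.mem_insert, Finset.mem_singleton] at hw'
  obtain ⟨F, hFG, hF, hvF, -, huF⟩ :=
    hS.exists_facet hG hv hw hu (by grind) hvu.symm (by grind)
  exact ⟨F, hFG, hF, hvF, huF⟩

theorem exists_facet_ssubset (hS : FaceSystem Γ face) {d : ℕ} {G : Finset α} (hd : 1 ≤ d)
    (hG : face (d + 1) G) : ∃ F ⊂ G, face d F := by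
  obtain ⟨v, hv⟩ := hS.nonempty hG
  have h1 := hS.card_nonNbrs hG hv
  obtain ⟨u, hu, huv⟩ := Finset.exists_mem_ne (show 1 < G.card by omega) v
  obtain ⟨F, hFG, hF, -, huF⟩ := hS.exists_facet_separating hd hG hv hu huv.symm
  exact ⟨F, Finset.ssubset_iff_subset_ne.2 ⟨hFG, by grind⟩, hF⟩

theorem nonAdjCount_eq_of_card_sdiff_eq_one (hS : FaceSystem Γ face) {d e : ℕ} {F G : Finset α}
    (hF : face d F) (hG : face e G) (hFG : F ⊆ G) (h : (G \ F).card = 1) :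
    nonAdjCount Γ G G = nonAdjCount Γ F F := by
  obtain ⟨x, hx⟩ := Finset.card_eq_one.1 h
  have hxm : ∀ w, w ∈ G ∧ w ∉ F ↔ w = x := fun w => by
    rw [← Finset.mem_sdiff, hx, Finset.mem_singleton]
  have h1 := nonAdjCount_self_add (Γ := Γ) hFG
  have h2 : nonAdjCount Γ (G \ F) G = 0 := by
    rw [nonAdjCount_eq_zero_iff]
    intro v hv w hw hvw
    rw [hx, Finset.mem_singleton] at hv
    subst hv
    have hwF : w ∈ F := by grind
    obtain ⟨u, huG, huF, hu⟩ := hS.leave hG hF hw hwF (by grind)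
    rw [(hxm u).1 ⟨huG, huF⟩] at hu
    exact hu.symm
  have h3 := nonAdjCount_mono_right (Γ := Γ) (S := G \ F) (Finset.sdiff_subset : G \ F ⊆ G)
  omega

theorem nonAdjCount_le (hS : FaceSystem Γ face) : ∀ (d t : ℕ) (F : Finset α), face d F →
    F.card = d + t + 1 → t + 1 ≤ d → nonAdjCount Γ F F ≤ 2 * ((t + 1) * t) := by
  intro d
  induction d with
  | zero => intro t F _ _ h; omega
  | succ d ih =>
    intro t F hF hcard ht
    have hnd : ∀ v ∈ F, (nonNbrs Γ v F).card ≤ t := fun v hv => by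
      have := hS.card_nonNbrs hF hv; omega
    rcases ht.eq_or_lt with h | h
    · have h1 := nonAdjCount_le_mul hnd
      rw [hcard, ← h] at h1
      calc _ ≤ _ := h1
        _ = _ := by ring
    · obtain ⟨H, hHF, hH⟩ := hS.exists_facet_ssubset (by omega) hF
      obtain ⟨v, hv⟩ := hS.nonempty hH
      have h1 := hS.card_nonNbrs hH hv
      have h2 := Finset.card_lt_card hHF
      obtain ⟨t', ht'⟩ : ∃ t', H.card = d + t' + 1 := ⟨H.card - d - 1, by omega⟩
      have h3 := ih t' H hH ht' (by omega)
      have h4 : (F \ H).card + H.card = F.card := Finset.card_sdiff_add_card_eq_card hHF.1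
      rcases (show t' ≤ t by omega).eq_or_lt with h5 | h5
      · subst h5
        rwa [hS.nonAdjCount_eq_of_card_sdiff_eq_one hH hF hHF.1 (by omega)]
      · have h6 := nonAdjCount_self_add (Γ := Γ) hHF.1
        have h7 := nonAdjCount_le_mul (S := F \ H) fun v hv =>
          hnd v (Finset.sdiff_subset hv)
        obtain ⟨c, rfl⟩ : ∃ c, t = t' + 1 + c := ⟨t - t' - 1, by omega⟩
        have h8 : (F \ H).card = c + 2 := by omega
        rw [h8] at h7
        nlinarith

end FaceSystem

/-- The hypotheses under which we look for a contradiction: `V` is the vertex set of a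
`(k + 1)`-face with `k + 5` vertices and 11 missing edges, all of whose facets miss at least two
vertices. -/
structure HasElevenNonEdges {α : Type*} [DecidableEq α] (Γ : SimpleGraph α)
    (face : ℕ → Finset α → Prop) (k : ℕ) (V : Finset α) : Prop where
  sys : FaceSystem Γ face
  three_le : 3 ≤ k
  face_top : face (k + 1) V
  card_top : V.card = k + 5
  count : nonAdjCount Γ V V = 22
  two_le : ∀ {G}, face k G → G ⊆ V → 2 ≤ (V \ G).card

namespace HasElevenNonEdges
variable {α : Type*} [DecidableEq α] {Γ : SimpleGraph α} {face : ℕ → Finset α → Prop} {k : ℕ}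
  {V : Finset α} {F G H : Finset α} {v w u a b c x y : α}

theorem card_sdiff (h : HasElevenNonEdges Γ face k V) (hGV : G ⊆ V) :
    (V \ G).card + G.card = k + 5 := by
  rw [Finset.card_sdiff_add_card_eq_card hGV, h.card_top]

theorem card_nonNbrs_le (h : HasElevenNonEdges Γ face k V) (hv : v ∈ V) :
    (nonNbrs Γ v V).card ≤ 3 := by
  have := h.sys.card_nonNbrs h.face_top hv
  have := h.card_top
  omega

theorem exists_adj_out (h : HasElevenNonEdges Γ face k V) (hG : face k G) (hGV : G ⊆ V)
    (hv : v ∈ G) : ∃ w ∈ V, w ∉ G ∧ Γ.Adj v w :=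
  h.sys.leave h.face_top hG (hGV hv) hv fun h1 => by
    have := h.two_le hG hGV
    rw [Finset.sdiff_eq_empty_iff_subset.2 h1] at this
    simp at this

theorem exists_facet (h : HasElevenNonEdges Γ face k V) (hv : v ∈ V) (hu : u ∈ V) (hvu : v ≠ u) :
    ∃ G ⊆ V, face k G ∧ v ∈ G ∧ u ∉ G :=
  h.sys.exists_facet_separating (by have := h.three_le; omega) h.face_top hv hu hvu

theorem exists_adj_diff (h : HasElevenNonEdges Γ face k V) (hG : face k G) (hF : face k F)
    (hvG : v ∈ G) (hvF : v ∈ F) (hGF : G ≠ F) : ∃ w ∈ G, w ∉ F ∧ Γ.Adj v w :=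
  h.sys.leave hG hF hvG hvF fun h1 => hGF (h.sys.eq_of_subset hG hF h1)

/-- A simple vertex of a facet has only one neighbour outside this facet. -/
theorem eq_of_adj_out (h : HasElevenNonEdges Γ face k V) (hv : (nonNbrs Γ v V).card = 3)
    (hG : face k G) (hGV : G ⊆ V) (hvG : v ∈ G) (hx : x ∈ V) (hxG : x ∉ G) (hvx : Γ.Adj v x)
    (hy : y ∈ V) (hyG : y ∉ G) (hvy : Γ.Adj v y) : x = y := by
  by_contra hxy
  have h1 := h.sys.card_nonNbrs hG hvG
  have h2 := card_nonNbrs_add_sdiff (Γ := Γ) hGV v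
  have h3 := h.card_sdiff hGV
  have h4 : nonNbrs Γ v (V \ G) ⊆ ((V \ G).erase x).erase y := by
    intro w
    simp only [mem_nonNbrs, Finset.mem_erase]
    grind
  have h5 := Finset.card_le_card h4
  rw [Finset.card_erase_of_mem, Finset.card_erase_of_mem] at h5
  · have := h.two_le hG hGV
    omega
  · simp [hx, hxG]
  · simp [hy, hyG, Ne.symm hxy]

theorem facet_unique (h : HasElevenNonEdges Γ face k V) (hv : (nonNbrs Γ v V).card = 3)
    (hG : face k G) (hGV : G ⊆ V) (hvG : v ∈ G) (hH : face k H) (hHV : H ⊆ V) (hvH : v ∈ H)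
    (hx : x ∈ V) (hxG : x ∉ G) (hxH : x ∉ H) (hvx : Γ.Adj v x) : G = H := by
  by_contra hGH
  obtain ⟨w, hwG, hwH, hw⟩ := h.exists_adj_diff hG hH hvG hvH hGH
  rw [h.eq_of_adj_out hv hH hHV hvH (hGV hwG) hwH hw hx hxH hvx] at hwG
  exact hxG hwG

theorem nonAdjCount_facet_le (h : HasElevenNonEdges Γ face k V) (hG : face k G) (hGV : G ⊆ V) :
    ∀ t, (V \ G).card + t = 4 → nonAdjCount Γ G G ≤ 2 * ((t + 1) * t) := by
  intro t ht
  have h1 := h.card_sdiff hGV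
  have h2 := h.two_le hG hGV
  have h3 := h.three_le
  exact h.sys.nonAdjCount_le k t G hG (by omega) (by omega)

theorem mem_and_notMem_iff (hM : V \ F = {a, b}) (w : α) : w ∈ V ∧ w ∉ F ↔ w = a ∨ w = b := by
  rw [← Finset.mem_sdiff, hM, Finset.mem_insert, Finset.mem_singleton]

theorem nonNbrs_eq_of_adj (hFV : F ⊆ V) (hM : V \ F = {a, b}) (hab : Γ.Adj a b) :
    nonNbrs Γ a V = nonNbrs Γ a F := by
  have hm := mem_and_notMem_iff hM
  ext w
  simp only [mem_nonNbrs]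
  grind

theorem adj_or_adj (h : HasElevenNonEdges Γ face k V) (hF : face k F) (hFV : F ⊆ V)
    (hM : V \ F = {a, b}) (hx : x ∈ F) : Γ.Adj a x ∨ Γ.Adj b x := by
  obtain ⟨w, hw, hwF, hxw⟩ := h.exists_adj_out hF hFV hx
  rcases (mem_and_notMem_iff hM w).1 ⟨hw, hwF⟩ with rfl | rfl
  exacts [Or.inl hxw.symm, Or.inr hxw.symm]

/-- If a facet `F` misses two adjacent simple vertices, then each vertex of `F` not adjacent to one
of them has at least two nonneighbours in `F`. -/
theorem two_le_card_nonNbrs (h : HasElevenNonEdges Γ face k V) (hF : face k F) (hFV : F ⊆ V)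
    (hM : V \ F = {a, b}) (hab : Γ.Adj a b) (ha : (nonNbrs Γ a V).card = 3)
    (hb : (nonNbrs Γ b V).card = 3)
    (hy : y ∈ F) (hay : ¬ Γ.Adj a y) :
    2 ≤ (nonNbrs Γ y F).card := by
  have hm := mem_and_notMem_iff hM
  have haV := (hm a).2 (Or.inl rfl)
  have hbV := (hm b).2 (Or.inr rfl)
  have hout : ∀ x ∈ F, Γ.Adj a x ∨ Γ.Adj b x := fun x => h.adj_or_adj hF hFV hM
  have hby : Γ.Adj b y := (hout y hy).resolve_left hay
  obtain ⟨K, hKV, hK, hbK, hyK⟩ := h.exists_facet hbV.1 (hFV hy) (by grind)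
  have haK : a ∈ K := by
    by_contra haK
    have := h.eq_of_adj_out hb hK hKV hbK (hFV hy) hyK hby haV.1 haK hab.symm
    grind
  -- the neighbours of `y` among the nonneighbours of `b` avoid `K`
  have key : ∀ x ∈ F, ¬ Γ.Adj b x → Γ.Adj x y → x ∉ K := by
    intro x hx hbx hxy hxK
    have hax : Γ.Adj a x := (hout x hx).resolve_right hbx
    obtain ⟨x', hx', hx'y⟩ := Finset.exists_mem_ne (h.two_le hK hKV) y
    rw [Finset.mem_sdiff] at hx'
    have hx'F : x' ∈ F := by
      by_contra hc
      rcases (hm x').1 ⟨hx'.1, hc⟩ with rfl | rfl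
      exacts [hx'.2 haK, hx'.2 hbK]
    have hbx' : ¬ Γ.Adj b x' := fun hc =>
      hx'y (h.eq_of_adj_out hb hK hKV hbK hx'.1 hx'.2 hc (hFV hy) hyK hby)
    have hax' : Γ.Adj a x' := (hout x' hx'F).resolve_right hbx'
    obtain ⟨G, hGV, hG, hxG, hyG, hx'G⟩ := h.sys.exists_facet h.face_top (hFV hx) (hFV hy) hx'.1 hxy
      (by grind) hx'y
    by_cases haG : a ∈ G <;> by_cases hbG : b ∈ G
    · rw [h.facet_unique ha hG hGV haG hK hKV haK hx'.1 hx'G hx'.2 hax'] at hyG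
      exact hyK hyG
    · have := h.eq_of_adj_out ha hG hGV haG hbV.1 hbG hab hx'.1 hx'G hax'
      grind
    · obtain ⟨w, hwG, hwF, hxw⟩ := h.exists_adj_diff hG hF hxG hx (by grind)
      rcases (hm w).1 ⟨hGV hwG, hwF⟩ with rfl | rfl
      exacts [haG hwG, hbx hxw.symm]
    · have h1 : G ⊆ F := fun w hw => by
        by_contra hwF
        rcases (hm w).1 ⟨hGV hw, hwF⟩ with rfl | rfl
        exacts [haG hw, hbG hw]
      rw [h.sys.eq_of_subset hG hF h1] at hx'G
      exact hx'G hx'F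
  have hbF : (nonNbrs Γ b V) ⊆ F := fun w hw => by
    rw [mem_nonNbrs] at hw
    by_contra hwF
    rcases (hm w).1 ⟨hw.1, hwF⟩ with rfl | rfl
    exacts [hw.2.2 hab.symm, hw.2.1 rfl]
  have h1 : (nonNbrs Γ b V \ nonNbrs Γ y F).card ≤ 1 := by
    rw [Finset.card_le_one]
    have h2 : ∀ x ∈ nonNbrs Γ b V \ nonNbrs Γ y F, x ∈ V ∧ x ∉ K ∧ Γ.Adj a x := by
      intro x hx
      rw [Finset.mem_sdiff] at hx
      have hxF := hbF hx.1
      rw [mem_nonNbrs, mem_nonNbrs] at hx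
      have hyx : Γ.Adj x y := by
        by_contra hc
        refine hx.2 ⟨hxF, ?_, fun h => hc h.symm⟩
        rintro rfl
        exact hx.1.2.2 hby
      exact ⟨hx.1.1, key x hxF hx.1.2.2 hyx, (hout x hxF).resolve_right hx.1.2.2⟩
    intro x hx z hz
    obtain ⟨h3, h4, h5⟩ := h2 x hx
    obtain ⟨h6, h7, h8⟩ := h2 z hz
    exact h.eq_of_adj_out ha hK hKV haK h3 h4 h5 h6 h7 h8
  have h2 := Finset.le_card_sdiff (nonNbrs Γ y F) (nonNbrs Γ b V)
  omega

theorem nonAdjCount_ne_ten (h : HasElevenNonEdges Γ face k V) (hF : face k F) (hFV : F ⊆ V)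
    (hM : V \ F = {a, b}) (hab : Γ.Adj a b) (ha : (nonNbrs Γ a V).card = 3)
    (hb : (nonNbrs Γ b V).card = 3) : nonAdjCount Γ F F ≠ 10 := by
  intro h10
  have hm := mem_and_notMem_iff hM
  have hM' : V \ F = {b, a} := by rw [hM, Finset.pair_comm]
  have haV := (hm a).2 (Or.inl rfl)
  have hbV := (hm b).2 (Or.inr rfl)
  have hcov : ∀ x ∈ F, Γ.Adj a x → ¬ Γ.Adj b x := by
    intro x hx hax hbx
    obtain ⟨G, hGV, hG, haG, hxG⟩ := h.exists_facet haV.1 (hFV hx) (by grind)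
    have hbG : b ∈ G := by
      by_contra hbG
      have := h.eq_of_adj_out ha hG hGV haG (hFV hx) hxG hax hbV.1 hbG hab
      grind
    obtain ⟨y, hy, hyx⟩ := Finset.exists_mem_ne (h.two_le hG hGV) x
    rw [Finset.mem_sdiff] at hy
    have hyF : y ∈ F := by
      by_contra hc
      rcases (hm y).1 ⟨hy.1, hc⟩ with rfl | rfl
      exacts [hy.2 haG, hy.2 hbG]
    rcases h.adj_or_adj hF hFV hM hyF with hy' | hy'
    · exact hyx (h.eq_of_adj_out ha hG hGV haG hy.1 hy.2 hy' (hFV hx) hxG hax)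
    · exact hyx (h.eq_of_adj_out hb hG hGV hbG hy.1 hy.2 hy' (hFV hx) hxG hbx)
  have h2 : ∀ y ∈ F, 2 ≤ (nonNbrs Γ y F).card := by
    intro y hy
    by_cases hay : Γ.Adj a y
    · exact h.two_le_card_nonNbrs hF hFV hM' hab.symm hb ha hy (hcov y hy hay)
    · exact h.two_le_card_nonNbrs hF hFV hM hab ha hb hy hay
  have h3 := mul_le_nonAdjCount h2
  have h4 := h.card_sdiff hFV
  have h5 := h.three_le
  rw [hM, Finset.card_pair hab.ne] at h4
  omega

/-- If `F` misses exactly `a` and `b`, which are not adjacent, and `x` is adjacent to both, then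
the vertices of `F` other than `x` adjacent to `a` form a clique. -/
theorem adj_of_not_adj (h : HasElevenNonEdges Γ face k V) (hF : face k F) (hFV : F ⊆ V)
    (hM : V \ F = {a, b}) (hne : a ≠ b) (hab : ¬ Γ.Adj a b) (ha : (nonNbrs Γ a V).card = 3)
    (hb : (nonNbrs Γ b V).card = 3) (hx : x ∈ F) (hax : Γ.Adj a x) (hbx : Γ.Adj b x)
    (hu : u ∈ F) (hau : Γ.Adj a u) (hux : u ≠ x) (hv : v ∈ F) (hav : Γ.Adj a v) (hvx : v ≠ x)
    (huv : u ≠ v) : Γ.Adj u v := by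
  have hm := mem_and_notMem_iff hM
  have haV := (hm a).2 (Or.inl rfl)
  have hbV := (hm b).2 (Or.inr rfl)
  obtain ⟨G, hGV, hG, haG, hxG⟩ := h.exists_facet haV.1 (hFV hx) (by grind)
  have hbG : b ∉ G := by
    intro hbG
    obtain ⟨y, hy, hyx⟩ := Finset.exists_mem_ne (h.two_le hG hGV) x
    rw [Finset.mem_sdiff] at hy
    have hyF : y ∈ F := by
      by_contra hc
      rcases (hm y).1 ⟨hy.1, hc⟩ with rfl | rfl
      exacts [hy.2 haG, hy.2 hbG]
    rcases h.adj_or_adj hF hFV hM hyF with hy' | hy'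
    · exact hyx (h.eq_of_adj_out ha hG hGV haG hy.1 hy.2 hy' (hFV hx) hxG hax)
    · exact hyx (h.eq_of_adj_out hb hG hGV hbG hy.1 hy.2 hy' (hFV hx) hxG hbx)
  have hsub : insert x (nonNbrs Γ a V) ⊆ V \ G := by
    intro y hy
    rw [Finset.mem_insert, mem_nonNbrs] at hy
    rw [Finset.mem_sdiff]
    rcases hy with rfl | hy
    · exact ⟨hFV hx, hxG⟩
    refine ⟨hy.1, fun hyG => ?_⟩
    have hyF : y ∈ F := by
      by_contra hc
      rcases (hm y).1 ⟨hy.1, hc⟩ with rfl | rfl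
      exacts [hy.2.1 rfl, hbG hyG]
    obtain ⟨w, hwG, hwF, hyw⟩ := h.exists_adj_diff hG hF hyG hyF (by grind)
    rcases (hm w).1 ⟨hGV hwG, hwF⟩ with rfl | rfl
    exacts [hy.2.2 hyw.symm, hbG hwG]
  have h1 := Finset.card_le_card hsub
  rw [Finset.card_insert_of_notMem (by rw [mem_nonNbrs]; tauto), ha] at h1
  have h2 := h.card_sdiff hGV
  have hmem : ∀ w ∈ F, Γ.Adj a w → w ≠ x → w ∈ G := fun w hw haw hwx => by
    by_contra hwG
    exact hwx (h.eq_of_adj_out ha hG hGV haG (hFV hw) hwG haw (hFV hx) hxG hax)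
  have h3 := h.sys.card_nonNbrs hG (hmem u hu hau hux)
  have h4 : (nonNbrs Γ u G).card = 0 := by omega
  rw [Finset.card_eq_zero, Finset.eq_empty_iff_forall_notMem] at h4
  by_contra hc
  exact h4 v (mem_nonNbrs.2 ⟨hmem v hv hav hvx, huv, hc⟩)

theorem nonAdjCount_ne_twelve_of_not_adj (h : HasElevenNonEdges Γ face k V) (hF : face k F)
    (hFV : F ⊆ V) (hM : V \ F = {a, b}) (hne : a ≠ b) (hab : ¬ Γ.Adj a b)
    (ha : (nonNbrs Γ a V).card = 3) (hb : (nonNbrs Γ b V).card = 3) :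
    nonAdjCount Γ F F ≠ 12 := by
  intro h12
  have hm := mem_and_notMem_iff hM
  have hM' : V \ F = {b, a} := by rw [hM, Finset.pair_comm]
  have haV := (hm a).2 (Or.inl rfl)
  have hbV := (hm b).2 (Or.inr rfl)
  have hA : (nonNbrs Γ a F).card = 2 := by
    have : nonNbrs Γ a V = insert b (nonNbrs Γ a F) := by
      ext w; simp only [Finset.mem_insert, mem_nonNbrs]; grind
    rw [this, Finset.card_insert_of_notMem (by rw [mem_nonNbrs]; tauto)] at ha
    omega
  have hB : (nonNbrs Γ b F).card = 2 := by
    have : nonNbrs Γ b V = insert a (nonNbrs Γ b F) := by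
      ext w; simp only [Finset.mem_insert, mem_nonNbrs]; grind [Γ.adj_comm a b]
    rw [this, Finset.card_insert_of_notMem (by rw [mem_nonNbrs]; tauto)] at hb
    omega
  have hout : ∀ x ∈ F, Γ.Adj a x ∨ Γ.Adj b x := fun x => h.adj_or_adj hF hFV hM
  have hcl : ∀ x ∈ F, Γ.Adj a x → Γ.Adj b x → ∀ u ∈ F, ∀ v ∈ F, u ≠ x → v ≠ x → u ≠ v →
      (Γ.Adj a u ∧ Γ.Adj a v) ∨ (Γ.Adj b u ∧ Γ.Adj b v) → Γ.Adj u v := by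
    intro x hx hax hbx u hu v hv hux hvx huv huv'
    rcases huv' with huv' | huv'
    · exact h.adj_of_not_adj hF hFV hM hne hab ha hb hx hax hbx hu huv'.1 hux hv huv'.2 hvx huv
    · exact h.adj_of_not_adj hF hFV hM' hne.symm (fun h => hab h.symm) hb ha hx hbx hax hu huv'.1
        hux hv huv'.2 hvx huv
  set D := nonNbrs Γ a F ∪ nonNbrs Γ b F with hD
  have hDF : D ⊆ F := Finset.union_subset nonNbrs_subset nonNbrs_subset
  have hDcard : D.card = 4 := by
    rw [hD, Finset.card_union_of_disjoint, hA, hB]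
    rw [Finset.disjoint_left]
    intro x h1 h2
    rw [mem_nonNbrs] at h1 h2
    exact (hout x h1.1).elim h1.2.2 h2.2.2
  have hC : ∀ x, x ∈ F \ D ↔ x ∈ F ∧ Γ.Adj a x ∧ Γ.Adj b x := by
    intro x
    simp only [hD, Finset.mem_sdiff, Finset.mem_union, mem_nonNbrs]
    grind
  have hCcard : 2 ≤ (F \ D).card := by
    have h1 := Finset.card_sdiff_add_card_eq_card hDF
    have h2 := h.card_sdiff hFV
    have h3 := h.three_le
    rw [hM, Finset.card_pair hne] at h2
    omega
  have h1 : ∀ u ∈ D, (nonNbrs Γ u F).card ≤ 2 := by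
    intro u hu
    have hu' := hu
    rw [hD, Finset.mem_union, mem_nonNbrs, mem_nonNbrs] at hu'
    have key : ∀ w ∈ nonNbrs Γ u F,
        ¬ ((Γ.Adj a u ∧ Γ.Adj a w) ∨ (Γ.Adj b u ∧ Γ.Adj b w)) := by
      intro w hw hc
      rw [mem_nonNbrs] at hw
      obtain ⟨x, hx, hxw⟩ := Finset.exists_mem_ne hCcard w
      have hx' := (hC x).1 hx
      refine hw.2.2 (hcl x hx'.1 hx'.2.1 hx'.2.2 u (hDF hu) w hw.1 ?_ hxw.symm hw.2.1 hc)
      rintro rfl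
      exact (Finset.mem_sdiff.1 hx).2 hu
    rcases hu' with hu' | hu'
    · rw [← hB]
      refine Finset.card_le_card fun w hw => ?_
      have := key w hw
      rw [mem_nonNbrs] at hw ⊢
      have := hout u hu'.1
      grind
    · rw [← hA]
      refine Finset.card_le_card fun w hw => ?_
      have := key w hw
      rw [mem_nonNbrs] at hw ⊢
      have := hout u hu'.1
      grind
  have key : ∀ u ∈ F \ D, ∀ w ∈ nonNbrs Γ u F, ∀ x ∈ F \ D, x = u ∨ x = w := by
    intro u hu w hw x hx
    by_contra! hc
    rw [mem_nonNbrs] at hw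
    rw [hC] at hu hx
    refine hw.2.2 (hcl x hx.1 hx.2.1 hx.2.2 u hu.1 w hw.1 hc.1.symm hc.2.symm hw.2.1 ?_)
    have := hout w hw.1
    tauto
  have h2 : nonAdjCount Γ (F \ D) F ≤ 2 := by
    rcases hCcard.eq_or_lt with h2 | h2
    · have h3 : ∀ u ∈ F \ D, (nonNbrs Γ u F).card ≤ 1 := by
        intro u hu
        rw [Finset.card_le_one]
        intro w hw z hz
        obtain ⟨x, hx, hxu⟩ := Finset.exists_mem_ne (show 1 < (F \ D).card by omega) u
        have h4 := (key u hu w hw x hx).resolve_left hxu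
        have h5 := (key u hu z hz x hx).resolve_left hxu
        rw [← h4, ← h5]
      have := nonAdjCount_le_mul h3
      omega
    · have h3 : ∀ u ∈ F \ D, (nonNbrs Γ u F).card ≤ 0 := by
        intro u hu
        rw [Nat.le_zero, Finset.card_eq_zero, Finset.eq_empty_iff_forall_notMem]
        intro w hw
        have h4 : F \ D ⊆ {u, w} := fun x hx => by
          simpa using key u hu w hw x hx
        have := (Finset.card_le_card h4).trans Finset.card_le_two
        omega
      have := nonAdjCount_le_mul h3
      omega
  have h3 := nonAdjCount_add_sdiff_left (Γ := Γ) hDF F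
  have h4 := nonAdjCount_le_mul h1
  omega

theorem nonAdjCount_ne_twelve_of_adj (h : HasElevenNonEdges Γ face k V) (hF : face k F)
    (hFV : F ⊆ V) (hM : V \ F = {a, b}) (hab : Γ.Adj a b)
    (ha : (nonNbrs Γ a V).card = 3) (hb : (nonNbrs Γ b V).card = 2) :
    nonAdjCount Γ F F ≠ 12 := by
  intro h12
  have hm := mem_and_notMem_iff hM
  have hM' : V \ F = {b, a} := by rw [hM, Finset.pair_comm]
  have haV := (hm a).2 (Or.inl rfl)
  have hbV := (hm b).2 (Or.inr rfl)
  have hk := h.three_le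
  have hFcard : F.card = k + 3 := by
    have := h.card_sdiff hFV
    rw [hM, Finset.card_pair hab.ne] at this
    omega
  have hout : ∀ x ∈ F, Γ.Adj a x ∨ Γ.Adj b x := fun x => h.adj_or_adj hF hFV hM
  rw [nonNbrs_eq_of_adj hFV hM' hab.symm] at hb
  have ha' := ha
  rw [nonNbrs_eq_of_adj hFV hM hab] at ha'
  set A := nonNbrs Γ a F with hA
  set B := nonNbrs Γ b F with hB
  have hAF : A ⊆ F := nonNbrs_subset
  have hBF : B ⊆ F := nonNbrs_subset
  have hmA : ∀ x ∈ F, x ∈ A ↔ ¬ Γ.Adj a x := fun x hx => by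
    rw [hA, mem_nonNbrs]; grind
  have hmB : ∀ x ∈ F, x ∈ B ↔ ¬ Γ.Adj b x := fun x hx => by
    rw [hB, mem_nonNbrs]; grind
  set X := F \ A with hX
  have hXF : X ⊆ F := Finset.sdiff_subset
  have hXA : F \ X = A := Finset.sdiff_sdiff_eq_self hAF
  have hmX : ∀ x ∈ X, x ∈ F ∧ x ∉ A ∧ Γ.Adj a x := fun x hx => by
    rw [hX, Finset.mem_sdiff] at hx
    exact ⟨hx.1, hx.2, by simpa [hmA x hx.1] using hx.2⟩
  have hXcard : X.card = k := by
    have := Finset.card_sdiff_add_card_eq_card hAF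
    rw [← hX] at this
    omega
  -- the neighbours of `a` in `F` form a clique
  have hclique : nonAdjCount Γ X X = 0 := by
    obtain ⟨G, hGV, hG, haG, hbG⟩ := h.exists_facet haV.1 hbV.1 hab.ne
    have h1 : G ⊆ insert a X := by
      intro y hyG
      by_contra hy
      rw [Finset.mem_insert, hX, Finset.mem_sdiff, not_or] at hy
      have hyF : y ∈ F := by
        by_contra hc
        rcases (hm y).1 ⟨hGV hyG, hc⟩ with rfl | rfl
        exacts [hy.1 rfl, hbG hyG]
      have hyA : y ∈ A := by tauto
      obtain ⟨w, hwG, hwF, hyw⟩ := h.exists_adj_diff hG hF hyG hyF (by grind)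
      rcases (hm w).1 ⟨hGV hwG, hwF⟩ with rfl | rfl
      exacts [(hmA y hyF).1 hyA hyw.symm, hbG hwG]
    have h2 : (insert a X).card = k + 1 := by
      rw [Finset.card_insert_of_notMem (fun h => haV.2 (hXF h)), hXcard]
    have h3 := h.sys.card_nonNbrs hG haG
    rw [Finset.eq_of_subset_of_card_le h1 (by omega)] at hG
    have h4 : ∀ v ∈ X, (nonNbrs Γ v X).card ≤ 0 := fun v hv => by
      have h5 := h.sys.card_nonNbrs hG (Finset.mem_insert_of_mem hv)
      have h6 := card_nonNbrs_mono (Γ := Γ) (v := v) (Finset.subset_insert a X)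
      omega
    have := nonAdjCount_le_mul h4
    omega
  have hnd : ∀ u ∈ A, (nonNbrs Γ u F).card ≤ 2 := fun u hu => by
    have := h.sys.card_nonNbrs hF (hAF hu)
    omega
  have h1 := nonAdjCount_self_add (Γ := Γ) hXF
  rw [hXA] at h1
  have h2 := nonAdjCount_le_mul hnd
  have hAA : nonAdjCount Γ A A = 0 := by omega
  have hAF' : nonAdjCount Γ A F = 6 := by omega
  have hadjA := nonAdjCount_eq_zero_iff.1 hAA
  have hsimple : ∀ u ∈ A, (nonNbrs Γ u V).card = 3 := by
    intro u hu
    have h3 := Finset.add_sum_erase A (fun v => (nonNbrs Γ v F).card) hu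
    have h4 := nonAdjCount_le_mul fun v hv => hnd v (Finset.mem_of_mem_erase (a := u) hv)
    rw [Finset.card_erase_of_mem hu, ha'] at h4
    simp only [nonAdjCount] at hAF' h4
    have h5 : insert a (nonNbrs Γ u F) ⊆ nonNbrs Γ u V := by
      rw [Finset.insert_subset_iff]
      refine ⟨mem_nonNbrs.2 ⟨haV.1, ?_, fun h => (hmA u (hAF hu)).1 hu h.symm⟩,
        nonNbrs_mono hFV⟩
      rintro rfl
      exact haV.2 (hAF hu)
    have h6 := Finset.card_le_card h5
    rw [Finset.card_insert_of_notMem (fun h => haV.2 (nonNbrs_subset h))] at h6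
    have h7 := h.card_nonNbrs_le (hFV (hAF hu))
    omega
  have hx2 : ∀ x ∈ X, 2 ≤ (nonNbrs Γ x A).card := by
    intro x hx
    obtain ⟨hxF, hxA, hax⟩ := hmX x hx
    obtain ⟨G, hGV, hG, haG, hxG⟩ := h.exists_facet haV.1 (hFV hxF) (by grind)
    have hin : ∀ w ∈ V, Γ.Adj a w → w ≠ x → w ∈ G := fun w hw haw hwx => by
      by_contra hwG
      exact hwx (h.eq_of_adj_out ha hG hGV haG hw hwG haw (hFV hxF) hxG hax)
    have hbG : b ∈ G := hin b hbV.1 hab (by grind)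
    obtain ⟨u, huA, huG⟩ : ∃ u ∈ A, u ∈ G := by
      by_contra! hc
      have h3 : insert x A ⊆ V \ G := by
        intro y hy
        rw [Finset.mem_sdiff]
        rcases Finset.mem_insert.1 hy with rfl | hy
        exacts [⟨hFV hxF, hxG⟩, ⟨hFV (hAF hy), hc y hy⟩]
      have h4 := Finset.card_le_card h3
      rw [Finset.card_insert_of_notMem hxA, ha'] at h4
      have h5 := h.card_sdiff hGV
      have h6 := h.sys.card_nonNbrs hG hbG
      obtain ⟨z, hz, hzx⟩ := Finset.exists_mem_ne (show 1 < B.card by omega) x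
      have hbz := (hmB z (hBF hz)).1 hz
      have haz := (hout z (hBF hz)).resolve_right hbz
      have h7 : z ∈ nonNbrs Γ b G :=
        mem_nonNbrs.2 ⟨hin z (hFV (hBF hz)) haz hzx, fun h => hbV.2 (h ▸ hBF hz), hbz⟩
      have := Finset.card_pos.2 ⟨z, h7⟩
      omega
    obtain ⟨u₀, hu₀, hu₀x⟩ := Finset.exists_mem_ne (h.two_le hG hGV) x
    rw [Finset.mem_sdiff] at hu₀
    have hau₀ : ¬ Γ.Adj a u₀ := fun hc => hu₀.2 (hin u₀ hu₀.1 hc hu₀x)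
    have hu₀F : u₀ ∈ F := by
      by_contra hc
      rcases (hm u₀).1 ⟨hu₀.1, hc⟩ with rfl | rfl
      exacts [hu₀.2 haG, hu₀.2 hbG]
    have hu₀A : u₀ ∈ A := (hmA u₀ hu₀F).2 hau₀
    have huniq : ∀ w ∈ V, w ∉ G → Γ.Adj u w → w = u₀ := fun w hw hwG huw =>
      h.eq_of_adj_out (hsimple u huA) hG hGV huG hw hwG huw hu₀.1 hu₀.2
        (hadjA u huA u₀ hu₀A (by grind))
    have h3 : A.erase u₀ ⊆ nonNbrs Γ x A := by
      intro y hy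
      rw [Finset.mem_erase] at hy
      have hyG : y ∈ G := by
        by_contra hyG
        exact hy.1 (huniq y (hFV (hAF hy.2)) hyG (hadjA u huA y hy.2 (by grind)))
      refine mem_nonNbrs.2 ⟨hy.2, by grind, fun hxy => hu₀x ?_⟩
      exact h.eq_of_adj_out (hsimple y hy.2) hG hGV hyG hu₀.1 hu₀.2
        (hadjA y hy.2 u₀ hu₀A hy.1) (hFV hxF) hxG hxy.symm
    have h4 := Finset.card_le_card h3
    rwa [Finset.card_erase_of_mem hu₀A, ha'] at h4
  have h3 := mul_le_nonAdjCount hx2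
  rw [nonAdjCount_comm] at h3
  have h4 := nonAdjCount_mono_right (Γ := Γ) (S := A) hXF
  have hk3 : k = 3 := by omega
  obtain ⟨x, hx, hxB⟩ : ∃ x ∈ X, x ∉ B := by
    by_contra! hc
    have := Finset.card_le_card (show X ⊆ B from hc)
    omega
  obtain ⟨hxF, hxA, hax⟩ := hmX x hx
  have hbx : Γ.Adj b x := by simpa [hmB x hxF] using hxB
  have hBX : B ⊆ X.erase x := fun y hy => by
    rw [Finset.mem_erase, hX, Finset.mem_sdiff, hmA y (hBF hy)]
    have := hout y (hBF hy)
    have := (hmB y (hBF hy)).1 hy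
    grind
  have hBX' : B = X.erase x :=
    Finset.eq_of_subset_of_card_le hBX (by rw [Finset.card_erase_of_mem hx]; omega)
  obtain ⟨K, hKV, hK, hbK, hxK, haK⟩ := h.sys.exists_facet h.face_top hbV.1 (hFV hxF) haV.1 hbx
    hab.ne (by grind)
  have h5 : K \ nonNbrs Γ x K ⊆ {x, b} ∪ (A \ nonNbrs Γ x A) := by
    intro y hy
    rw [Finset.mem_sdiff, mem_nonNbrs] at hy
    by_contra hc
    simp only [Finset.mem_union, Finset.mem_insert, Finset.mem_singleton, Finset.mem_sdiff,
      mem_nonNbrs, not_or] at hc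
    have hyF : y ∈ F := by
      by_contra hyF
      rcases (hm y).1 ⟨hKV hy.1, hyF⟩ with rfl | rfl
      exacts [haK hy.1, hc.1.2 rfl]
    have hyA : y ∉ A := by tauto
    have hyB : y ∈ B := by
      rw [hBX', Finset.mem_erase, hX, Finset.mem_sdiff]
      exact ⟨hc.1.1, hyF, hyA⟩
    obtain ⟨w, hwK, hwF, hyw⟩ := h.exists_adj_diff hK hF hy.1 hyF (by grind)
    rcases (hm w).1 ⟨hKV hwK, hwF⟩ with rfl | rfl
    exacts [haK hwK, (hmB y hyF).1 hyB hyw.symm]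
  have h6 := (Finset.card_le_card h5).trans (Finset.card_union_le _ _)
  have h7 := Finset.card_sdiff_add_card_eq_card (nonNbrs_subset (Γ := Γ) (v := x) (S := K))
  have h8 := Finset.card_sdiff_add_card_eq_card (nonNbrs_subset (Γ := Γ) (v := x) (S := A))
  have h9 := hx2 x hx
  have h10 := h.sys.card_nonNbrs hK hxK
  have h11 := Finset.card_le_two (a := x) (b := b)
  omega

theorem card_sdiff_ne_two (h : HasElevenNonEdges Γ face k V) (hF : face k F) (hFV : F ⊆ V) :
    (V \ F).card ≠ 2 := by
  intro h2
  obtain ⟨a, b, hne, hM⟩ := Finset.card_eq_two.1 h2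
  have hm := mem_and_notMem_iff hM
  have hM' : V \ F = {b, a} := by rw [hM, Finset.pair_comm]
  have h3 := h.nonAdjCount_facet_le hF hFV 2 (by omega)
  have h4 := nonAdjCount_self_add (Γ := Γ) hFV
  have h5 := h.card_nonNbrs_le ((hm a).2 (Or.inl rfl)).1
  have h6 := h.card_nonNbrs_le ((hm b).2 (Or.inr rfl)).1
  have h7 : nonAdjCount Γ (V \ F) V = (nonNbrs Γ a V).card + (nonNbrs Γ b V).card := by
    rw [hM, nonAdjCount, Finset.sum_pair hne]
  have h8 : nonAdjCount Γ (V \ F) (V \ F) =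
      (nonNbrs Γ a {a, b}).card + (nonNbrs Γ b {a, b}).card := by
    rw [hM, nonAdjCount, Finset.sum_pair hne]
  rw [h.count] at h4
  by_cases hab : Γ.Adj a b
  · have h9 : nonNbrs Γ a {a, b} = ∅ := by
      ext w; rw [mem_nonNbrs]; grind
    have h10 : nonNbrs Γ b {a, b} = ∅ := by
      ext w; rw [mem_nonNbrs]; grind [Γ.adj_comm a b]
    rw [h9, h10, Finset.card_empty] at h8
    rcases h5.eq_or_lt with h5' | h5' <;> rcases h6.eq_or_lt with h6' | h6'
    · exact h.nonAdjCount_ne_ten hF hFV hM hab h5' h6' (by omega)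
    · exact h.nonAdjCount_ne_twelve_of_adj hF hFV hM hab h5' (by omega) (by omega)
    · exact h.nonAdjCount_ne_twelve_of_adj hF hFV hM' hab.symm h6' (by omega) (by omega)
    · omega
  · have h9 : nonNbrs Γ a {a, b} = {b} := by
      ext w; rw [mem_nonNbrs]; grind
    have h10 : nonNbrs Γ b {a, b} = {a} := by
      ext w; rw [mem_nonNbrs]; grind [Γ.adj_comm a b]
    rw [h9, h10, Finset.card_singleton, Finset.card_singleton] at h8
    exact h.nonAdjCount_ne_twelve_of_not_adj hF hFV hM hne hab (by omega) (by omega) (by omega)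

theorem three_le_card_sdiff (h : HasElevenNonEdges Γ face k V) (hF : face k F) (hFV : F ⊆ V) :
    3 ≤ (V \ F).card :=
  lt_of_le_of_ne (h.two_le hF hFV) (h.card_sdiff_ne_two hF hFV).symm

/-- Three pairwise adjacent simple vertices: two of them have at least two common nonneighbours. -/
theorem two_le_card_nonNbrs_inter (h : HasElevenNonEdges Γ face k V)
    (ha : (nonNbrs Γ a V).card = 3) (hc : (nonNbrs Γ c V).card = 3)
    (haV : a ∈ V) (hbV : b ∈ V) (hcV : c ∈ V)
    (hab : Γ.Adj a b) (hac : Γ.Adj a c) (hbc : Γ.Adj b c) :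
    2 ≤ (nonNbrs Γ a V ∩ nonNbrs Γ c V).card := by
  obtain ⟨G, hGV, hG, haG, hbG⟩ := h.exists_facet haV hbV hab.ne
  have hcG : c ∈ G := by
    by_contra hcG
    exact hbc.ne (h.eq_of_adj_out ha hG hGV haG hbV hbG hab hcV hcG hac)
  have h1 : V \ G ⊆ insert b (nonNbrs Γ a V ∩ nonNbrs Γ c V) := by
    intro y hy
    rw [Finset.mem_sdiff] at hy
    rw [Finset.mem_insert, Finset.mem_inter, mem_nonNbrs, mem_nonNbrs]
    by_cases hyb : y = b
    · exact Or.inl hyb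
    refine Or.inr ⟨⟨hy.1, by grind, fun h1 => hyb ?_⟩, ⟨hy.1, by grind, fun h1 => hyb ?_⟩⟩
    · exact h.eq_of_adj_out ha hG hGV haG hy.1 hy.2 h1 hbV hbG hab
    · exact h.eq_of_adj_out hc hG hGV hcG hy.1 hy.2 h1 hbV hbG hbc.symm
  have h2 := (Finset.card_le_card h1).trans (Finset.card_insert_le _ _)
  have h3 := h.three_le_card_sdiff hG hGV
  omega

theorem card_sdiff_ne_three (h : HasElevenNonEdges Γ face k V) (hF : face k F) (hFV : F ⊆ V) :
    (V \ F).card ≠ 3 := by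
  intro h3
  have h1 := h.nonAdjCount_facet_le hF hFV 1 (by omega)
  have h2 := nonAdjCount_self_add (Γ := Γ) hFV
  obtain ⟨a, b, c, hab, hac, hbc, hM⟩ := Finset.card_eq_three.1 h3
  have hm : ∀ w, w ∈ V ∧ w ∉ F ↔ w = a ∨ w = b ∨ w = c := fun w => by
    rw [← Finset.mem_sdiff, hM]; simp
  have haV := (hm a).2 (by simp)
  have hbV := (hm b).2 (by simp)
  have hcV := (hm c).2 (by simp)
  have h4 : nonAdjCount Γ (V \ F) V =
      (nonNbrs Γ a V).card + ((nonNbrs Γ b V).card + (nonNbrs Γ c V).card) := by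
    rw [hM, nonAdjCount, Finset.sum_insert (by simp [hab, hac]), Finset.sum_pair hbc]
  have ha := h.card_nonNbrs_le haV.1
  have hb := h.card_nonNbrs_le hbV.1
  have hc := h.card_nonNbrs_le hcV.1
  rw [h.count] at h2
  have h5 : nonAdjCount Γ (V \ F) (V \ F) = 0 := by omega
  rw [nonAdjCount_eq_zero_iff, hM] at h5
  have hab' := h5 a (by simp) b (by simp) hab
  have hac' := h5 a (by simp) c (by simp) hac
  have hbc' := h5 b (by simp) c (by simp) hbc
  have h6 := h.two_le_card_nonNbrs_inter (by omega) (by omega) haV.1 hbV.1 hcV.1 hab' hac' hbc'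
  have h7 := h.two_le_card_nonNbrs_inter (by omega) (by omega) haV.1 hcV.1 hbV.1 hac' hab' hbc'.symm
  have h8 := Finset.card_union_add_card_inter (nonNbrs Γ a V ∩ nonNbrs Γ c V)
    (nonNbrs Γ a V ∩ nonNbrs Γ b V)
  have h9 : (nonNbrs Γ a V ∩ nonNbrs Γ c V) ∪ (nonNbrs Γ a V ∩ nonNbrs Γ b V) ⊆ nonNbrs Γ a V :=
    Finset.union_subset Finset.inter_subset_left Finset.inter_subset_left
  have h10 := Finset.card_le_card h9
  obtain ⟨y, hy⟩ := Finset.card_pos.1 (show 0 < ((nonNbrs Γ a V ∩ nonNbrs Γ c V) ∩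
    (nonNbrs Γ a V ∩ nonNbrs Γ b V)).card by omega)
  simp only [Finset.mem_inter, mem_nonNbrs] at hy
  obtain ⟨⟨⟨hyV, hya, hay⟩, -, hyc, hcy⟩, -, -, hyb, hby⟩ := hy
  have hyF : y ∈ F := by
    by_contra hyF
    rcases (hm y).1 ⟨hyV, hyF⟩ with rfl | rfl | rfl <;> contradiction
  obtain ⟨w, hw, hwF, hyw⟩ := h.exists_adj_out hF hFV hyF
  rcases (hm w).1 ⟨hw, hwF⟩ with rfl | rfl | rfl
  exacts [hay hyw.symm, hby hyw.symm, hcy hyw.symm]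

theorem card_sdiff_eq_four (h : HasElevenNonEdges Γ face k V) (hF : face k F) (hFV : F ⊆ V) :
    (V \ F).card = 4 := by
  have h1 := h.three_le_card_sdiff hF hFV
  have h2 := h.card_sdiff_ne_three hF hFV
  have h3 := h.card_sdiff hFV
  obtain ⟨v, hv⟩ := h.sys.nonempty hF
  have h4 := h.sys.card_nonNbrs hF hv
  omega

/-- A facet through a simple vertex `a` misses one neighbour of `a` and all its nonneighbours. -/
theorem sdiff_eq_insert_nonNbrs (h : HasElevenNonEdges Γ face k V)
    (ha : (nonNbrs Γ a V).card = 3) (hG : face k G) (hGV : G ⊆ V) (haG : a ∈ G) (hx : x ∈ V)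
    (hxG : x ∉ G) (hax : Γ.Adj a x) : V \ G = insert x (nonNbrs Γ a V) := by
  refine Finset.eq_of_subset_of_card_le (fun y hy => ?_) ?_
  · rw [Finset.mem_sdiff] at hy
    rw [Finset.mem_insert, mem_nonNbrs]
    by_cases hay : Γ.Adj a y
    · exact Or.inl (h.eq_of_adj_out ha hG hGV haG hy.1 hy.2 hay hx hxG hax)
    · exact Or.inr ⟨hy.1, by grind, hay⟩
  · rw [h.card_sdiff_eq_four hG hGV, Finset.card_insert_of_notMem (by rw [mem_nonNbrs]; tauto), ha]

theorem false (h : HasElevenNonEdges Γ face k V) : False := by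
  have hk := h.three_le
  have hfacet : ∀ G ⊆ V, face k G → nonAdjCount Γ (V \ G) (V \ G) + 22 =
      2 * nonAdjCount Γ (V \ G) V := by
    intro G hGV hG
    have h1 := nonAdjCount_self_add (Γ := Γ) hGV
    have h2 := h.nonAdjCount_facet_le hG hGV 0 (by rw [h.card_sdiff_eq_four hG hGV])
    rw [h.count] at h1
    omega
  have hle : ∀ G ⊆ V, face k G → nonAdjCount Γ (V \ G) (V \ G) ≤ 2 := by
    intro G hGV hG
    have h1 := hfacet G hGV hG
    have h2 := nonAdjCount_le_mul (S := V \ G) fun v hv =>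
      h.card_nonNbrs_le (Finset.sdiff_subset hv)
    rw [h.card_sdiff_eq_four hG hGV] at h2
    omega
  obtain ⟨a, b, haV, hbV, ha, hb, hab⟩ : ∃ a b, a ∈ V ∧ b ∈ V ∧ (nonNbrs Γ a V).card = 3 ∧
      (nonNbrs Γ b V).card = 3 ∧ Γ.Adj a b := by
    obtain ⟨F, hFV, hF⟩ := h.sys.exists_facet_ssubset (by omega) h.face_top
    set Q := (V \ F).filter fun v => (nonNbrs Γ v V).card = 3 with hQ
    have hQM : Q ⊆ V \ F := Finset.filter_subset _ _
    have hmQ : ∀ v ∈ Q, v ∈ V ∧ (nonNbrs Γ v V).card = 3 := fun v hv =>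
      ⟨Finset.sdiff_subset (hQM hv), (Finset.mem_filter.1 hv).2⟩
    have h1 := hfacet F hFV.1 hF
    have h2 := hle F hFV.1 hF
    have h3 := nonAdjCount_add_sdiff_left (Γ := Γ) hQM V
    have h4 : nonAdjCount Γ Q V ≤ Q.card * 3 := nonAdjCount_le_mul fun v hv => (hmQ v hv).2.le
    have h5 : nonAdjCount Γ ((V \ F) \ Q) V ≤ ((V \ F) \ Q).card * 2 := by
      refine nonAdjCount_le_mul fun v hv => ?_
      rw [Finset.mem_sdiff, hQ, Finset.mem_filter] at hv
      have := h.card_nonNbrs_le (Finset.sdiff_subset hv.1)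
      have : (nonNbrs Γ v V).card ≠ 3 := by tauto
      omega
    have h6 := Finset.card_sdiff_add_card_eq_card hQM
    rw [h.card_sdiff_eq_four hF hFV.1] at h6
    by_contra hc
    have h7 : ∀ v ∈ Q, 2 ≤ (nonNbrs Γ v (V \ F)).card := by
      intro v hv
      have h8 : Q.erase v ⊆ nonNbrs Γ v (V \ F) := by
        intro w hw
        rw [Finset.mem_erase] at hw
        refine mem_nonNbrs.2 ⟨hQM hw.2, hw.1.symm, fun hvw => hc ?_⟩
        exact ⟨v, w, (hmQ v hv).1, (hmQ w hw.2).1, (hmQ v hv).2, (hmQ w hw.2).2, hvw⟩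
      have h9 := Finset.card_le_card h8
      rw [Finset.card_erase_of_mem hv] at h9
      omega
    have h8 := mul_le_nonAdjCount h7
    have h9 := nonAdjCount_add_sdiff_left (Γ := Γ) hQM (V \ F)
    omega
  -- facets through `a` missing two other neighbours of `a`
  have hfac : ∀ x ∈ V, Γ.Adj a x → x ≠ b → ∃ G ⊆ V, face k G ∧ a ∈ G ∧ b ∈ G ∧ x ∉ G ∧
      V \ G = insert x (nonNbrs Γ a V) := by
    intro x hx hax hxb
    obtain ⟨G, hGV, hG, haG, hbG, hxG⟩ := h.sys.exists_facet h.face_top haV hbV hx hab hax.ne' hxb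
    exact ⟨G, hGV, hG, haG, hbG, hxG, h.sdiff_eq_insert_nonNbrs ha hG hGV haG hx hxG hax⟩
  obtain ⟨x, hx, z, hz, hxz⟩ : ∃ x ∈ (V \ nonNbrs Γ a V) \ {a, b},
      ∃ z ∈ (V \ nonNbrs Γ a V) \ {a, b}, x ≠ z := by
    rw [← Finset.one_lt_card]
    have h1 := Finset.le_card_sdiff {a, b} (V \ nonNbrs Γ a V)
    have h2 := Finset.le_card_sdiff (nonNbrs Γ a V) V
    have h3 := Finset.card_le_two (a := a) (b := b)
    have h4 := h.card_top
    omega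
  simp only [Finset.mem_sdiff, mem_nonNbrs, Finset.mem_insert, Finset.mem_singleton,
    not_or] at hx hz
  have hax : Γ.Adj a x := by grind
  have haz : Γ.Adj a z := by grind
  obtain ⟨G, hGV, hG, haG, hbG, hxG, hG'⟩ := hfac x hx.1.1 hax hx.2.2
  obtain ⟨K, hKV, hK, haK, hbK, hzK, hK'⟩ := hfac z hz.1.1 haz hz.2.2
  have hsub : nonNbrs Γ a V ⊆ nonNbrs Γ b V := by
    intro y hy
    have hyG : y ∈ V \ G := by rw [hG']; exact Finset.mem_insert_of_mem hy
    have hyK : y ∈ V \ K := by rw [hK']; exact Finset.mem_insert_of_mem hy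
    rw [Finset.mem_sdiff] at hyG hyK
    refine mem_nonNbrs.2 ⟨hyG.1, by grind, fun hby => hxz ?_⟩
    rw [← h.facet_unique hb hG hGV hbG hK hKV hbK hyG.1 hyG.2 hyK.2 hby] at hzK
    exact h.eq_of_adj_out ha hG hGV haG hx.1.1 hxG hax hz.1.1 hzK haz
  obtain ⟨H, hHV, hH, haH, hbH⟩ := h.exists_facet haV hbV hab.ne
  have hH' := h.sdiff_eq_insert_nonNbrs ha hH hHV haH hbV hbH hab
  have h1 : nonNbrs Γ a V ⊆ nonNbrs Γ b (V \ H) := by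
    intro y hy
    have hy' := mem_nonNbrs.1 (hsub hy)
    exact mem_nonNbrs.2 ⟨by rw [hH']; exact Finset.mem_insert_of_mem hy, hy'.2⟩
  have h2 := Finset.card_le_card h1
  have h3 := hle H hHV hH
  have h4 := Finset.single_le_sum (f := fun v => (nonNbrs Γ v (V \ H)).card)
    (fun _ _ => Nat.zero_le _) (show b ∈ V \ H from Finset.mem_sdiff.2 ⟨hbV, hbH⟩)
  simp only [nonAdjCount] at h3
  omega

end HasElevenNonEdges

theorem FaceSystem.nonAdjCount_ne {α : Type*} {Γ : SimpleGraph α} {face : ℕ → Finset α → Prop}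
    (hS : FaceSystem Γ face) {k : ℕ} (hk : 3 ≤ k) : ∀ {V : Finset α}, face (k + 1) V →
    V.card = k + 5 → nonAdjCount Γ V V ≠ 22 := by
  classical
  induction k, hk using Nat.le_induction with
  | base =>
    intro V hV hc h22
    refine (HasElevenNonEdges.mk hS le_rfl hV hc h22 fun {G} hG hGV => ?_).false
    by_contra! hlt
    have h1 : G ≠ V := by
      rintro rfl
      exact absurd (hS.dim_unique hG hV) (by omega)
    have h2 : 0 < (V \ G).card := Finset.card_pos.2 (Finset.sdiff_nonempty.2 fun h =>
      h1 (hGV.antisymm h))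
    rw [hS.nonAdjCount_eq_of_card_sdiff_eq_one hG hV hGV (by omega)] at h22
    have h3 := Finset.card_sdiff_add_card_eq_card hGV
    have h4 : nonAdjCount Γ G G ≤ G.card * 3 := nonAdjCount_le_mul fun v hv => by
      have := hS.card_nonNbrs hG hv
      omega
    omega
  | succ k hk ih =>
    intro V hV hc h22
    refine (HasElevenNonEdges.mk hS (by omega) hV hc h22 fun {G} hG hGV => ?_).false
    by_contra! hlt
    have h1 : G ≠ V := by
      rintro rfl
      exact absurd (hS.dim_unique hG hV) (by omega)
    have h2 : 0 < (V \ G).card := Finset.card_pos.2 (Finset.sdiff_nonempty.2 fun h =>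
      h1 (hGV.antisymm h))
    rw [hS.nonAdjCount_eq_of_card_sdiff_eq_one hG hV hGV (by omega)] at h22
    have h3 := Finset.card_sdiff_add_card_eq_card hGV
    exact ih hG (by omega) h22

section
variable {E : Type*} [NormedAddCommGroup E] [NormedSpace ℝ E] {V : Finset E}

/-- The graph of the polytope with vertex set `V`. -/
def edgeGraph (V : Finset E) : SimpleGraph E where
  Adj := EdgeAdj V
  symm := ⟨fun v w h => ⟨h.1.symm, segment_symm ℝ v w ▸ h.2⟩⟩
  loopless := ⟨fun _ h => h.1 rfl⟩

theorem faceSystem_edgeGraph [FiniteDimensional ℝ E]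
    (hV : ∀ w ∈ V, w ∈ (convexHull ℝ (V : Set E)).extremePoints ℝ) :
    FaceSystem (edgeGraph V) fun d F => IsFaceSet V d F ∧ F.Nonempty where
  nonempty h := h.2
  dim_unique h h' := h.1.2.2.symm.trans h'.1.2.2
  card_nonNbrs {d F v} hF hv := by
    classical
    have h1 := hF.1.le_degree hV hv
    have h2 := card_filter_adj_add (Γ := edgeGraph V) hv
    have h3 : F.filter (EdgeAdj V v) = F.filter ((edgeGraph V).Adj v) :=
      Finset.filter_congr fun _ _ => Iff.rfl
    rw [h3] at h1
    omega
  leave hG hF hvG hvF hGF := hG.1.exists_adj_notMem hV hF.1 hvG hvF hGF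
  eq_of_subset hF hG h := hF.1.eq_of_subset hV hG.1 hF.2 h
  exists_facet hG hv hw hu hvw huv huw := by
    obtain ⟨F, hFG, hF, hvF, hwF, huF⟩ := hG.1.exists_facet hV hv hw hu hvw huv huw
    exact ⟨F, hFG, ⟨hF, _, hvF⟩, hvF, hwF, huF⟩

theorem vectorSpan_convexHull (s : Set E) : vectorSpan ℝ (convexHull ℝ s) = vectorSpan ℝ s := by
  rw [← direction_affineSpan, affineSpan_convexHull, direction_affineSpan]

theorem EdgeAdj.isFaceSet_pair [DecidableEq E] {v w : E} (hv : v ∈ V) (hw : w ∈ V)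
    (h : EdgeAdj V v w) : IsFaceSet V 1 {v, w} := by
  refine ⟨by simp [Finset.insert_subset_iff, hv, hw], ?_, ?_⟩
  · rw [Finset.coe_pair, convexHull_pair]
    exact h.2
  · rw [Finset.coe_pair, vectorSpan_pair, vsub_eq_sub,
      finrank_span_singleton (sub_ne_zero.2 h.1)]

theorem eq_or_eq_of_segment_eq
    (hV : ∀ w ∈ V, w ∈ (convexHull ℝ (V : Set E)).extremePoints ℝ) {v w v' w' : E}
    (hv : v ∈ V) (hw : w ∈ V) (hv' : v' ∈ V) (hw' : w' ∈ V) (h' : v' ≠ w')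
    (h : segment ℝ v' w' = segment ℝ v w) : v' = v ∧ w' = w ∨ v' = w ∧ w' = v := by
  have key : ∀ u ∈ V, u ∈ segment ℝ v w → u = v ∨ u = w := by
    intro u hu huvw
    have := (mem_extremePoints_iff_forall_segment.1 (hV u hu)).2 v
      (subset_convexHull ℝ _ hv) w (subset_convexHull ℝ _ hw) huvw
    tauto
  have h1 := key v' hv' (h ▸ left_mem_segment ℝ v' w')
  have h2 := key w' hw' (h ▸ right_mem_segment ℝ v' w')
  grind

theorem exists_edgeAdj_of_isExtreme [FiniteDimensional ℝ E]
    (hV : ∀ w ∈ V, w ∈ (convexHull ℝ (V : Set E)).extremePoints ℝ) {e : Set E}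
    (he : IsExtreme ℝ (convexHull ℝ (V : Set E)) e) (hconv : Convex ℝ e)
    (hdim : Module.finrank ℝ (vectorSpan ℝ e) = 1) :
    ∃ v ∈ V, ∃ w ∈ V, EdgeAdj V v w ∧ e = segment ℝ v w := by
  classical
  have h1 := he.eq_convexHull_filter hconv
  set F := V.filter (· ∈ e) with hF
  have hface : IsFaceSet V 1 F := by
    refine ⟨Finset.filter_subset _ _, h1 ▸ he, ?_⟩
    rw [← vectorSpan_convexHull, ← h1, hdim]
  obtain ⟨v, hv⟩ : F.Nonempty := by
    rw [Finset.nonempty_iff_ne_empty]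
    intro h
    have h2 := hface.2.2
    rw [h, Finset.coe_empty, vectorSpan_empty, finrank_bot] at h2
    omega
  obtain ⟨w, hw⟩ := Finset.card_pos.1 (hface.le_degree hV hv)
  rw [Finset.mem_filter] at hw
  have h2 := (hw.2.isFaceSet_pair (hface.1 hv) (hface.1 hw.1)).eq_of_subset hV hface
    ⟨v, by simp⟩ (by simp [Finset.insert_subset_iff, hv, hw.1])
  refine ⟨v, hface.1 hv, w, hface.1 hw.1, hw.2, ?_⟩
  rw [h1, ← h2, Finset.coe_pair, convexHull_pair]

end

theorem two_mul_f₁_add {n : ℕ} {V : Finset (Fin n → ℝ)}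
    (hV : ∀ w ∈ V, w ∈ (convexHull ℝ (V : Set (Fin n → ℝ))).extremePoints ℝ) :
    2 * f₁ (convexHull ℝ (V : Set (Fin n → ℝ))) + nonAdjCount (edgeGraph V) V V + V.card =
      V.card * V.card := by
  classical
  set D := (V ×ˢ V).filter fun p => EdgeAdj V p.1 p.2 with hD
  have hmD : ∀ p, p ∈ D ↔ (p.1 ∈ V ∧ p.2 ∈ V) ∧ EdgeAdj V p.1 p.2 := fun p => by
    rw [hD, Finset.mem_filter, Finset.mem_product]
  have h1 : {e | IsEdge (convexHull ℝ (V : Set (Fin n → ℝ))) e} =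
      (D.image fun p => segment ℝ p.1 p.2 : Finset (Set (Fin n → ℝ))) := by
    ext e
    simp only [mem_ofPred_eq, Finset.coe_image, mem_image, Finset.mem_coe, hmD]
    constructor
    · rintro ⟨he, hconv, hdim⟩
      obtain ⟨v, hv, w, hw, hvw, rfl⟩ := exists_edgeAdj_of_isExtreme hV he hconv hdim
      exact ⟨(v, w), ⟨⟨hv, hw⟩, hvw⟩, rfl⟩
    · rintro ⟨⟨v, w⟩, ⟨⟨hv, hw⟩, hvw⟩, rfl⟩
      refine ⟨hvw.2, convex_segment _ _, ?_⟩
      have := (hvw.isFaceSet_pair hv hw).2.2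
      rwa [← vectorSpan_convexHull, Finset.coe_pair, convexHull_pair] at this
  have h2 : D.card = f₁ (convexHull ℝ (V : Set (Fin n → ℝ))) * 2 := by
    rw [f₁, h1, Set.ncard_coe_finset, ← smul_eq_mul, ← Finset.sum_const,
      Finset.card_eq_sum_card_image fun p : (Fin n → ℝ) × (Fin n → ℝ) => segment ℝ p.1 p.2]
    refine Finset.sum_congr rfl fun e he => ?_
    obtain ⟨⟨v, w⟩, hvw, rfl⟩ := Finset.mem_image.1 he
    have hvw' := (hmD _).1 hvw
    have hpair : (D.filter fun p => segment ℝ p.1 p.2 = segment ℝ v w) = {(v, w), (w, v)} := by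
      ext ⟨x, y⟩
      simp only [Finset.mem_filter, hmD, Finset.mem_insert, Finset.mem_singleton, Prod.mk.injEq]
      constructor
      · rintro ⟨⟨⟨hx, hy⟩, hxy⟩, h⟩
        exact eq_or_eq_of_segment_eq hV hvw'.1.1 hvw'.1.2 hx hy hxy.1 h
      · rintro (⟨rfl, rfl⟩ | ⟨rfl, rfl⟩)
        · exact ⟨hvw', rfl⟩
        · exact ⟨⟨hvw'.1.symm, (edgeGraph V).adj_symm hvw'.2⟩, segment_symm ℝ _ _⟩
    rw [hpair, Finset.card_pair fun h => hvw'.2.1 (Prod.ext_iff.1 h).1]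
  have h3 : D.card = ∑ v ∈ V, (V.filter ((edgeGraph V).Adj v)).card := by
    rw [hD, Finset.card_filter, Finset.sum_product]
    refine Finset.sum_congr rfl fun v _ => ?_
    rw [← Finset.card_filter]
    exact congrArg _ (Finset.filter_congr fun _ _ => Iff.rfl)
  have h4 : ∑ v ∈ V, ((V.filter ((edgeGraph V).Adj v)).card +
      (nonNbrs (edgeGraph V) v V).card + 1) = V.card * V.card := by
    rw [Finset.sum_congr rfl fun v hv => card_filter_adj_add (Γ := edgeGraph V) hv]
    simp
  rw [Finset.sum_add_distrib, Finset.sum_add_distrib, ← h3, Finset.sum_const] at h4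
  simp only [nonAdjCount]
  simp at h4
  omega

/-- A polytope is the convex hull of the finite set of its vertices. -/
theorem IsPolytope.exists_vertices {n : ℕ} {P : Set (Fin n → ℝ)} (hP : IsPolytope P) :
    ∃ V : Finset (Fin n → ℝ), P = convexHull ℝ (V : Set (Fin n → ℝ)) ∧
      (V : Set (Fin n → ℝ)) = P.extremePoints ℝ := by
  obtain ⟨S, rfl⟩ := hP
  have hfin : ((convexHull ℝ (S : Set (Fin n → ℝ))).extremePoints ℝ).Finite :=
    S.finite_toSet.subset extremePoints_convexHull_subset
  refine ⟨hfin.toFinset, ?_, hfin.coe_toFinset⟩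
  rw [hfin.coe_toFinset, ← (Set.Finite.isClosed_convexHull ℝ hfin).closure_eq,
    closure_convexHull_extremePoints (Set.Finite.isCompact_convexHull ℝ S.finite_toSet)
      (convex_convexHull ℝ _)]

/-- For a `d`-polytope `P`: if `f₀ ≤ 2d` then `f₁ ≥ φ(f₀, d)`, and if `d ≥ 4` then
`(f₀, f₁) ≠ (d + 4, φ(d + 4, d) + 1)`. -/
theorem stmt19 (d n : ℕ) (P : Set (Fin n → ℝ)) (hP : IsDPolytope d P) :
    (f₀ P ≤ 2 * d → (f₁ P : ℚ) ≥ phi (f₀ P) d) ∧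
    (4 ≤ d → ¬((f₀ P : ℚ) = (d : ℚ) + 4 ∧ (f₁ P : ℚ) = phi ((d : ℚ) + 4) d + 1)) := by
  obtain ⟨hpoly, hdim⟩ := hP
  obtain ⟨V, hPV, hVP⟩ := hpoly.exists_vertices
  have hV : ∀ w ∈ V, w ∈ (convexHull ℝ (V : Set (Fin n → ℝ))).extremePoints ℝ := fun w hw => by
    rwa [← hPV, ← hVP]
  have hf₀ : f₀ P = V.card := by rw [f₀, ← hVP, Set.ncard_coe_finset]
  have hf₁ := two_mul_f₁_add hV
  rw [← hPV] at hf₁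
  rw [adim, hPV, vectorSpan_convexHull] at hdim
  have hface : IsFaceSet V d V := ⟨subset_rfl, IsExtreme.rfl, hdim⟩
  have hS := faceSystem_edgeGraph hV
  rw [hf₀]
  simp only [phi]
  constructor
  · intro hle
    obtain rfl | hne := V.eq_empty_or_nonempty
    · rw [Finset.coe_empty, vectorSpan_empty, finrank_bot] at hdim
      subst hdim
      simp
    obtain ⟨v, hv⟩ := hne
    have h1 := hS.card_nonNbrs ⟨hface, v, hv⟩ hv
    obtain ⟨t, ht⟩ : ∃ t, V.card = d + t + 1 := ⟨V.card - d - 1, by omega⟩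
    have h2 := hS.nonAdjCount_le d t V ⟨hface, v, hv⟩ ht (by omega)
    have h3 : (2 * f₁ P + nonAdjCount (edgeGraph V) V V + V.card : ℚ) = V.card * V.card := by
      exact_mod_cast hf₁
    have h4 : (nonAdjCount (edgeGraph V) V V : ℚ) ≤ 2 * ((t + 1) * t) := by exact_mod_cast h2
    have h5 : (V.card : ℚ) = d + t + 1 := by exact_mod_cast ht
    rw [h5] at h3 ⊢
    nlinarith
  · rintro hd ⟨h1, h2⟩
    obtain ⟨k, rfl⟩ : ∃ k, d = k + 1 := ⟨d - 1, by omega⟩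
    have h3 : V.card = k + 5 := by
      have : (V.card : ℚ) = ((k + 5 : ℕ) : ℚ) := by rw [h1]; push_cast; ring
      exact_mod_cast this
    refine hS.nonAdjCount_ne (by omega) ⟨hface, Finset.card_pos.1 (by omega)⟩ h3 ?_
    have h4 : (2 * f₁ P + nonAdjCount (edgeGraph V) V V + V.card : ℚ) = V.card * V.card := by
      exact_mod_cast hf₁
    rw [h1, h2] at h4
    have h5 : (nonAdjCount (edgeGraph V) V V : ℚ) = 22 := by
      push_cast at h4
      linear_combination h4
    exact_mod_cast h5
end
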